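/- Let n ∈ ℕ, 1 ≤ p ≤ n, and 0 ≤ l ≤ n-2 < r ≤ 2n-3 with l + r < 2n-2 and r - l > n-3. Then the number of (n,l,r)-alternating sign pentagons P with ρ(P) = p equals the number of (0, n, r+2-n, r-l)-Magog pentagons M with τ(M) = p. -/

import Mathlib

open Finset

/-- An alternating sign triangle of order `n`: a triangular array with rows `i = 1,…,n`,
row `i` occupying columns `i,…,2n-i` (so the central column is column `n`).
Entries outside this region are `0`. -/
structure AST (n : ℕ) where
  entry : ℕ → ℕ → ℤ
  support : ∀ i j, entry i j ≠ 0 → 1 ≤ i ∧ i ≤ n ∧ i ≤ j ∧ j ≤ 2 * n - i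
  entries : ∀ i j, entry i j = -1 ∨ entry i j = 0 ∨ entry i j = 1
  rowSum : ∀ i, 1 ≤ i → i ≤ n → ∑ j ∈ Icc i (2 * n - i), entry i j = 1
  altRow : ∀ i j₁ j₂, j₁ < j₂ → entry i j₁ ≠ 0 → entry i j₂ ≠ 0 →
      (∀ j, j₁ < j → j < j₂ → entry i j = 0) → entry i j₁ * entry i j₂ = -1
  altCol : ∀ j i₁ i₂, i₁ < i₂ → entry i₁ j ≠ 0 → entry i₂ j ≠ 0 →
      (∀ i, i₁ < i → i < i₂ → entry i j = 0) → entry i₁ j * entry i₂ j = -1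
  topOne : ∀ i j, entry i j ≠ 0 → (∀ i', i' < i → entry i' j = 0) → entry i j = 1

namespace AST

variable {n : ℕ} (T : AST n)

/-- The sum of the entries of column `j`. -/
def colSum (j : ℕ) : ℤ := ∑ i ∈ Icc 1 n, T.entry i j

/-- The bottom entry of column `j` (the entry of column `j` with the largest row index). -/
def bottom (j : ℕ) : ℤ := T.entry (min j (2 * n - j)) j

/-- A `1`-column: a column summing to `1`. -/
def IsOneCol (j : ℕ) : Prop := T.colSum j = 1

/-- An `11`-column: a `1`-column with bottom entry `1`. -/
def IsElevenCol (j : ℕ) : Prop := T.colSum j = 1 ∧ T.bottom j = 1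

/-- A `10`-column: a `1`-column with bottom entry `0`. -/
def IsTenCol (j : ℕ) : Prop := T.colSum j = 1 ∧ T.bottom j = 0

instance : DecidablePred T.IsOneCol := fun j =>
  inferInstanceAs (Decidable (T.colSum j = 1))
instance : DecidablePred T.IsElevenCol := fun j =>
  inferInstanceAs (Decidable (T.colSum j = 1 ∧ T.bottom j = 1))
instance : DecidablePred T.IsTenCol := fun j =>
  inferInstanceAs (Decidable (T.colSum j = 1 ∧ T.bottom j = 0))

/-- The statistic `ρ`: `1` + (number of `11`-columns strictly left of the central column)
+ (number of `10`-columns strictly right of the central column). -/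
def rho : ℕ :=
  1 + ((Icc 1 (n - 1)).filter T.IsElevenCol).card
    + ((Icc (n + 1) (2 * n - 1)).filter T.IsTenCol).card

end AST

/-- The label in `{0,…,2n-3}` of the non-central column with natural index
`j ∈ {1,…,2n-1} \ {n}` of an AST of order `n` (labels go left to right, skipping the
central column). -/
def AST.label (n j : ℕ) : ℕ := if j < n then j - 1 else j - 2

namespace AST

variable {n : ℕ} (T : AST n)

/-- `T` is an `(n,l,r)`-alternating sign pentagon: every non-central `1`-column has its
label between `l` and `r`. -/
def IsASP (l r : ℕ) : Prop :=
  ∀ j, 1 ≤ j → j ≤ 2 * n - 1 → j ≠ n → T.IsOneCol j → l ≤ AST.label n j ∧ AST.label n j ≤ r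

end AST

/-- An `(m,n,k,l)`-Magog pentagon: the intersection of the top `k` rows and the first `l`
south-east diagonals (counted from the top right) of a Magog array of order `n`.
`entry j i` is the entry `a_{j,i}` (row `i`, with `i ≤ j ≤ n`); the cell `(j,i)` lies on
south-east diagonal `n - j + 2i - 1`, so it belongs to the pentagon iff `n + 2i ≤ l + j + 1`.
Rows are weakly increasing, (display-)columns are weakly decreasing, and the first row is
bounded by `a_{j,1} ≤ m + j`.  Cells of the trapezoid shape cut off by the diagonal
condition are (as in the defining array convention) equal to `1`; cells outside the
trapezoid shape are normalized to `0`.  An `(m,n,k)`-Magog trapezoid is the case `l = 2n-1`. -/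
structure MagogPentagon (m n k l : ℕ) where
  entry : ℕ → ℕ → ℕ
  pos : ∀ i j, 1 ≤ i → i ≤ k → i ≤ j → j ≤ n → n + 2 * i ≤ l + j + 1 → 1 ≤ entry j i
  rowInc : ∀ i j, 1 ≤ i → i ≤ k → i ≤ j → j + 1 ≤ n → n + 2 * i ≤ l + j + 1 →
      entry j i ≤ entry (j + 1) i
  colDec : ∀ i j, 1 ≤ i → i + 1 ≤ k → i ≤ j → j + 1 ≤ n → n + 2 * (i + 1) ≤ l + (j + 1) + 1 →
      entry (j + 1) (i + 1) ≤ entry j i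
  bound : ∀ j, 1 ≤ j → j ≤ n → entry j 1 ≤ m + j
  cut : ∀ i j, 1 ≤ i → i ≤ k → i ≤ j → j ≤ n → l + j + 1 < n + 2 * i → entry j i = 1
  outside : ∀ i j, ¬(1 ≤ i ∧ i ≤ k ∧ i ≤ j ∧ j ≤ n) → entry j i = 0

namespace MagogPentagon

/-- The statistic `τ(M) = n + ∑_{i=1}^{k} (a_{n-1,i} - a_{n,i})`. -/
def tau {m n k l : ℕ} (M : MagogPentagon m n k l) : ℤ :=
  (n : ℤ) + ∑ i ∈ Finset.Icc 1 k, ((M.entry (n - 1) i : ℤ) - (M.entry n i : ℤ))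

end MagogPentagon


section PartA

variable {R : Type*} [CommRing R]

/-- product over pairs `p < q` of `f (x p) (x q)` -/
def pairProd (f : R → R → R) {m : ℕ} (x : Fin m → R) : R :=
  ∏ p : Fin m, ∏ q ∈ Ioi p, f (x p) (x q)

/-- sum over `N > j_0 > … > j_{m-1} ≥ 0` of monomials -/
def hsum : (m : ℕ) → ℕ → (Fin m → R) → R
  | 0, _, _ => 1
  | _ + 1, 0, _ => 0
  | m + 1, N + 1, x => hsum (m + 1) N x + x 0 ^ N * hsum m N (fun i => x i.succ)

theorem hsum_zero (N : ℕ) (x : Fin 0 → R) : hsum 0 N x = 1 := by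
  cases N <;> rfl

theorem hsum_succ_zero (m : ℕ) (x : Fin (m + 1) → R) : hsum (m + 1) 0 x = 0 := rfl

theorem hsum_succ (m N : ℕ) (x : Fin (m + 1) → R) :
    hsum (m + 1) (N + 1) x = hsum (m + 1) N x + x 0 ^ N * hsum m N (fun i => x i.succ) := rfl

theorem pairProd_succ (f : R → R → R) {m : ℕ} (x : Fin (m + 1) → R) :
    pairProd f x = (∏ q : Fin m, f (x 0) (x q.succ)) * pairProd f (fun i => x i.succ) := by
  unfold pairProd
  rw [Fin.prod_univ_succ]
  congr 1
  · rw [Fin.prod_Ioi_zero]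
  · refine prod_congr rfl fun p _ => ?_
    rw [Fin.prod_Ioi_succ]

theorem pairProd_succAbove (f : R → R → R) (hf : ∀ x y, f x y = f y x) :
    ∀ (m : ℕ) (y : Fin (m + 1) → R) (k : Fin (m + 1)),
      pairProd f y = (∏ q : Fin m, f (y k) (y (k.succAbove q))) *
        pairProd f (y ∘ k.succAbove) := by
  intro m
  induction m with
  | zero => intro y k; simp [pairProd]
  | succ m ih =>
    intro y k
    refine Fin.cases ?_ (fun k => ?_) k
    · rw [pairProd_succ]; simp [Function.comp_def]
    · rw [pairProd_succ, ih _ k, pairProd_succ f (y ∘ k.succ.succAbove),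
        Fin.prod_univ_succ (fun q => f (y k.succ) (y (k.succ.succAbove q))),
        Fin.prod_univ_succAbove (fun q : Fin (m + 1) => f (y 0) (y q.succ)) k]
      simp only [Function.comp_def, Fin.succ_succAbove_zero, Fin.succ_succAbove_succ]
      rw [hf (y k.succ) (y 0)]
      ring

/-- antisymmetrizer -/
def asym {m : ℕ} (G : (Fin m → R) → R) (x : Fin m → R) : R :=
  ∑ σ : Equiv.Perm (Fin m), (Equiv.Perm.sign σ : ℤ) * G (x ∘ σ)

theorem perm_split_bij (m : ℕ) : Function.Bijective
    (fun kt : Fin (m + 1) × Equiv.Perm (Fin m) =>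
      ((Fin.cycleRange kt.1).symm * Equiv.Perm.decomposeFin.symm (0, kt.2) :
        Equiv.Perm (Fin (m + 1)))) := by
  rw [Fintype.bijective_iff_injective_and_card]
  constructor
  · rintro ⟨k, t⟩ ⟨k', t'⟩ h
    simp only at h
    have h0 := congrArg (fun s : Equiv.Perm (Fin (m + 1)) => s 0) h
    simp [Equiv.Perm.mul_apply] at h0
    subst h0
    have h1 := mul_left_cancel h
    have := Equiv.Perm.decomposeFin.symm.injective h1
    simpa using this
  · rw [Fintype.card_prod, Fintype.card_perm, Fintype.card_perm]
    simp [Nat.factorial_succ]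

theorem asym_succ {m : ℕ} (G : (Fin (m + 1) → R) → R) (x : Fin (m + 1) → R) :
    asym G x = ∑ k : Fin (m + 1), (-1) ^ (k : ℕ) *
      asym (fun y : Fin m → R => G (Fin.cons (x k) y)) (x ∘ k.succAbove) := by
  unfold asym
  rw [← (Equiv.ofBijective _ (perm_split_bij m)).sum_comp, Fintype.sum_prod_type]
  refine sum_congr rfl fun k _ => ?_
  rw [mul_sum]
  refine sum_congr rfl fun t _ => ?_
  rw [Equiv.ofBijective_apply, ← mul_assoc]
  congr 1
  · simp [Equiv.Perm.decomposeFin.symm_sign, Fin.sign_cycleRange]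
  · congr 1
    funext i
    refine Fin.cases ?_ (fun j => ?_) i
    · simp
    · simp [Fin.cycleRange_symm_succ]

theorem asym_zero (G : (Fin 0 → R) → R) (x : Fin 0 → R) : asym G x = G x := by
  unfold asym
  rw [Fintype.sum_unique]
  simp

theorem asym_add {m : ℕ} (G H : (Fin m → R) → R) (x : Fin m → R) :
    asym (fun y => G y + H y) x = asym G x + asym H x := by
  simp [asym, mul_add, sum_add_distrib]

theorem prod_perm_comp {m : ℕ} (g : R → R) (x : Fin m → R) (σ : Equiv.Perm (Fin m)) :
    ∏ q, g ((x ∘ σ) q) = ∏ q, g (x q) := Equiv.prod_comp σ (fun q => g (x q))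

/-- The antisymmetrization of `R * h`. -/
def Lsum (f : R → R → R) (m N : ℕ) (x : Fin m → R) : R :=
  asym (fun y => pairProd f y * hsum m N y) x

theorem Lsum_zero (f : R → R → R) (N : ℕ) (x : Fin 0 → R) : Lsum f 0 N x = 1 := by
  simp [Lsum, asym_zero, hsum_zero, pairProd]

theorem Lsum_succ_zero (f : R → R → R) (m : ℕ) (x : Fin (m + 1) → R) :
    Lsum f (m + 1) 0 x = 0 := by
  simp [Lsum, asym, hsum_succ_zero]

theorem Lsum_succ (f : R → R → R) (m N : ℕ) (x : Fin (m + 1) → R) :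
    Lsum f (m + 1) (N + 1) x = Lsum f (m + 1) N x +
      ∑ k : Fin (m + 1), (-1) ^ (k : ℕ) * (x k ^ N * (∏ q : Fin m, f (x k) (x (k.succAbove q))) *
        Lsum f m N (x ∘ k.succAbove)) := by
  unfold Lsum
  simp_rw [hsum_succ, mul_add]
  rw [asym_add, asym_succ (fun y : Fin (m+1) → R => pairProd f y * (y 0 ^ N * _))]
  congr 1
  refine sum_congr rfl fun k _ => ?_
  congr 1
  unfold asym
  rw [mul_sum]
  refine sum_congr rfl fun σ _ => ?_
  beta_reduce
  rw [pairProd_succ]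
  simp only [Fin.cons_zero, Fin.cons_succ]
  rw [prod_perm_comp (fun y => f (x k) y)]
  simp only [Function.comp_apply, Function.comp_def]
  ring

/-- `Φ` as a determinant-like sum over signs; vandermonde product. -/
def vand {m : ℕ} (u : Fin m → R) : R := pairProd (fun a b => b - a) u

theorem det_vand {m : ℕ} (u : Fin m → R) : (Matrix.vandermonde u).det = vand u :=
  Matrix.det_vandermonde u

theorem vand_succAbove {m : ℕ} (u : Fin (m + 1) → R) (k : Fin (m + 1)) :
    vand u = (-1) ^ (k : ℕ) * (∏ q : Fin m, (u (k.succAbove q) - u k)) *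
      vand (u ∘ k.succAbove) := by
  have h1 : vand (u ∘ k.cycleRange.symm) = (-1) ^ (k : ℕ) * vand u := by
    rw [← det_vand, ← det_vand]
    have := Matrix.det_permute k.cycleRange.symm (Matrix.vandermonde u)
    simp only [Equiv.Perm.sign_symm, Fin.sign_cycleRange] at this
    push_cast at this
    rw [← this]
    rfl
  have h2 : vand (u ∘ k.cycleRange.symm) = (∏ q : Fin m, (u (k.succAbove q) - u k)) *
      vand (u ∘ k.succAbove) := by
    unfold vand
    rw [pairProd_succ]
    simp [Fin.cycleRange_symm_succ, Function.comp_def]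
  rw [h1] at h2
  rw [mul_assoc, ← h2, ← mul_assoc, ← pow_add, Even.neg_one_pow ⟨_, rfl⟩, one_mul]

theorem det_bool_expand {m : ℕ} (a b c : Fin m → R) :
    (Matrix.of fun p (i : Fin m) => b p ^ (i : ℕ) + c p * a p ^ (i : ℕ)).det =
      ∑ ε : Fin m → Bool, (∏ p, if ε p then c p else 1) *
        vand (fun p => if ε p then a p else b p) := by
  have := (Matrix.detRowAlternating (n := Fin m) (R := R)).toMultilinearMap.map_sum
    (fun p (e : Bool) (i : Fin m) => if e then c p * a p ^ (i : ℕ) else b p ^ (i : ℕ))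
  simp only [Fintype.sum_bool] at this
  have h1 : (Matrix.of fun p (i : Fin m) => b p ^ (i : ℕ) + c p * a p ^ (i : ℕ)).det =
    ∑ ε : Fin m → Bool, (Matrix.of fun p (i : Fin m) =>
      (if ε p then c p * a p ^ (i : ℕ) else b p ^ (i : ℕ))).det := by
    refine Eq.trans ?_ this
    change Matrix.det _ = Matrix.det _
    congr 1
    ext p i
    simp [add_comm]
  rw [h1]
  refine sum_congr rfl fun ε _ => ?_
  rw [← det_vand, ← Matrix.det_mul_column]
  congr 1
  ext p i
  by_cases h : ε p <;> simp [h, Matrix.vandermonde_apply]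

end PartA


section PartA2

variable {F : Type*} [Field F]

/-- the determinant `Φ` in boolean-expanded form -/
def PhiB (a b : F → F) (w : F → F) (m N : ℕ) (x : Fin m → F) : F :=
  ∑ ε : Fin m → Bool, (∏ p, if ε p then -(x p ^ N * w (x p) ^ m / w (x p)) else 1) *
    vand (fun p => if ε p then a (x p) else b (x p))

/-- sign -/
def epsg : ℕ → ℤ
  | 0 => 1
  | m + 1 => (-1) ^ m * epsg m

theorem PhiB_det (a b w : F → F) (m N : ℕ) (x : Fin m → F) :
    PhiB a b w m N x = (Matrix.of fun p (i : Fin m) =>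
      b (x p) ^ (i : ℕ) + -(x p ^ N * w (x p) ^ m / w (x p)) * a (x p) ^ (i : ℕ)).det := by
  rw [det_bool_expand (fun p => a (x p)) (fun p => b (x p))]
  rfl

theorem PhiB_base (a b w : F → F) (m : ℕ) (x : Fin (m + 1) → F) (hw : ∀ p, w (x p) ≠ 0)
    (h2 : ∀ p, 1 + b (x p) = w (x p) * (1 + a (x p))) : PhiB a b w (m + 1) 0 x = 0 := by
  rw [PhiB_det, ← Matrix.exists_mulVec_eq_zero_iff]
  refine ⟨fun i => (m.choose i : F), ?_, ?_⟩
  · intro h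
    have := congrFun h 0
    simp at this
  · funext p
    simp only [Matrix.mulVec, dotProduct, Matrix.of_apply, Pi.zero_apply, add_mul, sum_add_distrib]
    have e1 : ∀ y : F, ∑ i : Fin (m + 1), y ^ (i : ℕ) * (m.choose i : F) = (1 + y) ^ m := by
      intro y
      rw [add_comm 1 y, add_pow, ← Fin.sum_univ_eq_sum_range (fun i => y ^ i * 1 ^ (m - i) * (m.choose i : F))]
      simp
    simp only [mul_assoc, ← mul_sum]
    rw [e1, e1, h2 p, pow_succ, mul_pow]
    field_simp [hw p]
    ring

def factorAB (a b w : F → F) (k q : F) : F := (w q)⁻¹ * (b q - a k) / (a q - a k)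

theorem PhiB_step {ι : Type*} [DecidableEq ι] (a b w : F → F) (X : ι → F)
    (hw : ∀ i, w (X i) ≠ 0) (hinj : ∀ i j, i ≠ j → a (X i) ≠ a (X j))
    (star : ∀ S : Finset ι, 1 - ∏ i ∈ S, X i =
      ∑ k ∈ S, (1 - X k) * ∏ q ∈ S.erase k, factorAB a b w (X k) (X q))
    (m N : ℕ) (g : Fin (m + 1) → ι) (hg : Function.Injective g) :
    PhiB a b w (m + 1) (N + 1) (X ∘ g) = PhiB a b w (m + 1) N (X ∘ g) +
      ∑ k : Fin (m + 1), (-1) ^ (k : ℕ) * (X (g k) ^ N * w (X (g k)) ^ m) * (1 - X (g k)) *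
        (∏ q : Fin m, (b (X (g (k.succAbove q))) - a (X (g k)))) *
        PhiB a b w m N (X ∘ g ∘ k.succAbove) := by
  -- main coefficient
  let C : (Fin (m + 1) → Bool) → F := fun ε =>
    (∏ p, if ε p then -(X (g p) ^ N * w (X (g p)) ^ m) else 1) *
      vand (fun p => if ε p then a (X (g p)) else b (X (g p)))
  have hN : PhiB a b w (m + 1) N (X ∘ g) = ∑ ε, C ε := by
    unfold PhiB
    refine sum_congr rfl fun ε _ => ?_
    simp only [C, Function.comp_apply]
    congr 1
    refine prod_congr rfl fun p _ => ?_
    split_ifs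
    · rw [pow_succ]; field_simp [hw (g p)]
    · rfl
  have hN1 : PhiB a b w (m + 1) (N + 1) (X ∘ g) =
      ∑ ε, C ε * ∏ p ∈ univ.filter (fun p => ε p = true), X (g p) := by
    unfold PhiB
    refine sum_congr rfl fun ε _ => ?_
    simp only [C, Function.comp_apply]
    rw [prod_filter, mul_right_comm, ← prod_mul_distrib]
    congr 1
    refine prod_congr rfl fun p _ => ?_
    split_ifs
    · rw [pow_succ, pow_succ]; field_simp [hw (g p)]
    · simp
  have hterm : ∀ k : Fin (m + 1),
      (-1) ^ (k : ℕ) * (X (g k) ^ N * w (X (g k)) ^ m) * (1 - X (g k)) *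
        (∏ q : Fin m, (b (X (g (k.succAbove q))) - a (X (g k)))) *
        PhiB a b w m N (X ∘ g ∘ k.succAbove) =
      ∑ ε : Fin (m + 1) → Bool, if ε k = true then - C ε * ((1 - X (g k)) *
        ∏ q ∈ (univ.filter (fun p => ε p = true)).erase k, factorAB a b w (X (g k)) (X (g q)))
        else 0 := by
    intro k
    rw [← (Fin.insertNthEquiv (fun _ => Bool) k).sum_comp, Fintype.sum_prod_type]
    simp only [Fintype.sum_bool, Fin.insertNthEquiv_apply, Fin.insertNth_apply_same, if_true]
    simp only [Bool.false_eq_true, if_false, sum_const_zero, add_zero]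
    unfold PhiB
    rw [mul_sum]
    refine sum_congr rfl fun ε _ => ?_
    have hfil : (univ.filter (fun p => (Fin.insertNth k true ε : Fin (m + 1) → Bool) p = true)).erase k
        = (univ.filter (fun q => ε q = true)).map k.succAboveEmb := by
      ext p
      refine Fin.succAboveCases k ?_ (fun q => ?_) p
      · simp [Fin.succAbove_ne]
      · simp [Fin.succAbove_ne]
    rw [hfil, prod_map]
    simp only [C]
    rw [vand_succAbove _ k, Fin.prod_univ_succAbove _ k]
    have hsm : (Fin.insertNthEquiv (fun _ => Bool) k) (true, ε) k = true := by simp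
    have hsa : ∀ q, (Fin.insertNthEquiv (fun _ => Bool) k) (true, ε) (k.succAbove q) = ε q := by simp
    simp only [hsm, hsa, if_true, Fin.succAboveEmb_apply, Function.comp_def]
    rw [prod_filter]
    have key : (∏ q : Fin m, (b (X (g (k.succAbove q))) - a (X (g k)))) *
        (∏ p, if ε p then -(X (g (k.succAbove p)) ^ N * w (X (g (k.succAbove p))) ^ m /
          w (X (g (k.succAbove p)))) else 1) =
        (∏ p, if ε p then -(X (g (k.succAbove p)) ^ N * w (X (g (k.succAbove p))) ^ m) else 1) *
        (∏ q : Fin m, ((if ε q then a (X (g (k.succAbove q))) else b (X (g (k.succAbove q)))) -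
          a (X (g k)))) *
        ∏ q : Fin m, if ε q = true then factorAB a b w (X (g k)) (X (g (k.succAbove q))) else 1 := by
      rw [← prod_mul_distrib, ← prod_mul_distrib, ← prod_mul_distrib]
      refine prod_congr rfl fun q _ => ?_
      split_ifs
      · have h1 : a (X (g (k.succAbove q))) - a (X (g k)) ≠ 0 :=
          sub_ne_zero.2 (hinj _ _ (fun h => Fin.succAbove_ne k q (hg h)))
        have h2 := hw (g (k.succAbove q))
        unfold factorAB
        field_simp
      · simp
    linear_combination (-1) ^ (k : ℕ) * (X (g k) ^ N * w (X (g k)) ^ m) * (1 - X (g k)) *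
      vand (fun p => if ε p then a (X (g (k.succAbove p))) else b (X (g (k.succAbove p)))) * key
  rw [hN, hN1]
  simp_rw [hterm]
  rw [sum_comm, ← sum_add_distrib]
  refine sum_congr rfl fun ε _ => ?_
  have st := star ((univ.filter (fun p => ε p = true)).map ⟨g, hg⟩)
  rw [sum_map, prod_map] at st
  have hst : ∀ k, ((univ.filter (fun p => ε p = true)).map ⟨g, hg⟩).erase (g k) =
      ((univ.filter (fun p => ε p = true)).erase k).map ⟨g, hg⟩ :=
    fun k => (map_erase ⟨g, hg⟩ _ k).symm
  simp only [Function.Embedding.coeFn_mk, hst, prod_map] at st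
  rw [← sum_filter, ← mul_sum, ← st]
  ring

theorem Lsum_eq_PhiB {ι : Type*} [DecidableEq ι] (f : F → F → F) (a b w : F → F) (X : ι → F)
    (hw : ∀ i, w (X i) ≠ 0) (hinj : ∀ i j, i ≠ j → a (X i) ≠ a (X j))
    (star : ∀ S : Finset ι, 1 - ∏ i ∈ S, X i =
      ∑ k ∈ S, (1 - X k) * ∏ q ∈ S.erase k, factorAB a b w (X k) (X q))
    (h1 : ∀ i j, f (X i) (X j) * (1 - X i * X j) = - w (X i) * (b (X j) - a (X i)))
    (h2 : ∀ i, 1 + b (X i) = w (X i) * (1 + a (X i)))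
    (N : ℕ) : ∀ (m : ℕ) (g : Fin m → ι) (_ : Function.Injective g),
    Lsum f m N (X ∘ g) * ((∏ p, (1 - X (g p))) * pairProd (fun x y => 1 - x * y) (X ∘ g)) =
      epsg m * PhiB a b w m N (X ∘ g) := by
  have hsymm := fun m (y : Fin (m + 1) → F) (k : Fin (m + 1)) =>
    pairProd_succAbove (fun x y : F => 1 - x * y) (fun x y => by ring) m y k
  induction N with
  | zero =>
    intro m g hg
    cases m with
    | zero => simp [Lsum_zero, pairProd, epsg, PhiB, vand]
    | succ m => rw [Lsum_succ_zero, PhiB_base a b w m (X ∘ g) (fun p => hw _) (fun p => h2 _)]; simp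
  | succ N ih =>
    intro m g hg
    cases m with
    | zero => simp [Lsum_zero, pairProd, epsg, PhiB, vand]
    | succ m =>
      rw [Lsum_succ, PhiB_step a b w X hw hinj star m N g hg, add_mul, mul_add, ih _ g hg]
      congr 1
      rw [sum_mul, mul_sum]
      refine sum_congr rfl fun k _ => ?_
      have ihk := ih m (g ∘ k.succAbove) (hg.comp Fin.succAbove_right_injective)
      rw [hsymm m _ k, Fin.prod_univ_succAbove _ k]
      have hf : (∏ q : Fin m, f (X (g k)) (X (g (k.succAbove q)))) *
          (∏ q : Fin m, (1 - X (g k) * X (g (k.succAbove q)))) =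
          (-1) ^ m * w (X (g k)) ^ m * ∏ q : Fin m, (b (X (g (k.succAbove q))) - a (X (g k))) := by
        rw [← prod_mul_distrib, ← mul_pow, neg_one_mul]
        simp_rw [h1]
        rw [prod_mul_distrib]
        simp
      simp only [Function.comp_apply, Function.comp_def, epsg] at ihk hf ⊢
      push_cast
      linear_combination (-1) ^ (k : ℕ) * X (g k) ^ N * (1 - X (g k)) *
        (Lsum f m N fun q => X (g (k.succAbove q))) * (∏ i : Fin m, (1 - X (g (k.succAbove i)))) *
        (pairProd (fun x y => 1 - x * y) fun q => X (g (k.succAbove q))) * hf +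
        (-1) ^ (k : ℕ) * X (g k) ^ N * (1 - X (g k)) * (-1) ^ m * w (X (g k)) ^ m *
        (∏ q : Fin m, (b (X (g (k.succAbove q))) - a (X (g k)))) * ihk

end PartA2


section PartA3

variable {F : Type*} [Field F]

theorem lagrange_extra {ι : Type*} [DecidableEq ι] (S : Finset ι) (v α β : ι → F) (z : F)
    (hv : ∀ i j, i ≠ j → v i ≠ v j) (hz : ∀ i, v i ≠ z) :
    ∏ i ∈ S, α i = ∑ k ∈ S, (∏ q ∈ S, (α q * v k + β q)) /
      ((v k - z) * ∏ q ∈ S.erase k, (v k - v q)) + ∏ q ∈ S, ((α q * z + β q) / (z - v q)) := by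
  have hinj : Set.InjOn (fun o : Option ι => o.elim z v) (insertNone S : Finset (Option ι)) := by
    rintro (_ | i) _ (_ | j) _ h
    · rfl
    · exact absurd h.symm (hz j)
    · exact absurd h (hz i)
    · by_contra hne
      exact hv i j (fun h => hne (by rw [h])) h
  let P : Polynomial F := ∏ q ∈ S, (Polynomial.C (α q) * Polynomial.X + Polynomial.C (β q))
  have hd : P.natDegree ≤ #S := by
    refine (Polynomial.natDegree_prod_le _ _).trans ?_
    refine (sum_le_sum (fun q _ => Polynomial.natDegree_linear_le)).trans ?_
    simp
  have hlt : P.degree < #(insertNone S) := by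
    rw [card_insertNone]
    refine lt_of_le_of_lt Polynomial.degree_le_natDegree ?_
    exact_mod_cast Nat.lt_succ_of_le hd
  have key := Lagrange.coeff_eq_sum hinj hlt
  rw [card_insertNone, Nat.add_sub_cancel] at key
  have hc : P.coeff #S = ∏ i ∈ S, α i := by
    have := Polynomial.coeff_prod_of_natDegree_le S
      (fun q => Polynomial.C (α q) * Polynomial.X + Polynomial.C (β q)) 1
      (fun q _ => Polynomial.natDegree_linear_le)
    simpa [P] using this
  have hev : ∀ y, P.eval y = ∏ q ∈ S, (α q * y + β q) := by
    intro y; simp [P, Polynomial.eval_prod]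
  rw [hc] at key
  rw [key]
  have hins : insertNone S = insert none (S.map Function.Embedding.some) := by
    ext o; cases o <;> simp
  have hnone : (none : Option ι) ∉ S.map Function.Embedding.some := by simp
  simp only [hins]
  rw [sum_insert hnone, erase_insert hnone, sum_map, prod_map, add_comm]
  congr 1
  · refine sum_congr rfl fun k _ => ?_
    have h1 : (insert none (S.map Function.Embedding.some)).erase (Function.Embedding.some k) =
        insert none ((S.erase k).map Function.Embedding.some) := by
      ext o; cases o <;> simp
    rw [h1, prod_insert (by simp), prod_map, hev]
    rfl
  · rw [hev, prod_div_distrib]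
    rfl

theorem star_of {ι : Type*} [DecidableEq ι] (X v α β γ : ι → F) (z : F) (fac : ι → ι → F)
    (hv : ∀ i j, i ≠ j → v i ≠ v j) (hz : ∀ i, v i ≠ z) (hγ : ∀ i, γ i ≠ 0)
    (h1 : ∀ k q, k ≠ q → α q * v k + β q = γ q * fac k q * (v k - v q))
    (h2 : ∀ q, α q * z + β q = γ q * (z - v q))
    (h3 : ∀ q, α q = γ q * X q)
    (h4 : ∀ k, α k * v k + β k = - (γ k * (1 - X k)) * (v k - z)) (S : Finset ι) :
    1 - ∏ i ∈ S, X i = ∑ k ∈ S, (1 - X k) * ∏ q ∈ S.erase k, fac k q := by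
  have key := lagrange_extra S v α β z hv hz
  have e1 : ∏ q ∈ S, ((α q * z + β q) / (z - v q)) = ∏ q ∈ S, γ q := by
    refine prod_congr rfl fun q _ => ?_
    rw [h2, mul_div_assoc, div_self (sub_ne_zero.2 (hz q).symm), mul_one]
  have e2 : ∀ k ∈ S, (∏ q ∈ S, (α q * v k + β q)) /
      ((v k - z) * ∏ q ∈ S.erase k, (v k - v q)) =
      - (∏ q ∈ S, γ q) * ((1 - X k) * ∏ q ∈ S.erase k, fac k q) := by
    intro k hk
    rw [← mul_prod_erase S _ hk, ← mul_prod_erase S γ hk, h4]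
    have : ∏ q ∈ S.erase k, (α q * v k + β q) = (∏ q ∈ S.erase k, γ q) *
        (∏ q ∈ S.erase k, fac k q) * ∏ q ∈ S.erase k, (v k - v q) := by
      rw [← prod_mul_distrib, ← prod_mul_distrib]
      exact prod_congr rfl fun q hq => h1 k q (ne_of_mem_erase hq).symm
    rw [this]
    have n1 : v k - z ≠ 0 := sub_ne_zero.2 (hz k)
    have n2 : ∏ q ∈ S.erase k, (v k - v q) ≠ 0 :=
      prod_ne_zero_iff.2 fun q hq => sub_ne_zero.2 (hv k q (ne_of_mem_erase hq).symm)
    field_simp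
  rw [e1, sum_congr rfl e2, prod_congr rfl (fun q _ => h3 q), prod_mul_distrib, ← mul_sum] at key
  have hn : ∏ q ∈ S, γ q ≠ 0 := prod_ne_zero_iff.2 fun q _ => hγ q
  apply mul_left_cancel₀ hn
  linear_combination -key

theorem Lsum_field_one {m : ℕ} (x : Fin m → F) (h0 : ∀ i, x i ≠ 0) (h1 : ∀ i, 1 + x i ≠ 0)
    (hinj : ∀ i j, i ≠ j → x i ≠ x j) (N : ℕ) :
    Lsum (fun _ _ => 1) m N x * ((∏ p, (1 - x p)) * pairProd (fun x y => 1 - x * y) x) =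
      epsg m * (Matrix.of fun p (i : Fin m) => x p ^ (i : ℕ) - x p ^ (N + (m - 1) - i)).det := by
  have := Lsum_eq_PhiB (fun _ _ => 1) (fun x => x⁻¹) (fun x => x) (fun x : F => x) x
    h0 (fun i j h => fun h' => hinj i j h (inv_injective h'))
    (star_of x x x (fun _ => -1) (fun _ => 1) (-1) _ hinj
      (fun i h => h1 i (by rw [h]; ring)) (fun _ => one_ne_zero)
      (fun k q h => by
        have n1 := h0 k
        have n2 := h0 q
        have n3 := sub_ne_zero.2 (hinj k q h)
        have n4 : (x q)⁻¹ - (x k)⁻¹ ≠ 0 := sub_ne_zero.2 (fun h' => hinj k q h (inv_injective h').symm)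
        unfold factorAB
        field_simp
        ring) (fun q => by ring) (fun q => by ring) (fun q => by ring))
    (fun i j => by have := h0 i; field_simp; ring) (fun i => by have := h0 i; field_simp; ring)
    N m id Function.injective_id
  rw [PhiB_det] at this
  simp only [Function.comp_id, id] at this
  rw [this]
  congr 2
  ext p i
  simp only [Matrix.of_apply]
  have n1 := h0 p
  have hi : (i : ℕ) + 1 ≤ m := i.2
  have e1 : x p ^ (N + (m - 1) - i) * x p ^ (i : ℕ) = x p ^ N * x p ^ (m - 1) := by
    rw [← pow_add, ← pow_add]; congr 1; omega
  have e2 : x p ^ m = x p ^ (m - 1) * x p := by rw [← pow_succ]; congr 1; omega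
  rw [e2, inv_pow]
  field_simp
  linear_combination e1

theorem Lsum_field_two {m : ℕ} (x : Fin m → F) (h0 : ∀ i, x i ≠ 0) (h1 : ∀ i, 1 + x i ≠ 0)
    (h2 : ∀ i, 1 + x i + x i ^ 2 ≠ 0)
    (hinj : ∀ i j, i ≠ j → x i ≠ x j) (h3 : ∀ i j, i ≠ j → x i + x j + x i * x j ≠ 0) (N : ℕ) :
    Lsum (fun x y => 1 + x + x * y) m N x *
      ((∏ p, (1 - x p)) * pairProd (fun x y => 1 - x * y) x) =
      epsg m * (Matrix.of fun p (i : Fin m) => (x p * (1 + x p)) ^ (i : ℕ) -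
        x p ^ (N + 2 * (m - 1) - 2 * i) * (1 + x p) ^ (i : ℕ)).det := by
  have hv : ∀ i j, i ≠ j → (1 + x i) + (1 + x i)⁻¹ ≠ (1 + x j) + (1 + x j)⁻¹ := by
    intro i j h h'
    have n1 := h1 i
    have n2 := h1 j
    have n3 := sub_ne_zero.2 (hinj i j h)
    have n4 := h3 i j h
    field_simp at h'
    have : (x i - x j) * (x i + x j + x i * x j) = 0 := by linear_combination h'
    simp [n3, n4] at this
  have ha : ∀ i j, i ≠ j → (x i)⁻¹ * (1 + (x i)⁻¹) ≠ (x j)⁻¹ * (1 + (x j)⁻¹) := by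
    intro i j h h'
    have n1 := h0 i
    have n2 := h0 j
    have n3 := sub_ne_zero.2 (hinj i j h)
    have n4 := h3 i j h
    field_simp at h'
    have : (x i - x j) * (x i + x j + x i * x j) = 0 := by linear_combination -h'
    simp [n3, n4] at this
  have := Lsum_eq_PhiB (fun x y => 1 + x + x * y) (fun x => x⁻¹ * (1 + x⁻¹))
    (fun x => x * (1 + x)) (fun x : F => x ^ 2) x
    (fun i => pow_ne_zero 2 (h0 i)) ha
    (star_of x (fun i => (1 + x i) + (1 + x i)⁻¹) (fun i => - (1 + x i) * x i)
      (fun i => 2 * (1 + x i) ^ 2 - 2 * (1 + x i) + 1) (fun i => - (1 + x i)) 1 _ hv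
      (fun i h => by
        have n1 := h1 i
        field_simp at h
        apply h2 i
        linear_combination h) (fun i => neg_ne_zero.2 (h1 i))
      (fun k q h => by
        have n1 := h0 k
        have n2 := h0 q
        have n3 := sub_ne_zero.2 (ha q k h.symm)
        have n5 := h1 k
        have n6 := h1 q
        have n7 := sub_ne_zero.2 (hinj q k h.symm)
        have n8 := h3 q k h.symm
        have e : (x q)⁻¹ * (1 + (x q)⁻¹) - (x k)⁻¹ * (1 + (x k)⁻¹) =
          - ((x q - x k) * (x q + x k + x q * x k)) / (x q ^ 2 * x k ^ 2) := by
          field_simp; ring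
        unfold factorAB
        rw [e]
        field_simp
        ring)
      (fun q => by have n6 := h1 q; field_simp; ring) (fun q => by ring)
      (fun q => by have n6 := h1 q; field_simp; ring))
    (fun i j => by have := h0 i; field_simp; ring) (fun i => by have := h0 i; field_simp; ring)
    N m id Function.injective_id
  rw [PhiB_det] at this
  simp only [Function.comp_id, id] at this
  rw [this]
  congr 2
  ext p i
  simp only [Matrix.of_apply]
  have n1 := h0 p
  have hi : (i : ℕ) + 1 ≤ m := i.2
  have e1 : x p ^ (N + 2 * (m - 1) - 2 * i) * x p ^ (2 * (i : ℕ)) = x p ^ N * x p ^ (2 * (m - 1)) := by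
    rw [← pow_add, ← pow_add]; congr 1; omega
  have e2 : (x p ^ 2) ^ m = x p ^ (2 * (m - 1)) * x p ^ 2 := by
    rw [← pow_add, ← pow_mul]; congr 1; omega
  have e3 : (x p)⁻¹ * (1 + (x p)⁻¹) = (1 + x p) / x p ^ 2 := by field_simp; ring
  rw [e2, e3, div_pow, ← pow_mul]
  field_simp
  linear_combination (1 + x p) ^ (i : ℕ) * e1

end PartA3


section PartA4

variable {R S : Type*} [CommRing R] [CommRing S]

theorem map_pairProd (φ : R →+* S) (f : R → R → R) (g : S → S → S)
    (h : ∀ x y, φ (f x y) = g (φ x) (φ y)) {m : ℕ} (x : Fin m → R) :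
    φ (pairProd f x) = pairProd g (φ ∘ x) := by
  simp [pairProd, map_prod, h]

theorem map_hsum (φ : R →+* S) (m N : ℕ) (x : Fin m → R) :
    φ (hsum m N x) = hsum m N (φ ∘ x) := by
  induction N generalizing m with
  | zero => cases m <;> simp [hsum]
  | succ N ih =>
    cases m with
    | zero => simp [hsum]
    | succ m => simp [hsum_succ, ih, Function.comp_def]

theorem map_Lsum (φ : R →+* S) (f : R → R → R) (g : S → S → S)
    (h : ∀ x y, φ (f x y) = g (φ x) (φ y)) (m N : ℕ) (x : Fin m → R) :
    φ (Lsum f m N x) = Lsum g m N (φ ∘ x) := by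
  unfold Lsum asym
  simp only [map_sum, map_mul, map_intCast, map_pairProd φ f g h, map_hsum]
  rfl

/-- The determinant `Φ`, for e = 2. -/
def PhiTwo (m N : ℕ) (x : Fin m → R) : R :=
  (Matrix.of fun p (i : Fin m) => (x p * (1 + x p)) ^ (i : ℕ) -
        x p ^ (N + 2 * (m - 1) - 2 * i) * (1 + x p) ^ (i : ℕ)).det

def PhiOne (m N : ℕ) (x : Fin m → R) : R :=
  (Matrix.of fun p (i : Fin m) => x p ^ (i : ℕ) - x p ^ (N + (m - 1) - i)).det

def denP {m : ℕ} (x : Fin m → R) : R :=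
  (∏ p, (1 - x p)) * pairProd (fun x y => 1 - x * y) x

theorem map_PhiTwo (φ : R →+* S) (m N : ℕ) (x : Fin m → R) :
    φ (PhiTwo m N x) = PhiTwo m N (φ ∘ x) := by
  unfold PhiTwo
  rw [RingHom.map_det]
  congr 1
  ext p i
  simp

theorem map_PhiOne (φ : R →+* S) (m N : ℕ) (x : Fin m → R) :
    φ (PhiOne m N x) = PhiOne m N (φ ∘ x) := by
  unfold PhiOne
  rw [RingHom.map_det]
  congr 1
  ext p i
  simp

theorem map_denP (φ : R →+* S) {m : ℕ} (x : Fin m → R) :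
    φ (denP x) = denP (φ ∘ x) := by
  unfold denP
  rw [map_mul, map_pairProd φ _ (fun x y => 1 - x * y) (by simp)]
  simp [map_prod]

theorem mvpoly_ne_zero_of_eval {m : ℕ} (P : MvPolynomial (Fin m) ℤ) (v : ℤ)
    (h : MvPolynomial.eval (fun _ => v) P ≠ 0) : P ≠ 0 := by
  rintro rfl; simp at h

theorem Lsum_two (m N : ℕ) (x : Fin m → R) :
    Lsum (fun x y => 1 + x + x * y) m N x * denP x = epsg m * PhiTwo m N x := by
  have hpoly : Lsum (fun x y => 1 + x + x * y) m N (MvPolynomial.X : Fin m → MvPolynomial (Fin m) ℤ) *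
      denP MvPolynomial.X = (epsg m : MvPolynomial (Fin m) ℤ) * PhiTwo m N MvPolynomial.X := by
    let Q := FractionRing (MvPolynomial (Fin m) ℤ)
    let φ := algebraMap (MvPolynomial (Fin m) ℤ) Q
    have hφ : Function.Injective φ := IsFractionRing.injective _ _
    apply hφ
    rw [map_mul, map_mul, map_Lsum φ _ (fun x y => 1 + x + x * y) (by simp), map_denP, map_PhiTwo]
    simp only [map_intCast]
    apply Lsum_field_two
    · intro i
      exact (map_ne_zero_iff φ hφ).2 (MvPolynomial.X_ne_zero i)
    · intro i
      have : φ (1 + MvPolynomial.X i) ≠ 0 :=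
        (map_ne_zero_iff φ hφ).2 (mvpoly_ne_zero_of_eval _ 1 (by simp))
      simpa using this
    · intro i
      have : φ (1 + MvPolynomial.X i + MvPolynomial.X i ^ 2) ≠ 0 :=
        (map_ne_zero_iff φ hφ).2 (mvpoly_ne_zero_of_eval _ 1 (by simp))
      simpa using this
    · intro i j hij h
      exact hij (MvPolynomial.X_injective (hφ h))
    · intro i j _
      have : φ (MvPolynomial.X i + MvPolynomial.X j + MvPolynomial.X i * MvPolynomial.X j) ≠ 0 :=
        (map_ne_zero_iff φ hφ).2 (mvpoly_ne_zero_of_eval _ 1 (by simp))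
      simpa using this
  have := congrArg (MvPolynomial.eval₂Hom (Int.castRingHom R) x) hpoly
  rw [map_mul, map_mul, map_Lsum _ _ (fun x y => 1 + x + x * y) (by simp), map_denP, map_PhiTwo,
    map_intCast] at this
  have hx : (MvPolynomial.eval₂Hom (Int.castRingHom R) x) ∘ MvPolynomial.X = x := by
    funext i; simp
  rwa [hx] at this

theorem Lsum_one (m N : ℕ) (x : Fin m → R) :
    Lsum (fun _ _ => 1) m N x * denP x = epsg m * PhiOne m N x := by
  have hpoly : Lsum (fun _ _ => 1) m N (MvPolynomial.X : Fin m → MvPolynomial (Fin m) ℤ) *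
      denP MvPolynomial.X = (epsg m : MvPolynomial (Fin m) ℤ) * PhiOne m N MvPolynomial.X := by
    let Q := FractionRing (MvPolynomial (Fin m) ℤ)
    let φ := algebraMap (MvPolynomial (Fin m) ℤ) Q
    have hφ : Function.Injective φ := IsFractionRing.injective _ _
    apply hφ
    rw [map_mul, map_mul, map_Lsum φ _ (fun _ _ => 1) (by simp), map_denP, map_PhiOne]
    simp only [map_intCast]
    apply Lsum_field_one
    · intro i
      exact (map_ne_zero_iff φ hφ).2 (MvPolynomial.X_ne_zero i)
    · intro i
      have : φ (1 + MvPolynomial.X i) ≠ 0 :=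
        (map_ne_zero_iff φ hφ).2 (mvpoly_ne_zero_of_eval _ 1 (by simp))
      simpa using this
    · intro i j hij h
      exact hij (MvPolynomial.X_injective (hφ h))
  have := congrArg (MvPolynomial.eval₂Hom (Int.castRingHom R) x) hpoly
  rw [map_mul, map_mul, map_Lsum _ _ (fun _ _ => 1) (by simp), map_denP, map_PhiOne,
    map_intCast] at this
  have hx : (MvPolynomial.eval₂Hom (Int.castRingHom R) x) ∘ MvPolynomial.X = x := by
    funext i; simp
  rwa [hx] at this

end PartA4


section PartA5

variable {K : Type*} [CommRing K]

/-- coefficient at the multi-index `J` -/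
noncomputable def cf {m : ℕ} (J : Fin m → ℕ) (P : MvPolynomial (Fin m) K) : K :=
  P.coeff (Finsupp.equivFunOnFinite.symm J)

theorem cf_add {m : ℕ} (J : Fin m → ℕ) (P Q : MvPolynomial (Fin m) K) :
    cf J (P + Q) = cf J P + cf J Q := MvPolynomial.coeff_add _ _ _

theorem cf_sub {m : ℕ} (J : Fin m → ℕ) (P Q : MvPolynomial (Fin m) K) :
    cf J (P - Q) = cf J P - cf J Q := MvPolynomial.coeff_sub _ _ _ _

theorem cf_sum {ι : Type*} {m : ℕ} (J : Fin m → ℕ) (s : Finset ι)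
    (P : ι → MvPolynomial (Fin m) K) :
    cf J (∑ i ∈ s, P i) = ∑ i ∈ s, cf J (P i) := MvPolynomial.coeff_sum _ _ _

theorem cf_rename_const {m : ℕ} (r : ℕ) (σ : Equiv.Perm (Fin m)) (P : MvPolynomial (Fin m) K) :
    cf (fun _ => r) (MvPolynomial.rename σ P) = cf (fun _ => r) P := by
  unfold cf
  rw [← MvPolynomial.coeff_rename_mapDomain σ σ.injective P]
  congr 1
  ext i
  have : i = σ (σ.symm i) := by simp
  rw [this, Finsupp.mapDomain_apply σ.injective]
  rfl

/-- the ideal generated by `X_p ^ (J p + 1)` -/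
noncomputable def truncIdeal {m : ℕ} (J : Fin m → ℕ) : Ideal (MvPolynomial (Fin m) K) :=
  Ideal.span (Set.range fun p => MvPolynomial.X p ^ (J p + 1))

theorem X_pow_mem_truncIdeal {m : ℕ} (J : Fin m → ℕ) (p : Fin m) (e : ℕ) (he : J p < e) :
    (MvPolynomial.X p ^ e : MvPolynomial (Fin m) K) ∈ truncIdeal J := by
  have : (MvPolynomial.X p ^ (J p + 1) : MvPolynomial (Fin m) K) ∈ truncIdeal J :=
    Ideal.subset_span ⟨p, rfl⟩
  exact Ideal.pow_mem_of_pow_mem _ this he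

theorem cf_of_mem {m : ℕ} (J : Fin m → ℕ) (P : MvPolynomial (Fin m) K) (h : P ∈ truncIdeal J) :
    cf J P = 0 := by
  unfold truncIdeal at h
  induction h using Submodule.span_induction with
  | mem x hx =>
    obtain ⟨p, rfl⟩ := hx
    unfold cf
    rw [MvPolynomial.coeff_X_pow, if_neg]
    intro h
    have := DFunLike.congr_fun h p
    simp at this
  | zero => simp [cf]
  | add x y _ _ hx hy => rw [cf_add, hx, hy, add_zero]
  | smul a x hx _ =>
    -- need generality
    obtain ⟨c, rfl⟩ := (Ideal.mem_span_range_iff_exists_fun).1 hx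
    rw [smul_eq_mul, mul_sum, cf_sum]
    refine sum_eq_zero fun p _ => ?_
    rw [← mul_assoc]
    unfold cf
    rw [MvPolynomial.X_pow_eq_monomial, MvPolynomial.coeff_mul_monomial', if_neg]
    intro h
    have := h p
    simp at this

theorem cf_congr {m : ℕ} (J : Fin m → ℕ) (P Q : MvPolynomial (Fin m) K)
    (h : Ideal.Quotient.mk (truncIdeal J) P = Ideal.Quotient.mk (truncIdeal J) Q) :
    cf J P = cf J Q := by
  have := cf_of_mem J _ (Ideal.Quotient.eq.1 h)
  rw [cf_sub] at this
  exact sub_eq_zero.1 this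

/-- renaming as a ring hom -/
noncomputable def renHom {m : ℕ} (σ : Equiv.Perm (Fin m)) :
    MvPolynomial (Fin m) K →+* MvPolynomial (Fin m) K :=
  (MvPolynomial.rename σ : MvPolynomial (Fin m) K →ₐ[K] MvPolynomial (Fin m) K).toRingHom

theorem rename_X_comp {m : ℕ} (σ : Equiv.Perm (Fin m)) :
    (renHom σ : MvPolynomial (Fin m) K →+* MvPolynomial (Fin m) K) ∘
      (MvPolynomial.X : Fin m → MvPolynomial (Fin m) K) = MvPolynomial.X ∘ σ := by
  funext i; simp [renHom]

theorem vand_perm {R : Type*} [CommRing R] {m : ℕ} (x : Fin m → R) (σ : Equiv.Perm (Fin m)) :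
    vand (x ∘ σ) = (Equiv.Perm.sign σ : ℤ) * vand x := by
  rw [← det_vand, ← det_vand]
  exact Matrix.det_permute σ (Matrix.vandermonde x)

theorem PhiTwo_perm {R : Type*} [CommRing R] {m : ℕ} (N : ℕ) (x : Fin m → R)
    (σ : Equiv.Perm (Fin m)) :
    PhiTwo m N (x ∘ σ) = (Equiv.Perm.sign σ : ℤ) * PhiTwo m N x := by
  unfold PhiTwo
  rw [← Matrix.det_permute σ]
  rfl

theorem map_vand {R S : Type*} [CommRing R] [CommRing S] (φ : R →+* S) {m : ℕ} (x : Fin m → R) :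
    φ (vand x) = vand (φ ∘ x) := map_pairProd φ _ _ (by simp) x

/-- antisymmetrization under the constant coefficient functional -/
theorem cf_asym {m : ℕ} (r : ℕ) (A : MvPolynomial (Fin m) K)
    (hA : ∀ σ : Equiv.Perm (Fin m), MvPolynomial.rename σ A = (Equiv.Perm.sign σ : ℤ) * A)
    (G : (Fin m → MvPolynomial (Fin m) K) → MvPolynomial (Fin m) K)
    (hG : ∀ σ : Equiv.Perm (Fin m), MvPolynomial.rename σ (G MvPolynomial.X) =
      G (MvPolynomial.X ∘ σ)) :
    (m.factorial : K) * cf (fun _ => r) (A * G MvPolynomial.X) =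
      cf (fun _ => r) (A * asym G MvPolynomial.X) := by
  unfold asym
  rw [mul_sum, cf_sum]
  have : ∀ σ ∈ (univ : Finset (Equiv.Perm (Fin m))), cf (fun _ => r) (A * (((Equiv.Perm.sign σ : ℤ) : MvPolynomial (Fin m) K) *
      G (MvPolynomial.X ∘ σ))) = cf (fun _ => r) (A * G MvPolynomial.X) := by
    intro σ _
    rw [← cf_rename_const r σ (A * G MvPolynomial.X), map_mul, hA, hG]
    congr 1
    ring
  rw [sum_congr rfl this, sum_const, card_univ, Fintype.card_perm, Fintype.card_fin, nsmul_eq_mul]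

theorem denP_ne_zero [IsDomain K] [CharZero K] (m : ℕ) :
    denP (MvPolynomial.X : Fin m → MvPolynomial (Fin m) K) ≠ 0 := by
  intro h
  have := congrArg (MvPolynomial.eval (fun _ => (2 : K))) h
  rw [map_denP, map_zero] at this
  unfold denP pairProd at this
  rw [mul_eq_zero, prod_eq_zero_iff, prod_eq_zero_iff] at this
  rcases this with ⟨p, _, hp⟩ | ⟨p, _, hp⟩
  · simp at hp
    norm_num at hp
  · rw [prod_eq_zero_iff] at hp
    obtain ⟨q, _, hq⟩ := hp
    simp at hq
    norm_num at hq

theorem epsg_sq (m : ℕ) : epsg m * epsg m = 1 := by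
  induction m with
  | zero => rfl
  | succ m ih =>
    unfold epsg
    rw [mul_mul_mul_comm, ih, ← pow_add, Even.neg_one_pow ⟨m, rfl⟩, one_mul]

/-- Theorem A. -/
theorem theoremA [IsDomain K] [CharZero K] (m N r : ℕ) (t : K) :
    cf (fun _ => r) ((∏ p : Fin m, (MvPolynomial.C t + MvPolynomial.X p)) *
      vand MvPolynomial.X * (pairProd (fun x y => 1 + x + x * y) MvPolynomial.X *
        hsum m N MvPolynomial.X)) =
    cf (fun _ => r) ((∏ p : Fin m, (MvPolynomial.C t + MvPolynomial.X p)) *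
      PhiTwo m N MvPolynomial.X * hsum m (r + 1) MvPolynomial.X) := by
  have hf : (m.factorial : K) ≠ 0 := by exact_mod_cast m.factorial_ne_zero
  apply mul_left_cancel₀ hf
  have hs : ∀ σ : Equiv.Perm (Fin m), MvPolynomial.rename σ
      (∏ p : Fin m, (MvPolynomial.C t + MvPolynomial.X p)) =
      ∏ p : Fin m, (MvPolynomial.C t + MvPolynomial.X p) := by
    intro σ
    simp only [map_prod, map_add, MvPolynomial.rename_C, MvPolynomial.rename_X]
    exact Equiv.prod_comp σ (fun p => MvPolynomial.C t + MvPolynomial.X p)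
  rw [cf_asym r _ (fun σ => ?_) (fun y => pairProd (fun x y => 1 + x + x * y) y * hsum m N y)
    (fun σ => ?_), cf_asym r _ (fun σ => ?_) (fun y => hsum m (r + 1) y) (fun σ => ?_)]
  · change cf _ (_ * Lsum (fun x y => 1 + x + x * y) m N _) = _
    have hL1 : asym (fun y => hsum m (r + 1) y) (MvPolynomial.X : Fin m → MvPolynomial (Fin m) K) =
        Lsum (fun _ _ => 1) m (r + 1) MvPolynomial.X := by
      unfold Lsum; simp [pairProd]
    rw [hL1]
    have e1 := Lsum_two m N (MvPolynomial.X : Fin m → MvPolynomial (Fin m) K)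
    have e2 := Lsum_one m (r + 1) (MvPolynomial.X : Fin m → MvPolynomial (Fin m) K)
    have hsw : PhiTwo m N MvPolynomial.X * Lsum (fun _ _ => 1) m (r + 1) MvPolynomial.X =
        Lsum (fun x y => 1 + x + x * y) m N MvPolynomial.X *
          PhiOne m (r + 1) (MvPolynomial.X : Fin m → MvPolynomial (Fin m) K) := by
      apply mul_right_cancel₀ (denP_ne_zero (K := K) m)
      have e3 : (epsg m : MvPolynomial (Fin m) K) * epsg m = 1 := by exact_mod_cast epsg_sq m
      linear_combination PhiTwo m N MvPolynomial.X * e2 - PhiOne m (r + 1) MvPolynomial.X * e1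
    rw [mul_assoc _ (PhiTwo m N _), hsw]
    apply cf_congr
    simp only [map_mul]
    have : Ideal.Quotient.mk (truncIdeal fun _ => r) (PhiOne m (r + 1) (MvPolynomial.X : Fin m → MvPolynomial (Fin m) K)) =
        Ideal.Quotient.mk (truncIdeal fun _ => r) (vand MvPolynomial.X) := by
      rw [map_PhiOne, map_vand, ← det_vand]
      unfold PhiOne
      congr 1
      ext p i
      simp only [Matrix.of_apply, Matrix.vandermonde_apply, Function.comp_apply]
      rw [sub_eq_self, ← map_pow, Ideal.Quotient.eq_zero_iff_mem]
      apply X_pow_mem_truncIdeal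
      have := i.2
      omega
    rw [this]
    ring
  · rw [map_mul, hs]
    have := map_PhiTwo (renHom σ : MvPolynomial (Fin m) K →+* MvPolynomial (Fin m) K) m N MvPolynomial.X
    rw [rename_X_comp, PhiTwo_perm] at this
    rw [show MvPolynomial.rename σ (PhiTwo m N MvPolynomial.X) = _ from this]
    ring
  · have := map_hsum (renHom σ : MvPolynomial (Fin m) K →+* MvPolynomial (Fin m) K) m (r + 1) MvPolynomial.X
    rw [rename_X_comp] at this
    exact this
  · rw [map_mul, hs]
    have := map_vand (renHom σ : MvPolynomial (Fin m) K →+* MvPolynomial (Fin m) K) MvPolynomial.X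
    rw [rename_X_comp, vand_perm] at this
    rw [show MvPolynomial.rename σ (vand MvPolynomial.X) = _ from this]
    ring
  · beta_reduce
    have h1 := map_hsum (renHom σ : MvPolynomial (Fin m) K →+* MvPolynomial (Fin m) K) m N MvPolynomial.X
    have h2 := map_pairProd (renHom σ : MvPolynomial (Fin m) K →+* MvPolynomial (Fin m) K)
      (fun x y => 1 + x + x * y) (fun x y => 1 + x + x * y) (by simp) MvPolynomial.X
    rw [rename_X_comp] at h1 h2
    rw [map_mul]
    exact congrArg₂ (· * ·) h2 h1

end PartA5


section PartA6

theorem hsum_eq_sum_range {R : Type*} [CommRing R] (m N : ℕ) (x : Fin (m + 1) → R) :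
    hsum (m + 1) N x = ∑ a ∈ range N, x 0 ^ a * hsum m a (fun i => x i.succ) := by
  induction N with
  | zero => rfl
  | succ N ih => rw [hsum_succ, ih, sum_range_succ]

theorem strictAnti_cons {m : ℕ} (a : ℕ) (d : Fin m → ℕ) :
    StrictAnti (Fin.cons a d : Fin (m + 1) → ℕ) ↔ (∀ i, d i < a) ∧ StrictAnti d := by
  constructor
  · intro h
    refine ⟨fun i => ?_, fun i j hij => ?_⟩
    · have := h (Fin.succ_pos i); simpa using this
    · have := h (Fin.succ_lt_succ_iff.2 hij); simpa using this
  · rintro ⟨h1, h2⟩ i j hij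
    revert hij
    refine Fin.cases ?_ (fun i => ?_) i <;> refine Fin.cases ?_ (fun j => ?_) j <;> intro hij
    · exact absurd hij (lt_irrefl _)
    · simpa using h1 j
    · exact absurd hij (by simp)
    · simpa using h2 (Fin.succ_lt_succ_iff.1 hij)

theorem sum_piFinset_succ {M σ : Type*} [AddCommMonoid M] {m : ℕ} (s : Finset σ)
    (g : (Fin (m + 1) → σ) → M) :
    ∑ d ∈ Fintype.piFinset (fun _ : Fin (m + 1) => s), g d =
      ∑ a ∈ s, ∑ d ∈ Fintype.piFinset (fun _ : Fin m => s), g (Fin.cons a d) := by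
  rw [← sum_product']
  refine sum_nbij' (fun d => (d 0, fun i => d i.succ)) (fun p => Fin.cons p.1 p.2) ?_ ?_ ?_ ?_ ?_
  · intro d hd
    simp only [Fintype.mem_piFinset, mem_product] at hd ⊢
    exact ⟨hd 0, fun i => hd _⟩
  · rintro ⟨a, d⟩ hd
    simp only [Fintype.mem_piFinset, mem_product] at hd ⊢
    intro i
    refine Fin.cases ?_ (fun i => ?_) i
    · simpa using hd.1
    · simpa using hd.2 i
  · intro d _
    funext i
    refine Fin.cases ?_ (fun i => ?_) i <;> simp
  · rintro ⟨a, d⟩ _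
    simp
  · intro d _
    congr 1
    funext i
    refine Fin.cases ?_ (fun i => ?_) i <;> simp

open Classical in
theorem hsum_eq_sum {R : Type*} [CommRing R] (m N : ℕ) (x : Fin m → R) :
    hsum m N x = ∑ d ∈ (Fintype.piFinset (fun _ : Fin m => range N)).filter StrictAnti,
      ∏ p, x p ^ d p := by
  induction m generalizing N with
  | zero =>
    rw [hsum_zero, sum_filter]
    simp [StrictAnti]
  | succ m ih =>
    rw [hsum_eq_sum_range, sum_filter, sum_piFinset_succ]
    refine sum_congr rfl fun a ha => ?_
    simp only [strictAnti_cons]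
    rw [ih, mul_sum, ← sum_filter]
    refine sum_congr ?_ fun d _ => ?_
    · ext d
      simp only [mem_filter, Fintype.mem_piFinset, mem_range] at ha ⊢
      constructor
      · rintro ⟨h1, h2⟩
        exact ⟨fun i => (h1 i).trans ha, h1, h2⟩
      · rintro ⟨h1, h2, h3⟩
        exact ⟨h2, h3⟩
    · rw [Fin.prod_univ_succ]
      simp

theorem cf_mul_prod_X_pow {K : Type*} [CommRing K] {m : ℕ} (J d : Fin m → ℕ)
    (G : MvPolynomial (Fin m) K) (h : ∀ p, d p ≤ J p) :
    cf J (G * ∏ p, MvPolynomial.X p ^ d p) = cf (fun p => J p - d p) G := by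
  have e : (∏ p, MvPolynomial.X p ^ d p : MvPolynomial (Fin m) K) =
      MvPolynomial.monomial (Finsupp.equivFunOnFinite.symm d) 1 := by
    rw [MvPolynomial.monomial_eq, Finsupp.prod_fintype _ _ (by simp)]
    simp
  unfold cf
  rw [e, MvPolynomial.coeff_mul_monomial', if_pos (by intro p; exact h p), mul_one]
  congr 1
  ext p
  simp

open Classical in
theorem sum_cf_eq {K : Type*} [CommRing K] (m l r : ℕ) (hlr : l ≤ r)
    (G : MvPolynomial (Fin m) K) :
    ∑ J ∈ (Fintype.piFinset (fun _ : Fin m => Icc l r)).filter StrictMono, cf J G =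
      cf (fun _ => r) (G * hsum m (r - l + 1) MvPolynomial.X) := by
  rw [hsum_eq_sum, mul_sum, cf_sum]
  refine sum_nbij' (fun J p => r - J p) (fun d p => r - d p) ?_ ?_ ?_ ?_ ?_
  · intro J hJ
    simp only [mem_filter, Fintype.mem_piFinset, mem_range, mem_Icc] at hJ ⊢
    refine ⟨fun i => ?_, fun i j hij => ?_⟩
    · have := hJ.1 i; omega
    · have := hJ.1 i; have := hJ.1 j; have := hJ.2 hij; dsimp; omega
  · intro J hJ
    simp only [mem_filter, Fintype.mem_piFinset, mem_range, mem_Icc] at hJ ⊢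
    refine ⟨fun i => ?_, fun i j hij => ?_⟩
    · have := hJ.1 i; omega
    · have := hJ.1 i; have := hJ.1 j; have := hJ.2 hij; dsimp; omega
  · intro J hJ
    simp only [mem_filter, Fintype.mem_piFinset, mem_range, mem_Icc] at hJ ⊢
    funext i; have := hJ.1 i; omega
  · intro J hJ
    simp only [mem_filter, Fintype.mem_piFinset, mem_range, mem_Icc] at hJ ⊢
    funext i; have := hJ.1 i; omega
  · intro J hJ
    simp only [mem_filter, Fintype.mem_piFinset, mem_range, mem_Icc] at hJ ⊢
    rw [cf_mul_prod_X_pow _ _ _ (fun p => Nat.sub_le _ _)]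
    congr 1
    funext i; have := hJ.1 i; omega

open Classical in
/-- Theorem A, in summed form. -/
theorem theoremA_sum {K : Type*} [CommRing K] [IsDomain K] [CharZero K] (m l r : ℕ) (hlr : l ≤ r)
    (t : K) :
    ∑ J ∈ (Fintype.piFinset (fun _ : Fin m => Icc l r)).filter StrictMono,
      cf J ((∏ p : Fin m, (MvPolynomial.C t + MvPolynomial.X p)) *
        vand MvPolynomial.X * pairProd (fun x y => 1 + x + x * y) MvPolynomial.X) =
    ∑ J ∈ (Fintype.piFinset (fun _ : Fin m => Icc 0 r)).filter StrictMono,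
      cf J ((∏ p : Fin m, (MvPolynomial.C t + MvPolynomial.X p)) *
        PhiTwo m (r - l + 1) MvPolynomial.X) := by
  rw [sum_cf_eq m l r hlr, sum_cf_eq m 0 r (Nat.zero_le _), mul_assoc, theoremA]
  rfl

end PartA6


section PartC1

variable {K : Type*} [CommRing K]

theorem cf_prod_aeval {m : ℕ} (J : Fin m → ℕ) (h : Fin m → Polynomial K) :
    cf J (∏ p, Polynomial.aeval (MvPolynomial.X p) (h p)) = ∏ p, (h p).coeff (J p) := by
  classical
  have e : ∀ p : Fin m, Polynomial.aeval (MvPolynomial.X p : MvPolynomial (Fin m) K) (h p) =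
      ∑ i ∈ (h p).support, MvPolynomial.C ((h p).coeff i) * MvPolynomial.X p ^ i := by
    intro p
    rw [Polynomial.aeval_eq_sum_range, Polynomial.sum_over_range' (h p) (f := fun i a => a • (MvPolynomial.X p : MvPolynomial (Fin m) K) ^ i) (by simp) _ (Nat.lt_succ_self _) |>.symm]
    rw [Polynomial.sum_def]
    simp [MvPolynomial.smul_eq_C_mul]
  simp_rw [e]
  rw [prod_univ_sum, cf_sum]
  have e2 : ∀ d : Fin m → ℕ, cf J (∏ p, (MvPolynomial.C ((h p).coeff (d p)) *
      MvPolynomial.X p ^ d p : MvPolynomial (Fin m) K)) =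
      if d = J then ∏ p, (h p).coeff (d p) else 0 := by
    intro d
    rw [prod_mul_distrib, ← map_prod]
    have e : (∏ p, MvPolynomial.X p ^ d p : MvPolynomial (Fin m) K) =
        MvPolynomial.monomial (Finsupp.equivFunOnFinite.symm d) 1 := by
      rw [MvPolynomial.monomial_eq, Finsupp.prod_fintype _ _ (by simp)]
      simp
    unfold cf
    rw [e, MvPolynomial.coeff_C_mul, MvPolynomial.coeff_monomial]
    simp
  simp_rw [e2]
  rw [sum_ite_eq']
  split_ifs with hJ
  · rfl
  · simp only [Fintype.mem_piFinset, Polynomial.mem_support_iff] at hJ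
    push Not at hJ
    obtain ⟨p, hp⟩ := hJ
    exact (prod_eq_zero (mem_univ p) hp).symm

theorem cf_det_aeval {m : ℕ} (J : Fin m → ℕ) (h : Fin m → Fin m → Polynomial K) :
    cf J (Matrix.of fun p i => Polynomial.aeval (MvPolynomial.X p) (h p i)).det =
      (Matrix.of fun p i => (h p i).coeff (J p)).det := by
  rw [← Matrix.det_transpose, Matrix.det_apply, ← Matrix.det_transpose (Matrix.of _), Matrix.det_apply, cf_sum]
  refine sum_congr rfl fun σ _ => ?_
  simp only [Matrix.transpose_apply, Matrix.of_apply]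
  rw [← cf_prod_aeval J (fun p => h p (σ p))]
  unfold cf
  rw [← MvPolynomial.coeff_smul]

/-- one-variable building blocks of `Φ` -/
noncomputable def gM (M i : ℕ) : Polynomial K :=
  (1 + Polynomial.X) ^ i * (Polynomial.X ^ i - Polynomial.X ^ (M - 2 * i))

noncomputable def Fdet (K : Type*) [CommRing K] (j M : ℕ) (x : Fin j → ℕ) : K :=
  (Matrix.of fun p (i : Fin j) => (gM M i : Polynomial K).coeff (x p)).det

theorem cf_s_Phi (m N : ℕ) (t : K) (J : Fin m → ℕ) :
    cf J ((∏ p : Fin m, (MvPolynomial.C t + MvPolynomial.X p)) * PhiTwo m N MvPolynomial.X) =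
    (Matrix.of fun p (i : Fin m) =>
      ((Polynomial.C t + Polynomial.X) * gM (N + 2 * (m - 1)) i : Polynomial K).coeff (J p)).det := by
  rw [← cf_det_aeval J (fun p (i : Fin m) => (Polynomial.C t + Polynomial.X) * gM (N + 2 * (m - 1)) i)]
  unfold PhiTwo
  rw [← Matrix.det_mul_column]
  congr 2
  ext p i
  congr 1
  simp only [Matrix.of_apply, gM, map_mul, map_add, map_sub, map_pow, Polynomial.aeval_X,
    Polynomial.aeval_C, map_one, MvPolynomial.algebraMap_eq, mul_pow]
  ring

theorem det_sum_bool {m : ℕ} (a b : Fin m → Fin m → K) :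
    (Matrix.of fun p i => a p i + b p i).det =
      ∑ ε : Fin m → Bool, (Matrix.of fun p i => if ε p then b p i else a p i).det := by
  have := (Matrix.detRowAlternating (n := Fin m) (R := K)).toMultilinearMap.map_sum
    (fun p (e : Bool) (i : Fin m) => if e then b p i else a p i)
  simp only [Fintype.sum_bool] at this
  refine Eq.trans ?_ this
  change Matrix.det _ = Matrix.det _
  congr 1
  ext p i
  simp [add_comm]

theorem Fdet_final (m M : ℕ) (t : K) (J : Fin m → ℕ) :
    (Matrix.of fun p (i : Fin m) =>
      ((Polynomial.C t + Polynomial.X) * gM M i : Polynomial K).coeff (J p)).det =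
    ∑ ε : Fin m → Bool, if ∀ q, (ε q).toNat ≤ J q then
      (∏ q, if ε q then 1 else t) * Fdet K m M (fun q => J q - (ε q).toNat) else 0 := by
  have h1 : (Matrix.of fun p (i : Fin m) =>
      ((Polynomial.C t + Polynomial.X) * gM M i : Polynomial K).coeff (J p)) =
      Matrix.of fun p (i : Fin m) => t * (gM M i : Polynomial K).coeff (J p) +
        (if 1 ≤ J p then (gM M i : Polynomial K).coeff (J p - 1) else 0) := by
    ext p i
    simp only [Matrix.of_apply, add_mul, Polynomial.coeff_add, Polynomial.coeff_C_mul]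
    congr 1
    rcases J p with _ | y
    · simp
    · simp [Polynomial.coeff_X_mul]
  rw [h1, det_sum_bool]
  refine sum_congr rfl fun ε _ => ?_
  split_ifs with h
  · unfold Fdet
    rw [← Matrix.det_mul_column]
    congr 1
    ext p i
    simp only [Matrix.of_apply]
    have := h p
    cases hε : ε p
    · simp
    · rw [hε] at this
      simp at this
      simp [this]
  · push Not at h
    obtain ⟨q, hq⟩ := h
    apply Matrix.det_eq_zero_of_row_eq_zero q
    intro i
    cases hε : ε q
    · simp [hε] at hq
    · simp [hε] at hq
      simp [hε, hq]

theorem Fdet_step (j M : ℕ) (hM : 2 * j ≤ M + 2) (x : Fin j → ℕ) :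
    Fdet K (j + 1) (M + 3) (Fin.cons 0 x) =
    ∑ ε : Fin j → Bool, if ∀ q, 1 + (ε q).toNat ≤ x q then
      Fdet K j M (fun q => x q - (1 + (ε q).toNat)) else 0 := by
  have h0 : Fdet K (j + 1) (M + 3) (Fin.cons 0 x) =
      (Matrix.of fun p (i : Fin j) => (gM (M + 3) (i + 1) : Polynomial K).coeff (x p)).det := by
    unfold Fdet
    rw [Matrix.det_succ_row_zero, Fin.sum_univ_succ]
    rw [sum_eq_zero, add_zero]
    · have : (gM (M + 3) 0 : Polynomial K).coeff 0 = 1 := by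
        simp [gM, Polynomial.coeff_X_pow]
      simp [this]
      rfl
    · intro i _
      have : (gM (M + 3) (i + 1) : Polynomial K).coeff 0 = 0 := by
        have hi := i.2
        have hne : M + 3 - 2 * ((i : ℕ) + 1) ≠ 0 := by omega
        rw [Polynomial.coeff_zero_eq_eval_zero]
        simp [gM, hne]
      simp [this]
  have h1 : (Matrix.of fun p (i : Fin j) => (gM (M + 3) (i + 1) : Polynomial K).coeff (x p)) =
      Matrix.of fun p (i : Fin j) =>
        (if 1 ≤ x p then (gM M i : Polynomial K).coeff (x p - 1) else 0) +
        (if 2 ≤ x p then (gM M i : Polynomial K).coeff (x p - 2) else 0) := by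
    ext p i
    have hg : (gM (M + 3) (i + 1) : Polynomial K) = Polynomial.X * gM M i +
        Polynomial.X * (Polynomial.X * gM M i) := by
      unfold gM
      have hi := i.2
      rw [show M + 3 - 2 * ((i : ℕ) + 1) = (M - 2 * i) + 1 by omega]
      ring
    simp only [Matrix.of_apply, hg, Polynomial.coeff_add]
    rcases x p with _ | _ | y
    · simp
    · simp [Polynomial.coeff_X_mul]
    · simp [Polynomial.coeff_X_mul]
  rw [h0, h1, det_sum_bool]
  refine sum_congr rfl fun ε _ => ?_
  split_ifs with h
  · unfold Fdet
    congr 1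
    ext p i
    simp only [Matrix.of_apply]
    have := h p
    cases hε : ε p
    · rw [hε] at this
      simp at this
      simp [this]
    · rw [hε] at this
      simp at this
      simp [this]
  · push Not at h
    obtain ⟨q, hq⟩ := h
    apply Matrix.det_eq_zero_of_row_eq_zero q
    intro i
    cases hε : ε q
    · simp [hε] at hq
      simp [hε, hq]
    · simp [hε] at hq
      simp only [Matrix.of_apply, hε]
      rw [if_pos trivial, if_neg (by omega)]

theorem Fdet_eq (j M : ℕ) (x : Fin j → ℕ) (p q : Fin j) (hpq : p ≠ q) (h : x p = x q) :
    Fdet K j M x = 0 :=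
  Matrix.det_zero_of_row_eq hpq (by funext i; simp [h])

theorem Fdet_pos (j M : ℕ) (x : Fin (j + 1) → ℕ) (h : ∀ p, 0 < x p ∧ x p < M) :
    Fdet K (j + 1) M x = 0 := by
  apply Matrix.det_eq_zero_of_column_eq_zero 0
  intro p
  have h1 := (h p).1
  have h2 := (h p).2
  simp [gM, Polynomial.coeff_X_pow, Polynomial.coeff_one]
  rw [if_neg (by omega), if_neg (by omega), sub_zero]

theorem gM_mid (M i y : ℕ) (hi : 2 * i ≤ M) (hy : 2 * y = M) [IsDomain K] [CharZero K] :
    (gM M i : Polynomial K).coeff y = 0 := by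
  have h : ∀ a, (gM M i : Polynomial K).coeff a =
      (if i ≤ a then (i.choose (a - i) : K) else 0) -
      (if M - 2 * i ≤ a then (i.choose (a - (M - 2 * i)) : K) else 0) := by
    intro a
    unfold gM
    rw [mul_sub, Polynomial.coeff_sub, Polynomial.coeff_mul_X_pow', Polynomial.coeff_mul_X_pow']
    simp [Polynomial.coeff_one_add_X_pow]
  rw [h]
  by_cases h1 : i ≤ y
  · rw [if_pos h1]
    by_cases h2 : M - 2 * i ≤ y
    · rw [if_pos h2, ← Nat.choose_symm (show y - i ≤ i by omega)]
      rw [show i - (y - i) = y - (M - 2 * i) by omega, sub_self]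
    · rw [if_neg h2, Nat.choose_eq_zero_of_lt (by omega)]
      simp
  · rw [if_neg h1, if_neg (by omega), sub_zero]

theorem Fdet_mid [IsDomain K] [CharZero K] (j M : ℕ) (hM : 2 * j ≤ M + 2) (x : Fin j → ℕ)
    (p : Fin j) (h : 2 * x p = M) : Fdet K j M x = 0 := by
  apply Matrix.det_eq_zero_of_row_eq_zero p
  intro i
  have := i.2
  exact gM_mid M i _ (by omega) h

end PartC1


section PartC2

theorem chain_sum {σ K : Type*} [DecidableEq σ] [CommRing K] (A : Finset σ) (g : σ → K) (N : ℕ) :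
    ∀ (w : ℕ → σ → σ → K) (Z : ℕ → σ → K)
    (_ : ∀ i < N, ∀ s' ∈ A, Z (i + 1) s' = ∑ s ∈ A, Z i s * w i s s'),
    ∑ π ∈ Fintype.piFinset (fun _ : Fin (N + 1) => A),
      Z 0 (π 0) * (∏ i : Fin N, w i (π i.castSucc) (π i.succ)) * g (π (Fin.last N)) =
    ∑ s ∈ A, Z N s * g s := by
  induction N with
  | zero =>
    intro w Z _
    rw [sum_piFinset_succ]
    refine sum_congr rfl fun s _ => ?_
    simp
  | succ N ih =>
    intro w Z hZ
    rw [sum_piFinset_succ, sum_comm]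
    have := ih (fun i => w (i + 1)) (fun i => Z (i + 1)) (fun i hi s' hs' => hZ (i + 1) (by omega) s' hs')
    rw [← this]
    refine sum_congr rfl fun π hπ => ?_
    rw [hZ 0 (by omega) (π 0) (Fintype.mem_piFinset.1 hπ 0), sum_mul, sum_mul]
    refine sum_congr rfl fun s _ => ?_
    rw [Fin.prod_univ_succ]
    simp only [Fin.cons_zero, Fin.castSucc_zero, Fin.val_zero, Fin.cons_succ, ← Fin.succ_castSucc, Fin.val_succ,
      ← Fin.succ_last]
    ring

open Classical in
/-- generating function of paths -/
theorem chain_gf {σ K : Type*} [CommRing K] (A : Finset σ) (s0 : σ) (N : ℕ) (t : K)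
    (T : ℕ → σ → σ → Prop) (e : ℕ → σ → σ → ℕ) (G : σ → Prop) (Z : ℕ → σ → K)
    (hZ0 : ∀ s ∈ A, Z 0 s = if s = s0 then 1 else 0)
    (hZ : ∀ i < N, ∀ s' ∈ A, Z (i + 1) s' = ∑ s ∈ A, if T i s s' then t ^ e i s s' * Z i s else 0) :
    ∑ π ∈ (Fintype.piFinset (fun _ : Fin (N + 1) => A)).filter (fun π => π 0 = s0 ∧
      (∀ i : Fin N, T i (π i.castSucc) (π i.succ)) ∧ G (π (Fin.last N))),
      t ^ (∑ i : Fin N, e i (π i.castSucc) (π i.succ)) = ∑ s ∈ A with G s, Z N s := by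
  have := chain_sum A (fun s => if G s then 1 else 0) N
    (fun i s s' => if T i s s' then t ^ e i s s' else 0) Z (by
      intro i hi s' hs'
      rw [hZ i hi s' hs']
      refine sum_congr rfl fun s _ => ?_
      split_ifs <;> ring)
  simp only [mul_ite, mul_one, mul_zero] at this
  rw [sum_filter, sum_filter, ← this]
  refine sum_congr rfl fun π hπ => ?_
  rw [hZ0 _ (Fintype.mem_piFinset.1 hπ 0), prod_ite_zero, ← prod_pow_eq_pow_sum]
  by_cases h1 : π 0 = s0 <;> by_cases h2 : ∀ i : Fin N, T i (π i.castSucc) (π i.succ) <;>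
    by_cases h3 : G (π (Fin.last N)) <;> simp [h1, h2, h3]

/-- finite set of bounded functions -/
noncomputable def bddFun (m k : ℕ) : Finset (ℕ → ℕ) :=
  (Set.Finite.subset (Set.finite_range (fun (f : Fin m → Fin (k + 1)) (p : ℕ) =>
    if h : p < m then (f ⟨p, h⟩ : ℕ) else 0))
    (show {f : ℕ → ℕ | (∀ p, m ≤ p → f p = 0) ∧ ∀ p, f p ≤ k} ⊆ _ from by
      rintro f ⟨h1, h2⟩
      refine ⟨fun p => ⟨f p, Nat.lt_succ_of_le (h2 p)⟩, ?_⟩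
      funext p
      by_cases h : p < m
      · simp [h]
      · simp [h, h1 p (by omega)])).toFinset

theorem mem_bddFun {m k : ℕ} {f : ℕ → ℕ} :
    f ∈ bddFun m k ↔ (∀ p, m ≤ p → f p = 0) ∧ ∀ p, f p ≤ k := by
  simp [bddFun]

/-- admissible states on the Magog side -/
def MagValid (i M : ℕ) (μ : ℕ → ℕ) : Prop :=
  Antitone μ ∧ (∀ p, i ≤ p → μ p = 0) ∧ 2 * (μ 0 + i) < M

def MagStep (μ μ' : ℕ → ℕ) : Prop := ∀ p, μ p ≤ μ' p ∧ μ' p ≤ μ p + 1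

variable {K : Type*} [CommRing K] [IsDomain K] [CharZero K]

open Classical in
theorem mag_step (m k i M : ℕ) (W : (Fin (i + 1) → Bool) → K) (μ' : ℕ → ℕ)
    (hA : μ' ∈ bddFun m k) (hanti : Antitone μ') (hsupp : ∀ p, i < p → μ' p = 0)
    (hcut : 2 * (μ' 0 + i) ≤ M) (hM : 0 < M) (hj : 2 * (i + 1) ≤ M + 2) :
    (∑ μ ∈ bddFun m k, if MagValid i M μ ∧ MagStep μ μ' then
      W (fun q => decide (μ' (i - q) ≠ μ (i - q))) * Fdet K (i + 1) M (fun q => μ (i - q) + q) else 0) =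
    ∑ ε : Fin (i + 1) → Bool, if ∀ q, (ε q).toNat ≤ μ' (i - q) + q then
      W ε * Fdet K (i + 1) M (fun q => μ' (i - q) + q - (ε q).toNat) else 0 := by
  rw [← sum_filter]
  refine sum_bij_ne_zero (fun μ _ _ => fun q => decide (μ' (i - q) ≠ μ (i - q))) ?_ ?_ ?_ ?_
  · intros; exact mem_univ _
  · intro μ₁ h1 h1' μ₂ h2 h2' he
    simp only [mem_filter] at h1 h2
    funext p
    by_cases hp : p ≤ i
    · have := congrFun he ⟨i - p, by omega⟩
      simp only [show i - (i - p) = p by omega] at this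
      have a1 := h1.2.2 p
      have a2 := h2.2.2 p
      simp only [decide_eq_decide] at this
      omega
    · rw [h1.2.1.2.1 p (by omega), h2.2.1.2.1 p (by omega)]
  · intro ε _ hε
    obtain ⟨hle, hF⟩ : (∀ q, (ε q).toNat ≤ μ' (i - q) + q) ∧
      Fdet K (i + 1) M (fun q => μ' (i - q) + q - (ε q).toNat) ≠ 0 := by
      split_ifs at hε with h
      · exact ⟨h, right_ne_zero_of_mul hε⟩
      · exact absurd rfl hε
    set y : Fin (i + 1) → ℕ := fun q => μ' (i - q) + q - (ε q).toNat with hy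
    have hb : ∀ q, (ε q).toNat ≤ 1 := fun q => Bool.toNat_le _
    have hmono : StrictMono y := by
      rw [Fin.strictMono_iff_lt_succ]
      intro q
      have h1 : y q.castSucc ≠ y q.succ := fun h => hF (Fdet_eq _ _ _ _ _ (Fin.castSucc_lt_succ).ne h)
      have h2 := hanti (show i - (q + 1) ≤ i - q by omega)
      have h3 := hle q.castSucc
      have h4 := hle q.succ
      have h5 := hb q.castSucc
      have h6 := hb q.succ
      simp only [hy, Fin.val_castSucc, Fin.val_succ] at *
      omega
    have hyq : ∀ q : Fin (i + 1), (q : ℕ) ≤ y q := by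
      intro q
      induction q using Fin.induction with
      | zero => simp
      | succ q ih =>
        have := hmono (Fin.castSucc_lt_succ (i := q))
        simp only [Fin.val_succ, Fin.val_castSucc] at *
        omega
    have hlast : 2 * y (Fin.last i) ≤ M := by
      simp only [hy, Fin.val_last, Nat.sub_self]; omega
    have hall : ∀ q, y q ≤ y (Fin.last i) := fun q => hmono.monotone (Fin.le_last q)
    have hy0 : y 0 = 0 := by
      by_contra h0
      refine hF (Fdet_pos _ _ _ fun q => ?_)
      have h1 := hmono.monotone (Fin.zero_le q)
      have h2 := hall q
      constructor
      · exact lt_of_lt_of_le (Nat.pos_of_ne_zero h0) h1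
      · change y q < M
        omega
    have hlast' : 2 * y (Fin.last i) ≠ M := fun h => hF (Fdet_mid _ _ hj _ _ h)
    have hsub : ∀ q : Fin (i + 1), (ε q).toNat ≤ μ' (i - q) := by
      intro q
      have := hyq q
      have h1 := hle q
      simp only [hy] at this
      omega
    let μ : ℕ → ℕ := fun p => if p ≤ i then μ' p - (ε ⟨i - p, by omega⟩).toNat else 0
    have hμq : ∀ q : Fin (i + 1), μ (i - q) + (ε q).toNat = μ' (i - q) := by
      intro q
      have hq := q.2
      have e : (⟨i - (i - q), by omega⟩ : Fin (i + 1)) = q := by ext; simp; omega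
      have := hsub q
      simp only [μ]
      rw [if_pos (by omega), e]
      omega
    have hyμ : ∀ q : Fin (i + 1), y q = μ (i - q) + q := by
      intro q
      have := hμq q
      simp only [hy]
      omega
    have hstep : MagStep μ μ' := by
      intro p
      by_cases hp : p ≤ i
      · have := hμq ⟨i - p, by omega⟩
        simp only [show i - (i - p) = p by omega] at this
        have h1 := hb ⟨i - p, by omega⟩
        omega
      · have := hsupp p (by omega)
        simp only [μ, if_neg hp]
        omega
    have hε2 : (fun q : Fin (i + 1) => decide (μ' (i - q) ≠ μ (i - q))) = ε := by
      funext q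
      have := hμq q
      cases h : ε q
      · simp [h] at this; simp [this]
      · simp [h] at this; simp; omega
    have hval : MagValid i M μ := by
      refine ⟨antitone_nat_of_succ_le fun p => ?_, fun p hp => ?_, ?_⟩
      · by_cases hp : p + 1 ≤ i
        · have h1 := hyμ ⟨i - p, by omega⟩
          have h2 := hyμ ⟨i - (p + 1), by omega⟩
          simp only [show i - (i - p) = p by omega, show i - (i - (p + 1)) = p + 1 by omega] at h1 h2
          have h3 := hmono (show (⟨i - (p + 1), by omega⟩ : Fin (i + 1)) < ⟨i - p, by omega⟩ by
            simp; omega)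
          omega
        · simp only [μ, if_neg hp]; omega
      · rcases hp.eq_or_lt with rfl | hp
        · have := hyμ 0
          simp at this
          omega
        · simp only [μ, if_neg (not_le.2 hp)]
      · have := hyμ (Fin.last i)
        simp at this
        omega
    refine ⟨μ, ?_, ?_, hε2⟩
    · simp only [mem_filter]
      refine ⟨mem_bddFun.2 ⟨fun p hp => ?_, fun p => ?_⟩, hval, hstep⟩
      · have := (mem_bddFun.1 hA).1 p hp
        have := hstep p
        omega
      · have := (mem_bddFun.1 hA).2 p
        have := hstep p
        omega
    · have e : (fun q : Fin (i + 1) => μ (i - q) + q) = y := by funext q; rw [hyμ]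
      change W (fun q => decide (μ' (i - q) ≠ μ (i - q))) * Fdet K (i + 1) M (fun q => μ (i - q) + q) ≠ 0
      rw [e, hε2]
      split_ifs at hε with h
      exact hε
  · intro μ hμ _
    simp only [mem_filter] at hμ
    have hq : ∀ q : Fin (i + 1), (decide (μ' (i - q) ≠ μ (i - q))).toNat + μ (i - q) = μ' (i - q) := by
      intro q
      have := hμ.2.2 (i - q)
      by_cases h : μ' (i - q) = μ (i - q)
      · simp [h]
      · simp [h]; omega
    rw [if_pos (fun q => by have := hq q; beta_reduce; omega)]
    congr 1
    congr 1
    funext q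
    have := hq q
    beta_reduce
    omega

end PartC2


section PartC3

variable {K : Type*} [CommRing K] [IsDomain K] [CharZero K]

/-- transition relation on the Magog side -/
def MagT (c i : ℕ) (μ μ' : ℕ → ℕ) : Prop :=
  MagStep μ μ' ∧ MagValid (i + 1) (c + 3 * (i + 1)) μ'

def magE (a i : ℕ) (μ μ' : ℕ → ℕ) : ℕ :=
  if i = a then ((range (a + 1)).filter fun p => μ p = μ' p).card else 0

noncomputable def magDet (a c : ℕ) (t : K) (J : Fin (a + 1) → ℕ) : K :=
  (Matrix.of fun p (i : Fin (a + 1)) =>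
      ((Polynomial.C t + Polynomial.X) * gM (c + 3 * a) i : Polynomial K).coeff (J p)).det

open Classical in
noncomputable def magZ (a c : ℕ) (t : K) (i : ℕ) (μ : ℕ → ℕ) : K :=
  if MagValid i (c + 3 * i) μ then
    if i ≤ a then Fdet K (i + 1) (c + 3 * i) (fun q => μ (i - q) + q)
    else magDet a c t (fun q => μ (a - q) + q)
  else 0

theorem prod_ite_rev (a : ℕ) (t : K) (μ μ' : ℕ → ℕ) :
    (∏ q : Fin (a + 1), if decide (μ' (a - q) ≠ μ (a - q)) then (1 : K) else t) =
      t ^ ((range (a + 1)).filter fun p => μ p = μ' p).card := by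
  have h := Fin.prod_univ_eq_prod_range (fun q => if decide (μ' (a - q) ≠ μ (a - q)) then (1 : K) else t) (a + 1)
  rw [h, ← prod_range_reflect]
  rw [prod_congr rfl (g := fun p => if μ p = μ' p then t else 1)]
  · rw [prod_ite, prod_const, prod_const_one, mul_one]
  · intro p hp
    rw [mem_range] at hp
    rw [show a - (a + 1 - 1 - p) = p by omega]
    by_cases h : μ p = μ' p
    · simp [h]
    · have : μ' p ≠ μ p := fun h' => h h'.symm
      simp [h, this]

open Classical in
theorem magZ_step (a k c : ℕ) (t : K) (hc : 1 ≤ c) (hk : 2 * (k + a) ≤ c + 3 * a)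
    (i : ℕ) (hi : i < a + 1) (μ' : ℕ → ℕ) (hA : μ' ∈ bddFun (a + 1) k) :
    magZ a c t (i + 1) μ' = ∑ μ ∈ bddFun (a + 1) k,
      if MagT c i μ μ' then t ^ magE a i μ μ' * magZ a c t i μ else 0 := by
  by_cases hv : MagValid (i + 1) (c + 3 * (i + 1)) μ'
  swap
  · rw [magZ, if_neg hv, sum_eq_zero]
    intro μ _
    rw [if_neg (fun h => hv h.2)]
  obtain ⟨h1, h2, h3⟩ := id hv
  have h2' : ∀ p, i < p → μ' p = 0 := fun p hp => h2 p hp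
  have hb := (mem_bddFun.1 hA).2 0
  have hcut : 2 * (μ' 0 + i) ≤ c + 3 * i := by
    omega
  have key := fun W => mag_step (K := K) (a + 1) k i (c + 3 * i) W μ' hA h1 h2' hcut (by omega) (by omega)
  rcases Nat.lt_or_ge i a with hia | hia
  · rw [magZ, if_pos hv, if_pos (by omega)]
    have hc0 : (fun q : Fin (i + 1 + 1) => μ' (i + 1 - q) + q) =
        Fin.cons 0 (fun q : Fin (i + 1) => μ' (i - q) + q + 1) := by
      funext q
      refine Fin.cases ?_ (fun q => ?_) q
      · simp [h2 (i + 1) le_rfl]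
      · simp only [Fin.val_succ, Fin.cons_succ, Nat.add_sub_add_right]
        omega
    rw [hc0, show c + 3 * (i + 1) = c + 3 * i + 3 by omega, Fdet_step _ _ (by omega)]
    refine Eq.trans ?_ ((key (fun _ => 1)).symm.trans ?_)
    · refine sum_congr rfl fun ε _ => ?_
      refine if_congr ?_ ?_ rfl
      · refine forall_congr' fun q => ?_
        omega
      · rw [one_mul]
        congr 1
        funext q
        omega
    · refine sum_congr rfl fun μ _ => ?_
      unfold MagT magE magZ
      rw [if_neg hia.ne, if_pos hia.le]
      by_cases h4 : MagValid i (c + 3 * i) μ <;> by_cases h5 : MagStep μ μ' <;> simp [h4, h5, hv]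
  · have : i = a := by omega
    subst this
    rw [magZ, if_pos hv, if_neg (by omega), magDet, Fdet_final]
    refine ((key (fun ε => ∏ q, if ε q then 1 else t)).symm.trans ?_)
    refine sum_congr rfl fun μ _ => ?_
    rw [prod_ite_rev]
    unfold MagT magE magZ
    rw [if_pos rfl, if_pos le_rfl]
    by_cases h4 : MagValid i (c + 3 * i) μ <;> by_cases h5 : MagStep μ μ' <;> simp [h4, h5, hv]

open Classical in
theorem magZ_zero (a k c : ℕ) (t : K) (hc : 1 ≤ c) (μ : ℕ → ℕ) (hA : μ ∈ bddFun (a + 1) k) :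
    magZ a c t 0 μ = if μ = 0 then 1 else 0 := by
  unfold magZ
  rw [if_pos (Nat.zero_le a)]
  by_cases h : μ = 0
  · subst h
    rw [if_pos ⟨fun _ _ _ => le_rfl, fun _ _ => rfl, by simp; omega⟩, if_pos rfl]
    have : ¬ (0 = c) := by omega
    simp [Fdet, Matrix.det_fin_one, gM, this, Polynomial.coeff_X_pow]
  · rw [if_neg h, if_neg]
    rintro ⟨_, h2, _⟩
    exact h (funext fun p => h2 p (Nat.zero_le _))

open Classical in
theorem magZ_last (a k c : ℕ) (t : K) (hc : 1 ≤ c) (hk : 2 * (k + a) ≤ c + 3 * a) :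
    ∑ μ ∈ bddFun (a + 1) k, magZ a c t (a + 1) μ =
      ∑ J ∈ (Fintype.piFinset (fun _ : Fin (a + 1) => Icc 0 (k + a))).filter StrictMono,
        magDet a c t J := by
  have e : ∀ μ ∈ bddFun (a + 1) k, magZ a c t (a + 1) μ =
      if Antitone μ then magDet a c t (fun q => μ (a - q) + q) else 0 := by
    intro μ hμ
    have h1 := mem_bddFun.1 hμ
    unfold magZ
    rw [if_neg (show ¬ (a + 1 ≤ a) by omega)]
    refine if_congr ⟨fun h => h.1, fun h => ⟨h, h1.1, ?_⟩⟩ rfl rfl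
    have := h1.2 0
    omega
  rw [sum_congr rfl e, ← sum_filter]
  refine sum_bij (fun μ _ => fun q => μ (a - q) + q) ?_ ?_ ?_ ?_
  · intro μ hμ
    simp only [mem_filter, mem_bddFun] at hμ
    simp only [mem_filter, Fintype.mem_piFinset, mem_Icc]
    refine ⟨fun q => ⟨Nat.zero_le _, ?_⟩, fun q q' h => ?_⟩
    · have := hμ.1.2 (a - q)
      have := q.2
      omega
    · have := hμ.2 (show a - (q' : ℕ) ≤ a - q by have : (q : ℕ) < q' := h; omega)
      have : (q : ℕ) < q' := h
      show μ (a - q) + q < μ (a - q') + q'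
      omega
  · intro μ₁ h1 μ₂ h2 he
    simp only [mem_filter, mem_bddFun] at h1 h2
    funext p
    by_cases hp : p ≤ a
    · have := congrFun he ⟨a - p, by omega⟩
      simp only [show a - (a - p) = p by omega] at this
      omega
    · rw [h1.1.1 p (by omega), h2.1.1 p (by omega)]
  · intro J hJ
    simp only [mem_filter, Fintype.mem_piFinset, mem_Icc] at hJ
    obtain ⟨hJ1, hmono⟩ := hJ
    have hyq : ∀ q : Fin (a + 1), (q : ℕ) ≤ J q := by
      intro q
      induction q using Fin.induction with
      | zero => simp
      | succ q ih =>
        have := hmono (Fin.castSucc_lt_succ (i := q))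
        simp only [Fin.val_succ, Fin.val_castSucc] at *
        omega
    have hup : ∀ d : ℕ, ∀ q : Fin (a + 1), (q : ℕ) + d = a → J q + d ≤ k + a := by
      intro d
      induction d with
      | zero => intro q _; have := (hJ1 q).2; omega
      | succ d ih =>
        intro q hq
        have h1 := ih ⟨q + 1, by omega⟩ (by simp; omega)
        have h2 := hmono (show q < ⟨q + 1, by omega⟩ by rw [Fin.lt_def]; simp)
        omega
    let μ : ℕ → ℕ := fun p => if h : p ≤ a then J ⟨a - p, by omega⟩ - (a - p) else 0
    have hμ : ∀ q : Fin (a + 1), μ (a - q) + q = J q := by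
      intro q
      have := q.2
      have e : (⟨a - (a - q), by omega⟩ : Fin (a + 1)) = q := by ext; simp; omega
      have h3 := hyq q
      simp only [μ]
      rw [dif_pos (by omega), e]
      omega
    refine ⟨μ, ?_, funext hμ⟩
    simp only [mem_filter, mem_bddFun]
    refine ⟨⟨fun p hp => ?_, fun p => ?_⟩, antitone_nat_of_succ_le fun p => ?_⟩
    · simp only [μ]; rw [dif_neg (by omega)]
    · simp only [μ]
      split_ifs with h
      · have := hup p ⟨a - p, by omega⟩ (by simp; omega)
        omega
      · omega
    · simp only [μ]
      by_cases h : p + 1 ≤ a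
      · rw [dif_pos h, dif_pos (by omega)]
        have := hmono (show (⟨a - (p + 1), by omega⟩ : Fin (a + 1)) < ⟨a - p, by omega⟩ by
          rw [Fin.lt_def]; simp; omega)
        omega
      · rw [dif_neg h]; omega
  · intro μ _; rfl

open Classical in
/-- generating function of the Magog paths -/
theorem mag_gf (a k c : ℕ) (t : K) (hc : 1 ≤ c) (hk : 2 * (k + a) ≤ c + 3 * a) :
    ∑ π ∈ (Fintype.piFinset (fun _ : Fin (a + 1 + 1) => bddFun (a + 1) k)).filter (fun π => π 0 = 0 ∧
      (∀ i : Fin (a + 1), MagT c i (π i.castSucc) (π i.succ))),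
      t ^ (((range (a + 1)).filter fun p => π (Fin.last a).castSucc p = π (Fin.last (a + 1)) p).card) =
      ∑ J ∈ (Fintype.piFinset (fun _ : Fin (a + 1) => Icc 0 (k + a))).filter StrictMono,
        cf J ((∏ p : Fin (a + 1), (MvPolynomial.C t + MvPolynomial.X p)) *
          PhiTwo (a + 1) (c + a) MvPolynomial.X) := by
  have h := chain_gf (bddFun (a + 1) k) 0 (a + 1) t (MagT c) (magE a) (fun _ => True) (magZ a c t)
    (fun s hs => magZ_zero a k c t hc s hs)
    (fun i hi s hs => magZ_step a k c t hc hk i hi s hs)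
  simp only [filter_true, and_true] at h
  rw [magZ_last a k c t hc hk] at h
  have h2 : ∀ J : Fin (a + 1) → ℕ, cf J ((∏ p : Fin (a + 1), (MvPolynomial.C t + MvPolynomial.X p)) *
          PhiTwo (a + 1) (c + a) MvPolynomial.X) = magDet a c t J := by
    intro J
    rw [cf_s_Phi, magDet, show c + a + 2 * (a + 1 - 1) = c + 3 * a by omega]
  simp_rw [h2]
  rw [← h]
  refine sum_congr rfl fun π _ => ?_
  congr 1
  rw [sum_eq_single (Fin.last a)]
  · simp [magE]
  · intro i _ hi
    have : (i : ℕ) ≠ a := fun h => hi (Fin.ext (by simpa using h))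
    simp [magE, this]
  · simp

end PartC3


section PartC4

theorem mem_iff_le_card (k : ℕ) (P : ℕ → Prop) [DecidablePred P]
    (hP : ∀ i, 1 ≤ i → i + 1 ≤ k → P (i + 1) → P i) (i : ℕ) (h1 : 1 ≤ i) (hk : i ≤ k) :
    i ≤ ((Icc 1 k).filter P).card ↔ P i := by
  have hdown : ∀ d i, 1 ≤ i → i + d ≤ k → P (i + d) → P i := by
    intro d
    induction d with
    | zero => intro i _ _ h; exact h
    | succ d ih => intro i h1 h2 h; exact ih i h1 (by omega) (hP (i + d) (by omega) (by omega) h)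
  constructor
  · intro h
    by_contra hn
    have : (Icc 1 k).filter P ⊆ Icc 1 (i - 1) := by
      intro x hx
      simp only [mem_filter, mem_Icc] at hx ⊢
      refine ⟨hx.1.1, ?_⟩
      by_contra hx2
      refine hn (hdown (x - i) i h1 (by omega) ?_)
      rw [show i + (x - i) = x by omega]
      exact hx.2
    have := card_le_card this
    simp at this
    omega
  · intro h
    have : Icc 1 i ⊆ (Icc 1 k).filter P := by
      intro x hx
      simp only [mem_filter, mem_Icc] at hx ⊢
      refine ⟨⟨hx.1, by omega⟩, hdown (i - x) x hx.1 (by omega) ?_⟩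
      rw [show x + (i - x) = i by omega]
      exact h
    have := card_le_card this
    simpa using this

/-- conjugate partition encoded by column `j` of a Magog pentagon -/
def magState {m n k l : ℕ} (M : MagogPentagon m n k l) (j p : ℕ) : ℕ :=
  ((Icc 1 k).filter fun i => p + 1 < M.entry j i).card

variable {m n k l : ℕ}

theorem mag_pos (M : MagogPentagon m n k l) (i j : ℕ) (h1 : 1 ≤ i) (h2 : i ≤ k) (h3 : i ≤ j)
    (h4 : j ≤ n) : 1 ≤ M.entry j i := by
  by_cases h : n + 2 * i ≤ l + j + 1
  · exact M.pos i j h1 h2 h3 h4 h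
  · rw [M.cut i j h1 h2 h3 h4 (by omega)]

theorem mag_noncut (M : MagogPentagon m n k l) (i j : ℕ) (h : 1 < M.entry j i) :
    1 ≤ i ∧ i ≤ k ∧ i ≤ j ∧ j ≤ n ∧ n + 2 * i ≤ l + j + 1 := by
  have h1 : 1 ≤ i ∧ i ≤ k ∧ i ≤ j ∧ j ≤ n := by
    by_contra h'
    rw [M.outside i j h'] at h
    omega
  obtain ⟨a, b, c, d⟩ := h1
  refine ⟨a, b, c, d, ?_⟩
  by_contra h'
  rw [M.cut i j a b c d (by omega)] at h
  omega

theorem mag_down (M : MagogPentagon m n k l) (p i j : ℕ) (h1 : 1 ≤ i)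
    (h : p + 1 < M.entry j (i + 1)) : p + 1 < M.entry (j - 1) i ∧ p + 1 < M.entry j i := by
  obtain ⟨_, b, c, d, e⟩ := mag_noncut M (i + 1) j (by omega)
  obtain ⟨j, rfl⟩ : ∃ j', j = j' + 1 := ⟨j - 1, by omega⟩
  have h2 := M.colDec i j h1 b (by omega) d (by omega)
  have h3 := M.rowInc i j h1 (by omega) (by omega) d (by omega)
  simp only [Nat.add_sub_cancel]
  omega

theorem le_magState (M : MagogPentagon m n k l) (p i j : ℕ) (h1 : 1 ≤ i) (hk : i ≤ k) :
    i ≤ magState M j p ↔ p + 1 < M.entry j i :=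
  mem_iff_le_card k _ (fun i' h1 _ h => (mag_down M p i' j h1 h).2) i h1 hk

theorem magState_le (M : MagogPentagon m n k l) (p j : ℕ) : magState M j p ≤ k := by
  unfold magState
  refine (card_filter_le _ _).trans ?_
  simp

theorem magState_spec (M : MagogPentagon m n k l) (p j : ℕ) (h : 1 ≤ magState M j p) :
    p + 1 < M.entry j (magState M j p) :=
  (le_magState M p _ j h (magState_le M p j)).1 le_rfl

theorem magState_anti (M : MagogPentagon m n k l) (j : ℕ) : Antitone (magState M j) := by
  intro p p' h
  unfold magState
  refine card_le_card fun i hi => ?_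
  simp only [mem_filter] at hi ⊢
  exact ⟨hi.1, by omega⟩

theorem magState_supp (M : MagogPentagon 0 n k l) (j p : ℕ) (h : j ≤ p + 1) :
    magState M j p = 0 := by
  by_contra h0
  have h1 := (le_magState M p 1 j le_rfl (by have := magState_le M p j; omega)).1 (by omega)
  obtain ⟨_, _, b, c, _⟩ := mag_noncut M 1 j (by omega)
  have := M.bound j b c
  omega

theorem magState_step (M : MagogPentagon m n k l) (j : ℕ) (hj : j + 1 ≤ n) :
    MagStep (magState M j) (magState M (j + 1)) := by
  intro p
  constructor
  · by_cases h : magState M j p = 0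
    · omega
    · have h1 := magState_spec M p j (by omega)
      obtain ⟨a, b, c, d, e⟩ := mag_noncut M (magState M j p) j (by omega)
      refine (le_magState M p _ _ a b).2 ?_
      have := M.rowInc _ j a b c hj e
      omega
  · by_contra h
    obtain ⟨i, hi⟩ : ∃ i, magState M (j + 1) p = i + 1 := ⟨magState M (j + 1) p - 1, by omega⟩
    have h1 := magState_spec M p (j + 1) (by omega)
    rw [hi] at h1
    have h2 := (mag_down M p i (j + 1) (by omega) h1).1
    have h3 := (le_magState M p i j (by omega) (by have := magState_le M p (j + 1); omega)).2 h2
    omega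

theorem magState_valid (a c : ℕ) (hc : 1 ≤ c) (hn : n = a + 2) (hl : l + 1 = c + a)
    (M : MagogPentagon 0 n k l) (i : ℕ) :
    MagValid i (c + 3 * i) (magState M (i + 1)) := by
  refine ⟨magState_anti M _, fun p hp => magState_supp M _ _ (by omega), ?_⟩
  by_cases h : magState M (i + 1) 0 = 0
  · omega
  · have h1 := magState_spec M 0 (i + 1) (by omega)
    obtain ⟨_, _, _, _, e⟩ := mag_noncut M _ (i + 1) (by omega)
    omega

open Classical in
noncomputable def magPaths (a k c : ℕ) : Finset (Fin (a + 1 + 1) → ℕ → ℕ) :=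
  (Fintype.piFinset (fun _ : Fin (a + 1 + 1) => bddFun (a + 1) k)).filter (fun π => π 0 = 0 ∧
      (∀ i : Fin (a + 1), MagT c i (π i.castSucc) (π i.succ)))

def magPathOf (a : ℕ) {k d : ℕ} (M : MagogPentagon 0 (a + 2) k d) : Fin (a + 1 + 1) → ℕ → ℕ :=
  fun i => magState M (i + 1)

theorem magPathOf_mem (a k c d : ℕ) (hc : 1 ≤ c) (hd : d + 1 = c + a)
    (M : MagogPentagon 0 (a + 2) k d) : magPathOf a M ∈ magPaths a k c := by
  unfold magPaths
  simp only [mem_filter, Fintype.mem_piFinset, mem_bddFun]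
  refine ⟨fun i => ⟨fun p hp => magState_supp M _ _ (by omega), fun p => magState_le _ _ _⟩, ?_, ?_⟩
  · funext p
    exact magState_supp M _ _ (by simp)
  · intro i
    exact ⟨magState_step M _ (by simp; omega), magState_valid a c hc rfl hd M _⟩

theorem entry_eq (a k d : ℕ) (M : MagogPentagon 0 (a + 2) k d) (i j : ℕ) (h1 : 1 ≤ i) (h2 : i ≤ k)
    (h3 : i ≤ j) (h4 : j ≤ a + 2) :
    M.entry j i = 1 + ((range (a + 1)).filter fun p => i ≤ magState M j p).card := by
  have hp := mag_pos M i j h1 h2 h3 h4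
  have hle : M.entry j i ≤ a + 2 := by
    by_contra h
    have h5 := (le_magState M (a + 1) i j h1 h2).2 (by omega)
    rw [magState_supp M j (a + 1) (by omega)] at h5
    omega
  have : (range (a + 1)).filter (fun p => i ≤ magState M j p) = range (M.entry j i - 1) := by
    ext p
    simp only [mem_filter, mem_range, le_magState M p i j h1 h2]
    omega
  rw [this, card_range]
  omega

theorem magPathOf_inj (a k d : ℕ) :
    Function.Injective (magPathOf a : MagogPentagon 0 (a + 2) k d → _) := by
  intro M M' h
  have : M.entry = M'.entry := by
    funext j i
    by_cases hs : 1 ≤ i ∧ i ≤ k ∧ i ≤ j ∧ j ≤ a + 2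
    · obtain ⟨h1, h2, h3, h4⟩ := hs
      have := congrFun h ⟨j - 1, by omega⟩
      simp only [magPathOf, show j - 1 + 1 = j by omega] at this
      rw [entry_eq a k d M i j h1 h2 h3 h4, entry_eq a k d M' i j h1 h2 h3 h4, this]
    · rw [M.outside i j hs, M'.outside i j hs]
  cases M; cases M'; simp at this; subst this; rfl

theorem magPaths_valid (a k c : ℕ) (hc : 1 ≤ c) (π : Fin (a + 1 + 1) → ℕ → ℕ)
    (h : π ∈ magPaths a k c) (i : Fin (a + 1 + 1)) : MagValid i (c + 3 * i) (π i) := by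
  unfold magPaths at h
  simp only [mem_filter] at h
  refine Fin.cases ?_ (fun i => ?_) i
  · rw [h.2.1]
    exact ⟨fun _ _ _ => le_rfl, fun _ _ => rfl, by simp; omega⟩
  · exact (h.2.2 i).2

theorem magPathOf_surj (a k c d : ℕ) (hc : 1 ≤ c) (hd : d + 1 = c + a)
    (π : Fin (a + 1 + 1) → ℕ → ℕ) (hπ : π ∈ magPaths a k c) :
    ∃ M : MagogPentagon 0 (a + 2) k d, magPathOf a M = π := by
  have hval := magPaths_valid a k c hc π hπ
  unfold magPaths at hπ
  simp only [mem_filter, Fintype.mem_piFinset, mem_bddFun] at hπ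
  obtain ⟨hb, h0, hT⟩ := hπ
  let ν : ℕ → ℕ → ℕ := fun j p => if h : j - 1 < a + 1 + 1 then π ⟨j - 1, h⟩ p else 0
  have hν : ∀ i : Fin (a + 1 + 1), ν (i + 1) = π i := by
    intro i
    funext p
    simp [ν]
    omega
  have hνval : ∀ j, 1 ≤ j → j ≤ a + 2 → MagValid (j - 1) (c + 3 * (j - 1)) (ν j) := by
    intro j h1 h2
    have := hval ⟨j - 1, by omega⟩
    rw [← hν] at this
    simpa [show j - 1 + 1 = j by omega] using this
  have hνstep : ∀ j, 1 ≤ j → j + 1 ≤ a + 2 → MagStep (ν j) (ν (j + 1)) := by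
    intro j h1 h2
    have := (hT ⟨j - 1, by omega⟩).1
    rw [← hν, ← hν] at this
    simpa [show j - 1 + 1 = j by omega] using this
  let E : ℕ → ℕ → ℕ := fun j i => if 1 ≤ i ∧ i ≤ k ∧ i ≤ j ∧ j ≤ a + 2 then
    1 + ((range (a + 1)).filter fun p => i ≤ ν j p).card else 0
  have hE : ∀ i j, 1 ≤ i → i ≤ k → i ≤ j → j ≤ a + 2 → E j i =
    1 + ((range (a + 1)).filter fun p => i ≤ ν j p).card := by
    intro i j h1 h2 h3 h4
    simp only [E]; rw [if_pos ⟨h1, h2, h3, h4⟩]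
  let M : MagogPentagon 0 (a + 2) k d :=
    { entry := E
      pos := by
        intro i j h1 h2 h3 h4 _
        rw [hE i j h1 h2 h3 h4]; omega
      rowInc := by
        intro i j h1 h2 h3 h4 _
        rw [hE i j h1 h2 h3 (by omega), hE i (j + 1) h1 h2 (by omega) h4]
        refine Nat.add_le_add_left (card_le_card fun p hp => ?_) 1
        simp only [mem_filter] at hp ⊢
        have := hνstep j (by omega) h4 p
        exact ⟨hp.1, by omega⟩
      colDec := by
        intro i j h1 h2 h3 h4 _
        rw [hE i j h1 (by omega) h3 (by omega), hE (i + 1) (j + 1) (by omega) h2 (by omega) h4]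
        refine Nat.add_le_add_left (card_le_card fun p hp => ?_) 1
        simp only [mem_filter] at hp ⊢
        have := hνstep j (by omega) h4 p
        exact ⟨hp.1, by omega⟩
      bound := by
        intro j h1 h2
        by_cases hk : 1 ≤ k
        · rw [hE 1 j le_rfl hk h1 h2]
          have : (range (a + 1)).filter (fun p => 1 ≤ ν j p) ⊆ range (j - 1) := by
            intro p hp
            simp only [mem_filter, mem_range] at hp ⊢
            by_contra h
            have := (hνval j h1 h2).2.1 p (by omega)
            omega
          have := card_le_card this
          rw [card_range] at this
          omega
        · simp only [E]; rw [if_neg (by omega)]; omega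
      cut := by
        intro i j h1 h2 h3 h4 h5
        rw [hE i j h1 h2 h3 h4]
        rw [filter_false_of_mem, card_empty]
        intro p _ hp
        have hv := hνval j (by omega) h4
        have := hv.1 (Nat.zero_le p)
        have := hv.2.2
        omega
      outside := by
        intro i j h
        simp only [E]; rw [if_neg h] }
  refine ⟨M, ?_⟩
  have hbd : ∀ j, ∀ h : j < a + 1 + 1, ∀ p, π ⟨j, h⟩ p ≤ j := by
    intro j
    induction j with
    | zero => intro h p; have : π ⟨0, h⟩ = 0 := h0
              rw [this]; simp
    | succ j ih =>
      intro h p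
      have h1 := ih (by omega) p
      have h2 := ((hT ⟨j, by omega⟩).1 p).2
      simp only [Fin.castSucc_mk, Fin.succ_mk] at h2
      omega
  funext i p
  change magState M (i + 1) p = _
  have hv := hval i
  have hbi := hb i
  have e : (Icc 1 k).filter (fun i' => p + 1 < M.entry (i + 1) i') = Icc 1 (π i p) := by
    ext i'
    simp only [mem_filter, mem_Icc]
    by_cases hs : 1 ≤ i' ∧ i' ≤ k ∧ i' ≤ i + 1
    · obtain ⟨s1, s2, s3⟩ := hs
      have h1 : M.entry (i + 1) i' = _ := hE i' (i + 1) s1 s2 s3 (by omega)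
      rw [h1, hν]
      have h2 : p < ((range (a + 1)).filter fun p => i' ≤ π i p).card ↔ i' ≤ π i p := by
        constructor
        · intro h
          by_contra hn
          have : ((range (a + 1)).filter fun p => i' ≤ π i p) ⊆ range p := by
            intro x hx
            simp only [mem_filter, mem_range] at hx ⊢
            by_contra hx2
            have := hv.1 (show p ≤ x by omega)
            omega
          have := card_le_card this
          rw [card_range] at this
          omega
        · intro h
          have hp : p < a + 1 := by
            by_contra hp
            have := hbi.1 p (by omega)
            omega
          have : range (p + 1) ⊆ ((range (a + 1)).filter fun p => i' ≤ π i p) := by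
            intro x hx
            simp only [mem_filter, mem_range] at hx ⊢
            have := hv.1 (show x ≤ p by omega)
            omega
          have := card_le_card this
          rw [card_range] at this
          omega
      omega
    · constructor
      · intro h
        obtain ⟨x1, x2, x3, _⟩ := mag_noncut M i' (i + 1) (by omega)
        exact absurd ⟨x1, x2, x3⟩ hs
      · intro h
        exfalso
        apply hs
        have := hbi.2 p
        have := hbd i i.2 p
        simp only [Fin.eta] at this
        omega
  unfold magState
  rw [e]
  simp

theorem sum_card_le (a k : ℕ) (μ : ℕ → ℕ) (h : ∀ p, μ p ≤ k) :
    ∑ i ∈ Icc 1 k, ((range (a + 1)).filter fun p => i ≤ μ p).card = ∑ p ∈ range (a + 1), μ p := by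
  simp_rw [card_filter]
  rw [sum_comm]
  refine sum_congr rfl fun p _ => ?_
  rw [← card_filter]
  have : (Icc 1 k).filter (fun i => i ≤ μ p) = Icc 1 (μ p) := by
    ext i
    have := h p
    simp only [mem_filter, mem_Icc]
    omega
  rw [this]; simp

theorem tau_eq (a k d : ℕ) (hk : k ≤ a + 1) (M : MagogPentagon 0 (a + 2) k d) :
    M.tau = 1 + (((range (a + 1)).filter fun p => magPathOf a M (Fin.last a).castSucc p =
      magPathOf a M (Fin.last (a + 1)) p).card : ℤ) := by
  unfold MagogPentagon.tau magPathOf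
  simp only [Fin.val_castSucc, Fin.val_last]
  have e : ∀ j, a + 1 ≤ j → j ≤ a + 2 → ∑ i ∈ Icc 1 k, (M.entry j i : ℤ) =
      k + ∑ p ∈ range (a + 1), (magState M j p : ℤ) := by
    intro j h1 h2
    have := sum_card_le a k (magState M j) (magState_le M · j)
    rw [← Nat.cast_sum (range (a + 1)), ← this]
    push_cast
    have hk1 : (k : ℤ) = ∑ i ∈ Icc 1 k, (1 : ℤ) := by simp
    conv_rhs => rw [hk1]
    rw [← sum_add_distrib]
    refine sum_congr rfl fun i hi => ?_
    rw [mem_Icc] at hi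
    rw [entry_eq a k d M i j hi.1 hi.2 (by omega) h2]
    push_cast
    rfl
  rw [sum_sub_distrib, e _ (by omega) (by omega), e _ (by omega) (by omega)]
  have h3 : ∀ p ∈ range (a + 1), (magState M (a + 1 + 1) p : ℤ) = magState M (a + 1) p + 1 -
      (if magState M (a + 1) p = magState M (a + 1 + 1) p then 1 else 0) := by
    intro p _
    have := magState_step M (a + 1) le_rfl p
    split_ifs <;> omega
  rw [sum_congr rfl h3, sum_sub_distrib, sum_add_distrib, card_filter]
  simp
  ring

theorem natCard_eq_of_bij {α β : Type*} (P : α → Prop) (s : Finset β) (f : α → β)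
    (hinj : Function.Injective f) (h1 : ∀ x, P x → f x ∈ s) (h2 : ∀ b ∈ s, ∃ x, P x ∧ f x = b) :
    Nat.card {x // P x} = s.card := by
  have hb : Function.Bijective (fun x : {x // P x} => (⟨f x, h1 x x.2⟩ : s)) := by
    constructor
    · intro x y h
      exact Subtype.ext (hinj (congrArg Subtype.val h))
    · rintro ⟨b, hb⟩
      obtain ⟨x, hx, rfl⟩ := h2 b hb
      exact ⟨⟨x, hx⟩, rfl⟩
  rw [Nat.card_congr (Equiv.ofBijective _ hb), Nat.card_eq_fintype_card, Fintype.card_coe]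

theorem magog_card (a k c d p : ℕ) (hc : 1 ≤ c) (hd : d + 1 = c + a) (hk : k ≤ a + 1) :
    Nat.card {M : MagogPentagon 0 (a + 2) k d // M.tau = (p : ℤ)} =
      ((magPaths a k c).filter fun π => 1 + ((range (a + 1)).filter fun p =>
        π (Fin.last a).castSucc p = π (Fin.last (a + 1)) p).card = p).card := by
  refine natCard_eq_of_bij _ _ (magPathOf a) (magPathOf_inj a k d) ?_ ?_
  · intro M hM
    rw [tau_eq a k d hk] at hM
    rw [mem_filter]
    exact ⟨magPathOf_mem a k c d hc hd M, by exact_mod_cast hM⟩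
  · intro π hπ
    rw [mem_filter] at hπ
    obtain ⟨M, rfl⟩ := magPathOf_surj a k c d hc hd π hπ.1
    refine ⟨M, ?_, rfl⟩
    rw [tau_eq a k d hk]
    exact_mod_cast hπ.2

end PartC4


section PartB1

/-- number of elements of `S` below `c` -/
def cnt (S : Finset ℕ) (c : ℕ) : ℕ := Nat.count (· ∈ S) c

theorem cnt_zero (S : Finset ℕ) : cnt S 0 = 0 := by simp [cnt]

theorem cnt_succ (S : Finset ℕ) (c : ℕ) : cnt S (c + 1) = cnt S c + if c ∈ S then 1 else 0 :=
  Nat.count_succ _ _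

theorem cnt_congr (S S' : Finset ℕ) (c : ℕ) (h : ∀ d < c, d ∈ S ↔ d ∈ S') : cnt S c = cnt S' c := by
  induction c with
  | zero => simp [cnt_zero]
  | succ c ih =>
    rw [cnt_succ, cnt_succ, ih (fun d hd => h d (by omega))]
    simp [h c (by omega)]

theorem cnt_insert (S : Finset ℕ) (C d : ℕ) (h : d ≤ C) : cnt (insert C S) d = cnt S d := by
  refine cnt_congr _ _ _ fun x hx => ?_
  rw [mem_insert]
  constructor
  · rintro (rfl | h')
    · omega
    · exact h'
  · exact Or.inr

theorem cnt_eq_card (S : Finset ℕ) (C : ℕ) (h : S ⊆ range C) : cnt S C = S.card := by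
  unfold cnt
  rw [Nat.count_eq_card_filter_range]
  congr 1
  ext x
  simp only [mem_filter, mem_range]
  exact ⟨fun h => h.2, fun hx => ⟨mem_range.1 (h hx), hx⟩⟩

/-- admissible transitions, restricted to columns `< C` -/
def okRow (F : ℕ → Prop) (S' : Finset ℕ) (C : ℕ) (S : Finset ℕ) : Prop :=
  (∀ d ≤ C, cnt S d ≤ cnt S' d ∧ cnt S' d ≤ cnt S d + 1) ∧ ∀ c < C, F c → (c ∈ S ↔ c ∈ S')

theorem okRow_succ (F : ℕ → Prop) (S' : Finset ℕ) (C : ℕ) (S : Finset ℕ) :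
    okRow F S' (C + 1) S ↔ okRow F S' C S ∧
      (cnt S (C + 1) ≤ cnt S' (C + 1) ∧ cnt S' (C + 1) ≤ cnt S (C + 1) + 1) ∧
      (F C → (C ∈ S ↔ C ∈ S')) := by
  unfold okRow
  constructor
  · rintro ⟨h1, h2⟩
    exact ⟨⟨fun d hd => h1 d (by omega), fun c hc => h2 c (by omega)⟩, h1 _ le_rfl, h2 C (by omega)⟩
  · rintro ⟨⟨h1, h2⟩, h3, h4⟩
    refine ⟨fun d hd => ?_, fun c hc => ?_⟩
    · rcases Nat.lt_or_ge d (C + 1) with h | h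
      · exact h1 d (by omega)
      · rw [show d = C + 1 by omega]; exact h3
    · rcases Nat.lt_or_ge c C with h | h
      · exact h2 c h
      · rw [show c = C by omega]; exact h4

theorem okRow_insert (F : ℕ → Prop) (S' : Finset ℕ) (C : ℕ) (S : Finset ℕ) :
    okRow F S' C (insert C S) ↔ okRow F S' C S := by
  unfold okRow
  refine and_congr ?_ ?_
  · refine forall_congr' fun d => forall_congr' fun hd => ?_
    rw [cnt_insert S C d hd]
  · refine forall_congr' fun c => forall_congr' fun hc => ?_
    have : c ∈ insert C S ↔ c ∈ S := by simp [hc.ne]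
    rw [this]

variable {P : Type*} [CommRing P]

open Classical in
/-- column scan: partial sums over subsets of the first `C` columns, with partial row sum `e`;
`w c j` is the letter for column `c` in variable `j`,
`v c b b'` the weight of column `c`. -/
noncomputable def scan (F : ℕ → Prop) (w : ℕ → ℕ → P) (v : ℕ → Prop → Prop → P) (S' : Finset ℕ)
    (e C : ℕ) : P :=
  ∑ S ∈ (range C).powerset, if okRow F S' C S ∧ cnt S' C = cnt S C + e then
    ∏ c ∈ range C, (v c (c ∈ S) (c ∈ S') * if c ∈ S then w c (cnt S c) else 1) else 0

open Classical in
theorem scan_succ (F : ℕ → Prop) (w : ℕ → ℕ → P) (v : ℕ → Prop → Prop → P) (S' : Finset ℕ)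
    (e C : ℕ) : scan F w v S' e (C + 1) =
    ∑ S ∈ (range C).powerset, if okRow F S' C S then
      (∏ c ∈ range C, (v c (c ∈ S) (c ∈ S') * if c ∈ S then w c (cnt S c) else 1)) *
      ((if (cnt S' (C + 1) = cnt S C + e ∧ e ≤ 1 ∧ (F C → ¬ (C ∈ S'))) then v C False (C ∈ S') else 0) +
       (if (cnt S' (C + 1) = cnt S C + 1 + e ∧ e ≤ 1 ∧ (F C → (C ∈ S'))) then
          v C True (C ∈ S') * w C (cnt S C) else 0)) else 0 := by
  unfold scan
  rw [range_add_one, sum_powerset_insert notMem_range_self, ← sum_add_distrib]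
  refine sum_congr rfl fun S hS => ?_
  rw [mem_powerset] at hS
  have hC : C ∉ S := fun h => by have := mem_range.1 (hS h); omega
  have e1 : cnt S (C + 1) = cnt S C := by rw [cnt_succ, if_neg hC, add_zero]
  have e2 : cnt (insert C S) (C + 1) = cnt S C + 1 := by
    rw [cnt_succ, if_pos (mem_insert_self _ _), cnt_insert _ _ _ le_rfl]
  have e3 : ∏ c ∈ range C, (v c (c ∈ insert C S) (c ∈ S') *
      if c ∈ insert C S then w c (cnt (insert C S) c) else 1) =
      ∏ c ∈ range C, (v c (c ∈ S) (c ∈ S') * if c ∈ S then w c (cnt S c) else 1) := by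
    refine prod_congr rfl fun c hc => ?_
    rw [mem_range] at hc
    have : c ∈ insert C S ↔ c ∈ S := by simp [hc.ne]
    rw [cnt_insert _ _ _ hc.le]
    simp only [this]
  rw [prod_insert notMem_range_self, prod_insert notMem_range_self, e3, okRow_succ, okRow_succ, okRow_insert, e1, e2,
    if_pos (mem_insert_self _ _), if_neg hC, cnt_insert _ _ _ le_rfl]
  by_cases h0 : okRow F S' C S
  · simp only [h0, true_and, if_true]
    rw [mul_add]
    congr 1
    · by_cases h1 : cnt S' (C + 1) = cnt S C + e ∧ e ≤ 1 ∧ (F C → ¬ (C ∈ S'))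
      · rw [if_pos h1, if_pos]
        · simp only [hC]; ring
        · refine ⟨⟨by omega, fun hF => ?_⟩, h1.1⟩
          simp [hC, h1.2.2 hF]
      · rw [if_neg h1, if_neg, mul_zero]
        rintro ⟨⟨h2, h3⟩, h4⟩
        refine h1 ⟨h4, by omega, fun hF h => hC ((h3 hF).2 h)⟩
    · by_cases h1 : cnt S' (C + 1) = cnt S C + 1 + e ∧ e ≤ 1 ∧ (F C → (C ∈ S'))
      · rw [if_pos h1, if_pos]
        · simp only [mem_insert_self]; ring
        · refine ⟨⟨by omega, fun hF => ?_⟩, h1.1⟩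
          simp [h1.2.2 hF]
      · rw [if_neg h1, if_neg, mul_zero]
        rintro ⟨⟨h2, h3⟩, h4⟩
        refine h1 ⟨h4, by omega, fun hF => (h3 hF).1 (mem_insert_self _ _)⟩
  · simp [h0]

open Classical in
theorem scan_eq (F : ℕ → Prop) (w : ℕ → ℕ → P) (v : ℕ → Prop → Prop → P) (S' : Finset ℕ)
    (e C : ℕ) : scan F w v S' e C = ∑ S ∈ (range C).powerset, if okRow F S' C S then
      (∏ c ∈ range C, (v c (c ∈ S) (c ∈ S') * if c ∈ S then w c (cnt S c) else 1)) *
      (if cnt S' C = cnt S C + e then 1 else 0) else 0 := by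
  unfold scan
  refine sum_congr rfl fun S _ => ?_
  by_cases h0 : okRow F S' C S <;> simp [h0]

open Classical in
theorem scan_zero_notMem (F : ℕ → Prop) (w : ℕ → ℕ → P) (v : ℕ → Prop → Prop → P) (S' : Finset ℕ)
    (C : ℕ) (h : C ∉ S') : scan F w v S' 0 (C + 1) =
      scan F w v S' 0 C * v C False False + (if F C then 0 else
        scan F w v S' 1 C * (v C True False * w C (cnt S' C - 1))) := by
  have e1 : cnt S' (C + 1) = cnt S' C := by rw [cnt_succ, if_neg h, add_zero]
  rw [scan_succ, scan_eq, scan_eq]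
  by_cases hF : F C
  · rw [if_pos hF, add_zero, sum_mul]
    refine sum_congr rfl fun S _ => ?_
    by_cases h0 : okRow F S' C S
    · simp [h0, e1, hF, h, mul_comm]
    · simp [h0]
  · rw [if_neg hF, sum_mul, sum_mul, ← sum_add_distrib]
    refine sum_congr rfl fun S _ => ?_
    by_cases h0 : okRow F S' C S
    · have h1 := h0.1 C le_rfl
      rcases (show cnt S' C = cnt S C ∨ cnt S' C = cnt S C + 1 by omega) with h2 | h2
      · simp [h0, e1, hF, h, h2]
      · simp [h0, e1, hF, h, h2]
    · simp [h0]

open Classical in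
theorem scan_one_notMem (F : ℕ → Prop) (w : ℕ → ℕ → P) (v : ℕ → Prop → Prop → P) (S' : Finset ℕ)
    (C : ℕ) (h : C ∉ S') : scan F w v S' 1 (C + 1) = scan F w v S' 1 C * v C False False := by
  have e1 : cnt S' (C + 1) = cnt S' C := by rw [cnt_succ, if_neg h, add_zero]
  rw [scan_succ, scan_eq, sum_mul]
  refine sum_congr rfl fun S _ => ?_
  by_cases h0 : okRow F S' C S
  · have h1 := h0.1 C le_rfl
    rcases (show cnt S' C = cnt S C ∨ cnt S' C = cnt S C + 1 by omega) with h2 | h2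
    · simp [h0, e1, h, h2]
      intro hh; omega
    · simp [h0, e1, h, h2]
  · simp [h0]

open Classical in
theorem scan_zero_mem (F : ℕ → Prop) (w : ℕ → ℕ → P) (v : ℕ → Prop → Prop → P) (S' : Finset ℕ)
    (C : ℕ) (h : C ∈ S') : scan F w v S' 0 (C + 1) =
      scan F w v S' 0 C * (v C True True * w C (cnt S' C)) := by
  have e1 : cnt S' (C + 1) = cnt S' C + 1 := by rw [cnt_succ, if_pos h]
  rw [scan_succ, scan_eq, sum_mul]
  refine sum_congr rfl fun S _ => ?_
  by_cases h0 : okRow F S' C S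
  · have h1 := h0.1 C le_rfl
    rcases (show cnt S' C = cnt S C ∨ cnt S' C = cnt S C + 1 by omega) with h2 | h2
    · simp [h0, e1, h, h2]
    · simp [h0, e1, h, h2]
      intro hh; omega
  · simp [h0]

open Classical in
theorem scan_one_mem (F : ℕ → Prop) (w : ℕ → ℕ → P) (v : ℕ → Prop → Prop → P) (S' : Finset ℕ)
    (C : ℕ) (h : C ∈ S') : scan F w v S' 1 (C + 1) =
      (if F C then 0 else scan F w v S' 0 C * v C False True) +
        scan F w v S' 1 C * (v C True True * w C (cnt S' C - 1)) := by
  have e1 : cnt S' (C + 1) = cnt S' C + 1 := by rw [cnt_succ, if_pos h]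
  rw [scan_succ, scan_eq, scan_eq]
  by_cases hF : F C
  · rw [if_pos hF, zero_add, sum_mul]
    refine sum_congr rfl fun S _ => ?_
    by_cases h0 : okRow F S' C S
    · have h1 := h0.1 C le_rfl
      rcases (show cnt S' C = cnt S C ∨ cnt S' C = cnt S C + 1 by omega) with h2 | h2
      · simp [h0, e1, hF, h, h2]
      · simp [h0, e1, hF, h, h2]
    · simp [h0]
  · rw [if_neg hF, sum_mul, sum_mul, ← sum_add_distrib]
    refine sum_congr rfl fun S _ => ?_
    by_cases h0 : okRow F S' C S
    · have h1 := h0.1 C le_rfl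
      rcases (show cnt S' C = cnt S C ∨ cnt S' C = cnt S C + 1 by omega) with h2 | h2
      · simp [h0, e1, hF, h, h2]
      · simp [h0, e1, hF, h, h2]
    · simp [h0]

end PartB1


section PartB2

/-- letters -/
def wl {R : Type*} [CommRing R] (n i c : ℕ) (t y : R) : R :=
  if c ≤ i then (1 + y) ^ c * (-y) ^ (i - c) * (t * (1 + y) - y)
  else if c < 2 * n - i then (1 + y) ^ c
  else (1 + y) ^ (2 * n - 1 - i) * y ^ (c + i - 2 * n) * (1 + t * y)

theorem map_wl {R S : Type*} [CommRing R] [CommRing S] (φ : R →+* S) (n i c : ℕ) (t y : R) :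
    φ (wl n i c t y) = wl n i c (φ t) (φ y) := by
  unfold wl
  split_ifs <;> simp

variable {K : Type*} [CommRing K]

/-- swap of adjacent variables -/
noncomputable def sw (j : ℕ) : MvPolynomial ℕ K →+* MvPolynomial ℕ K :=
  (MvPolynomial.rename (Equiv.swap j (j + 1))).toRingHom

theorem sw_X (j k : ℕ) (h1 : k ≠ j) (h2 : k ≠ j + 1) :
    sw j (MvPolynomial.X k : MvPolynomial ℕ K) = MvPolynomial.X k := by
  simp [sw, Equiv.swap_apply_of_ne_of_ne h1 h2]

theorem sw_C (j : ℕ) (t : K) : sw j (MvPolynomial.C t) = MvPolynomial.C t := by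
  simp [sw]

theorem sw_X_left (j : ℕ) : sw j (MvPolynomial.X j : MvPolynomial ℕ K) = MvPolynomial.X (j + 1) := by
  simp [sw]

theorem sw_X_right (j : ℕ) : sw j (MvPolynomial.X (j + 1) : MvPolynomial ℕ K) = MvPolynomial.X j := by
  simp [sw]

open MvPolynomial

variable (K) in
/-- the null space -/
noncomputable def nullSp (a : ℕ) : AddSubgroup (MvPolynomial ℕ K) :=
  AddSubgroup.closure {x | ∃ j Q, j + 1 < a ∧ sw j Q = Q ∧ x = (1 + X j + X j * X (j + 1)) * Q}

theorem nullSp_mono {a b : ℕ} (h : a ≤ b) : nullSp K a ≤ nullSp K b := by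
  refine AddSubgroup.closure_mono ?_
  rintro x ⟨j, Q, h1, h2, h3⟩
  exact ⟨j, Q, by omega, h2, h3⟩

theorem nullSp_mul (a : ℕ) (x y : MvPolynomial ℕ K) (hx : x ∈ nullSp K a)
    (hy : ∀ j, j + 1 < a → sw j y = y) : x * y ∈ nullSp K a := by
  unfold nullSp at hx
  induction hx using AddSubgroup.closure_induction with
  | mem x hx =>
    obtain ⟨j, Q, h1, h2, rfl⟩ := hx
    refine AddSubgroup.subset_closure ⟨j, Q * y, h1, ?_, by ring⟩
    rw [map_mul, h2, hy j h1]
  | zero => rw [zero_mul]; exact AddSubgroup.zero_mem _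
  | add x z _ _ h1 h2 => rw [add_mul]; exact AddSubgroup.add_mem _ h1 h2
  | neg x _ h => rw [neg_mul]; exact AddSubgroup.neg_mem _ h

/-- column recursion for the reduced scans: `(H, Π)` -/
noncomputable def HPi (S' : Finset ℕ) (w' : ℕ → MvPolynomial ℕ K → MvPolynomial ℕ K) :
    ℕ → MvPolynomial ℕ K × MvPolynomial ℕ K
  | 0 => (0, 1)
  | c + 1 => if c ∈ S' then
      ((HPi S' w' c).1 * ((1 + X (cnt S' c - 1)) * w' c (X (cnt S' c - 1))) + w' c 0 * (HPi S' w' c).2,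
        (HPi S' w' c).2 * (- w' c (X (cnt S' c)))) else HPi S' w' c

theorem HPi_zero (S' : Finset ℕ) (w' : ℕ → MvPolynomial ℕ K → MvPolynomial ℕ K) (C : ℕ)
    (h : cnt S' C = 0) : HPi S' w' C = (0, 1) := by
  induction C with
  | zero => rfl
  | succ C ih =>
    rw [cnt_succ] at h
    have h1 : C ∉ S' := fun hh => by rw [if_pos hh] at h; omega
    rw [HPi, if_neg h1, ih (by omega)]

theorem sw_HPi (S' : Finset ℕ) (w' : ℕ → MvPolynomial ℕ K → MvPolynomial ℕ K)
    (hw : ∀ c j x, sw j (w' c x) = w' c (sw j x)) (C : ℕ) :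
    (∀ j, cnt S' C ≤ j + 1 → sw j (HPi S' w' C).1 = (HPi S' w' C).1) ∧
    (∀ j, cnt S' C ≤ j → sw j (HPi S' w' C).2 = (HPi S' w' C).2) := by
  induction C with
  | zero => simp [HPi]
  | succ C ih =>
    by_cases h : C ∈ S'
    · rw [HPi, if_pos h, cnt_succ, if_pos h]
      dsimp only
      constructor
      · intro j hj
        by_cases h0 : cnt S' C = 0
        · rw [HPi_zero _ _ _ h0]
          simp [hw]
        · rw [map_add, map_mul, map_mul, map_mul, ih.1 j (by omega), ih.2 j (by omega), hw, hw, map_add,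
            sw_X _ _ (by omega) (by omega)]
          simp
      · intro j hj
        rw [map_mul, map_neg, hw, ih.2 j (by omega), sw_X _ _ (by omega) (by omega)]
    · rw [HPi, if_neg h, cnt_succ, if_neg h]
      exact ih

/-- frozen columns -/
def frz (n i c : ℕ) : Prop := c ≤ i ∨ 2 * n - i ≤ c

open Classical in
/-- column weights -/
noncomputable def vwt {R : Type*} [CommRing R] (n i : ℕ) (t : R) (c : ℕ) (b b' : Prop) : R :=
  if (c = i + 1 ∧ b' ∧ ¬ b) ∨ (c = 2 * n - i - 1 ∧ b ∧ b') then t else 1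

theorem scan_inv (n i : ℕ) (t : K) (S' : Finset ℕ) (hi : i + 2 ≤ n) (w : ℕ → ℕ → MvPolynomial ℕ K)
    (hw : ∀ c j, w c j = X j * wl n i c (C t) (X j)) (v : ℕ → Prop → Prop → MvPolynomial ℕ K)
    (hv : v = vwt n i (C t))
    (w' : ℕ → MvPolynomial ℕ K → MvPolynomial ℕ K) (hw' : ∀ c x, w' c x = wl n (i + 1) c (C t) x) (c : ℕ) :
    (c ≤ i + 1 → (HPi S' w' c).1 = 0 ∧ scan (frz n i) w v S' 1 c = 0 ∧
      scan (frz n i) w v S' 0 c = (HPi S' w' c).2) ∧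
    (scan (frz n i) w v S' 1 c - (HPi S' w' c).1 ∈ nullSp K (cnt S' c - 1)) ∧
    (c + i + 1 ≤ 2 * n → scan (frz n i) w v S' 0 c - ((HPi S' w' c).1 * (1 + X (cnt S' c - 1)) ^ c + (HPi S' w' c).2)
      ∈ nullSp K (cnt S' c)) := by
  have hsw : ∀ c j x, sw j (w' c x) = w' c (sw j x) := by
    intro c j x
    rw [hw', hw', map_wl, sw_C]
  have hww : ∀ j c b, b ≠ j → b ≠ j + 1 → sw j (w c b) = w c b := by
    intro j c b h1 h2
    rw [hw, map_mul, map_wl, sw_C, sw_X j b h1 h2]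
  induction c with
  | zero =>
    refine ⟨fun _ => ?_, ?_, fun _ => ?_⟩ <;>
      simp [HPi, scan, okRow, cnt_zero, AddSubgroup.zero_mem]
  | succ c ih =>
    set s0 := scan (frz n i) w v S' 0 c with hs0
    set s1 := scan (frz n i) w v S' 1 c with hs1
    set a := cnt S' c with ha
    obtain ⟨ih1, ih2, ih3⟩ := ih
    -- early phase
    have early : c ≤ i → (HPi S' w' (c + 1)).1 = 0 ∧ scan (frz n i) w v S' 1 (c + 1) = 0 ∧
      scan (frz n i) w v S' 0 (c + 1) = (HPi S' w' (c + 1)).2 := by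
      intro hc
      obtain ⟨e1, e2, e3⟩ := ih1 (by omega)
      have hF : frz n i c := Or.inl hc
      by_cases h : c ∈ S'
      · rw [scan_one_mem _ _ _ _ _ h, scan_zero_mem _ _ _ _ _ h, HPi, if_pos h, if_pos hF]
        rw [← hs0, ← hs1, e2, e3, e1]
        dsimp only
        refine ⟨?_, by ring, ?_⟩
        · have : w' c 0 = 0 := by
            rw [hw']
            simp [wl, show c ≤ i + 1 by omega, show i + 1 - c ≠ 0 by omega]
          rw [this]
          ring
        · rw [hv, hw, hw']
          simp only [wl, vwt, show c ≤ i + 1 by omega, hc, if_true]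
          rw [if_neg (by omega), show i + 1 - c = (i - c) + 1 by omega, pow_succ]
          ring
      · rw [scan_one_notMem _ _ _ _ _ h, scan_zero_notMem _ _ _ _ _ h, HPi, if_neg h, if_pos hF]
        have hvt : v c False False = 1 := by rw [hv]; simp [vwt]
        rw [← hs0, ← hs1, e2, e3, hvt]
        exact ⟨e1, by ring, by ring⟩
    by_cases hci : c ≤ i
    · obtain ⟨e1, e2, e3⟩ := early hci
      refine ⟨fun _ => ⟨e1, e2, e3⟩, ?_, fun _ => ?_⟩
      · rw [e1, e2, sub_zero]; exact AddSubgroup.zero_mem _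
      · rw [e1, e3, zero_mul, zero_add, sub_self]; exact AddSubgroup.zero_mem _
    refine ⟨fun h => absurd h (by omega), ?_⟩
    set h := (HPi S' w' c).1 with hh
    set π := (HPi S' w' c).2 with hπ
    have hnull1 : ∀ y, (∀ j, j + 1 < a - 1 → sw j y = y) → (s1 - h) * y ∈ nullSp K (a - 1) :=
      fun y hy => nullSp_mul _ _ _ ih2 hy
    have hza : ∀ j, j + 1 < a - 1 → sw j (X (a - 1) : MvPolynomial ℕ K) = X (a - 1) :=
      fun j hj => sw_X _ _ (by omega) (by omega)
    have hzb : ∀ j, j + 1 < a → sw j (X a : MvPolynomial ℕ K) = X a :=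
      fun j hj => sw_X _ _ (by omega) (by omega)
    by_cases hcl : 2 * n - i ≤ c
    · -- late phase
      refine ⟨?_, fun h => absurd h (by omega)⟩
      have hF : frz n i c := Or.inr hcl
      by_cases hm : c ∈ S'
      · rw [scan_one_mem _ _ _ _ _ hm, HPi, if_pos hm, if_pos hF, cnt_succ, if_pos hm, ← ha, add_tsub_cancel_right]
        have e1 : w' c 0 = 0 := by
          rw [hw']
          simp [wl, show ¬ c ≤ i + 1 by omega, show ¬ c < 2 * n - (i + 1) by omega, show c + (i + 1) - 2 * n ≠ 0 by omega]
        have e2 : v c True True = 1 := by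
          rw [hv]; simp [vwt]; intro hx; omega
        have e3 : w c (a - 1) = (1 + X (a - 1)) * w' c (X (a - 1)) := by
          rw [hw, hw']
          simp only [wl]
          rw [if_neg (by omega), if_neg (by omega), if_neg (by omega), if_neg (by omega),
            show 2 * n - 1 - i = 2 * n - 1 - (i + 1) + 1 by omega, show c + (i + 1) - 2 * n = c + i - 2 * n + 1 by omega]
          ring
        rw [e1, e2]
        dsimp only
        rw [← e3]
        have := nullSp_mono (Nat.sub_le a 1) (hnull1 (w c (a - 1)) (fun j hj => hww _ _ _ (by omega) (by omega)))
        convert this using 1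
        ring
      · rw [scan_one_notMem _ _ _ _ _ hm, HPi, if_neg hm, cnt_succ, if_neg hm, add_zero, ← ha]
        have hvt : v c False False = 1 := by rw [hv]; simp [vwt]
        rw [← hs1, hvt, mul_one]
        exact ih2
    -- middle phase
    have hF : ¬ frz n i c := by unfold frz; omega
    have ih3 := ih3 (by omega)
    have ew : ∀ j, w c j = X j * (1 + X j) ^ c := by
      intro j
      rw [hw]
      simp only [wl]
      rw [if_neg (by omega), if_pos (by omega)]
    by_cases hm : c ∈ S'
    · rw [scan_one_mem _ _ _ _ _ hm, scan_zero_mem _ _ _ _ _ hm, HPi, if_pos hm, if_neg hF, cnt_succ, if_pos hm, ← ha, add_tsub_cancel_right]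
      dsimp only
      rw [← hh, ← hπ]
      rw [← hs0, ← hs1]
      by_cases hc1 : c = i + 1
      · obtain ⟨e1, e2, e3⟩ := ih1 (by omega)
        rw [e1, e2, e3]
        have hvt : v c False True = C t := by rw [hv]; simp [vwt, hc1]
        have hvt1 : v c True True = 1 := by rw [hv]; simp [vwt]; intro hx; omega
        have e4 : ∀ x, w' c x = (1 + x) ^ c * (C t * (1 + x) - x) := by
          intro x
          rw [hw']
          simp only [wl]
          rw [if_pos (by omega), show i + 1 - c = 0 by omega]
          ring
        simp only [hvt, hvt1, e4, ew]
        constructor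
        · convert AddSubgroup.zero_mem _ using 1
          ring
        · intro _
          convert AddSubgroup.zero_mem _ using 1
          ring
      · have hvt : v c False True = 1 := by rw [hv]; simp [vwt, hc1]
        have e5 : w' c 0 = 1 := by
          rw [hw']; simp [wl, show ¬ c ≤ i + 1 by omega]
          intro h1
          simp [show c + (i + 1) - 2 * n = 0 by omega]
        have key : s0 * v c False True + s1 * (v c True True * w c (a - 1)) -
            (h * ((1 + X (a - 1)) * w' c (X (a - 1))) + w' c 0 * π) =
            (s0 - (h * (1 + X (a - 1)) ^ c + π)) + (s1 - h) * (v c True True * w c (a - 1)) := by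
          rw [e5, hvt, ew]
          by_cases hc2 : c = 2 * n - i - 1
          · have hvt1 : v c True True = C t := by rw [hv]; simp [vwt, hc2]
            have e4 : ∀ x, (1 + x) * w' c x = (1 + x) ^ c * (1 + C t * x) := by
              intro x
              rw [hw']
              simp only [wl]
              rw [if_neg (by omega), if_neg (by omega), show c + (i + 1) - 2 * n = 0 by omega,
                show c = 2 * n - 1 - (i + 1) + 1 by omega]
              simp
              ring
            rw [e4, hvt1]
            ring
          · have hvt1 : v c True True = 1 := by rw [hv]; simp [vwt]; intro hx; omega
            have e4 : ∀ x, w' c x = (1 + x) ^ c := by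
              intro x
              rw [hw']
              simp only [wl]
              rw [if_neg (by omega), if_pos (by omega)]
            rw [e4, hvt1]
            ring
        have hvC : ∀ j, sw j (v c True True) = v c True True := by
          intro j; rw [hv]; unfold vwt; split_ifs <;> simp [sw_C]
        constructor
        · rw [key]
          refine AddSubgroup.add_mem _ ih3 (nullSp_mono (Nat.sub_le a 1) (hnull1 _ ?_))
          intro j hj
          rw [map_mul, hvC, hww _ _ _ (by omega) (by omega)]
        · intro hc3
          have hvt1 : v c True True = 1 := by rw [hv]; simp [vwt]; intro hx; omega
          have e4 : ∀ x, w' c x = (1 + x) ^ c := by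
            intro x
            rw [hw']
            simp only [wl]
            rw [if_neg (by omega), if_pos (by omega)]
          have key2 : s0 * (v c True True * w c a) - ((h * ((1 + X (a - 1)) * w' c (X (a - 1))) + w' c 0 * π) * (1 + X a) ^ (c + 1)
              + π * - w' c (X a)) = (s0 - (h * (1 + X (a - 1)) ^ c + π)) * w c a -
              h * ((1 + X (a - 1)) * (1 + X a)) ^ c * ((1 + X (a - 1)) * (1 + X a) - X a) := by
            rw [e5, hvt1, e4, e4, ew, mul_pow]
            ring
          rw [key2]
          refine AddSubgroup.sub_mem _ (nullSp_mono (Nat.le_succ a) (nullSp_mul _ _ _ ih3 ?_)) ?_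
          · intro j hj
            exact hww _ _ _ (by omega) (by omega)
          · by_cases h0 : a = 0
            · have : h = 0 := by rw [hh, HPi_zero _ _ _ (by omega)]
              rw [this, zero_mul, zero_mul]
              exact AddSubgroup.zero_mem _
            · refine AddSubgroup.subset_closure ⟨a - 1, h * ((1 + X (a - 1)) * (1 + X a)) ^ c, by omega, ?_, ?_⟩
              · obtain ⟨b, hb⟩ : ∃ b, a = b + 1 := ⟨a - 1, by omega⟩
                rw [map_mul, (sw_HPi S' w' hsw c).1 (a - 1) (by omega)]
                rw [hb, add_tsub_cancel_right]
                simp only [map_pow, map_mul, map_add, map_one, sw_X_left, sw_X_right]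
                ring
              · rw [show a - 1 + 1 = a by omega]
                ring
    · rw [scan_one_notMem _ _ _ _ _ hm, scan_zero_notMem _ _ _ _ _ hm, HPi, if_neg hm, if_neg hF, cnt_succ, if_neg hm,
        add_zero, ← ha, ← hh, ← hπ]
      have hvt : v c False False = 1 := by rw [hv]; simp [vwt]
      have hvt1 : v c True False = 1 := by rw [hv]; simp [vwt]
      rw [hvt, hvt1]
      rw [← hs0, ← hs1]
      refine ⟨by rw [mul_one]; exact ih2, fun _ => ?_⟩
      have key : s0 * 1 + s1 * (1 * w c (a - 1)) - (h * (1 + X (a - 1)) ^ (c + 1) + π) =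
        (s0 - (h * (1 + X (a - 1)) ^ c + π)) + (s1 - h) * w c (a - 1) := by
        rw [ew]; ring
      rw [key]
      refine AddSubgroup.add_mem _ ih3 (nullSp_mono (Nat.sub_le a 1) (hnull1 _ ?_))
      intro j hj
      exact hww _ _ _ (by omega) (by omega)

end PartB2


section PartB3

section gen
variable {R : Type*} [CommRing R]

/-- pair factor -/
def rm (x y : R) : R := 1 + y + x * y

/-- signed Vandermonde product -/
def vm {m : ℕ} (u : Fin m → R) : R := (-1) ^ (m.choose 2) * vand u

theorem vm_expand {m : ℕ} (u : Fin (m + 1) → R) :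
    vm u = ∑ s : Fin (m + 1), (-1) ^ (s : ℕ) * u s ^ m * vm (u ∘ s.succAbove) := by
  unfold vm
  rw [← det_vand, Matrix.det_succ_column _ (Fin.last m), mul_sum]
  refine sum_congr rfl fun s _ => ?_
  have : (Matrix.vandermonde u).submatrix s.succAbove (Fin.last m).succAbove =
      Matrix.vandermonde (u ∘ s.succAbove) := by
    ext a b
    simp [Matrix.vandermonde_apply]
  rw [this, det_vand, Nat.choose_succ_succ' m 1, Nat.choose_one_right, pow_add, pow_add]
  simp only [Matrix.vandermonde_apply, Fin.val_last]
  have e : ((-1 : R) ^ m) * (-1) ^ m = 1 := by rw [← pow_add, Even.neg_one_pow ⟨_, rfl⟩]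
  linear_combination ((-1) ^ m.choose 2 * (-1) ^ (s : ℕ) * u s ^ m * vand (u ∘ s.succAbove)) * e

theorem pairProd_succAbove' (f : R → R → R) :
    ∀ (m : ℕ) (y : Fin (m + 1) → R) (k : Fin (m + 1)),
      pairProd f y = (∏ q : Fin m, if (q : ℕ) < k then f (y (k.succAbove q)) (y k) else
        f (y k) (y (k.succAbove q))) * pairProd f (y ∘ k.succAbove) := by
  intro m
  induction m with
  | zero => intro y k; simp [pairProd]
  | succ m ih =>
    intro y k
    refine Fin.cases ?_ (fun k => ?_) k
    · rw [pairProd_succ]; simp [Function.comp_def]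
    · rw [pairProd_succ, ih _ k, pairProd_succ f (y ∘ k.succ.succAbove),
        Fin.prod_univ_succ (fun q : Fin (m + 1) => if (q : ℕ) < k.succ then _ else _),
        Fin.prod_univ_succAbove (fun q : Fin (m + 1) => f (y 0) (y q.succ)) k]
      simp only [Function.comp_def, Fin.succ_succAbove_zero, Fin.succ_succAbove_succ, Fin.val_succ,
        Fin.val_zero, add_lt_add_iff_right, Nat.zero_lt_succ, if_true]
      ring

theorem pairProd_eq (f : R → R → R) {m : ℕ} (x : Fin m → R) :
    pairProd f x = ∏ pq ∈ (univ : Finset (Fin m × Fin m)).filter (fun pq => pq.1 < pq.2),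
      f (x pq.1) (x pq.2) := by
  unfold pairProd
  rw [prod_filter, Fintype.prod_prod_type]
  refine prod_congr rfl fun p _ => ?_
  rw [← prod_filter]
  congr 1
  ext q
  simp

theorem pairProd_swap (f : R → R → R) {m : ℕ} (x : Fin m → R) (a b : Fin m) (h : (a : ℕ) + 1 = b) :
    ∃ E, pairProd f x = f (x a) (x b) * E ∧ pairProd f (x ∘ Equiv.swap a b) = f (x b) (x a) * E := by
  set T := (univ : Finset (Fin m × Fin m)).filter (fun pq => pq.1 < pq.2) with hT
  have hab : (a, b) ∈ T := by rw [hT, mem_filter]; exact ⟨mem_univ _, by rw [Fin.lt_def]; dsimp only; omega⟩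
  refine ⟨∏ pq ∈ T.erase (a, b), f (x pq.1) (x pq.2), ?_, ?_⟩
  · rw [pairProd_eq, ← hT, mul_prod_erase T (fun pq => f (x pq.1) (x pq.2)) hab]
  · rw [pairProd_eq, ← hT, ← mul_prod_erase T _ hab]
    congr 1
    · simp
    · refine prod_equiv (Equiv.prodCongr (Equiv.swap a b) (Equiv.swap a b)) ?_ ?_
      · rintro ⟨p, q⟩
        simp only [mem_erase, hT, mem_filter, mem_univ, true_and, Equiv.prodCongr_apply, Prod.map_apply, ne_eq,
          Prod.mk.injEq, Equiv.swap_apply_def, Fin.lt_def]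
        split_ifs <;> simp_all [Fin.ext_iff] <;> omega
      · rintro ⟨p, q⟩ _
        rfl

end gen

variable {K : Type*} [CommRing K]
open MvPolynomial

/-- projection to finitely many variables -/
noncomputable def proj (i : ℕ) : MvPolynomial ℕ K →ₐ[K] MvPolynomial (Fin i) K :=
  aeval (fun j => if h : j < i then X ⟨j, h⟩ else 0)

theorem proj_X (i j : ℕ) (h : j < i) : proj i (X j : MvPolynomial ℕ K) = X ⟨j, h⟩ := by
  simp [proj, h]

/-- the functional -/
noncomputable def Lam (i : ℕ) (F : MvPolynomial ℕ K) : K :=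
  cf (fun _ => i) (proj i F * (pairProd rm X * vm X))

theorem Lam_add (i : ℕ) (F G : MvPolynomial ℕ K) : Lam i (F + G) = Lam i F + Lam i G := by
  unfold Lam; rw [map_add, add_mul, cf_add]

theorem Lam_sub (i : ℕ) (F G : MvPolynomial ℕ K) : Lam i (F - G) = Lam i F - Lam i G := by
  unfold Lam; rw [map_sub, sub_mul, cf_sub]

theorem Lam_zero (i : ℕ) : Lam i (0 : MvPolynomial ℕ K) = 0 := by
  unfold Lam; simp [cf]

theorem Lam_sum {ι : Type*} (i : ℕ) (s : Finset ι) (F : ι → MvPolynomial ℕ K) :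
    Lam i (∑ x ∈ s, F x) = ∑ x ∈ s, Lam i (F x) := by
  unfold Lam; rw [map_sum, sum_mul, cf_sum]

theorem Lam_C_mul (i : ℕ) (t : K) (F : MvPolynomial ℕ K) : Lam i (C t * F) = t * Lam i F := by
  unfold Lam cf
  have : proj i (C t : MvPolynomial ℕ K) = C t := by simp [proj]
  rw [map_mul, this, mul_assoc, coeff_C_mul]

theorem Lam_null [IsDomain K] [CharZero K] (i : ℕ) (F : MvPolynomial ℕ K) (h : F ∈ nullSp K i) :
    Lam i F = 0 := by
  unfold nullSp at h
  induction h using AddSubgroup.closure_induction with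
  | zero => exact Lam_zero i
  | add x y _ _ h1 h2 => rw [Lam_add, h1, h2, add_zero]
  | neg x _ h => rw [← zero_sub, Lam_sub, h, Lam_zero, sub_zero]
  | mem x hx =>
    obtain ⟨j, Q, h1, h2, rfl⟩ := hx
    set a : Fin i := ⟨j, by omega⟩ with ha
    set b : Fin i := ⟨j + 1, h1⟩ with hb
    have hab : (a : ℕ) + 1 = b := rfl
    have hne : a ≠ b := by simp [ha, hb]
    obtain ⟨E, hE1, hE2⟩ := pairProd_swap rm (X : Fin i → MvPolynomial (Fin i) K) a b hab
    set σ := Equiv.swap a b with hσ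
    have hQ : renHom σ (proj i Q) = proj i Q := by
      conv_rhs => rw [← h2]
      have : ((renHom σ).comp (proj i : MvPolynomial ℕ K →ₐ[K] _).toRingHom) =
        ((proj i : MvPolynomial ℕ K →ₐ[K] _).toRingHom.comp (sw j)) := by
        refine MvPolynomial.ringHom_ext (fun r => by simp [proj, sw, renHom]) (fun k => ?_)
        simp only [proj, sw, renHom, RingHom.comp_apply, AlgHom.toRingHom_eq_coe, RingHom.coe_coe, rename_X, aeval_X]
        by_cases hk : k < i
        · rcases eq_or_ne k j with rfl | h3
          · simp [hk, h1, hσ, ha, hb]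
          · rcases eq_or_ne k (j + 1) with rfl | h4
            · have h5 : j < i := by omega
              simp [hk, hσ, ha, hb, h5]
            · rw [Equiv.swap_apply_of_ne_of_ne h3 h4, dif_pos hk, rename_X, hσ,
                Equiv.swap_apply_of_ne_of_ne]
              · simpa [ha] using h3
              · simpa [hb] using h4
        · rw [Equiv.swap_apply_of_ne_of_ne (by omega) (by omega), dif_neg hk, map_zero]
      exact RingHom.congr_fun this Q
    have hren : renHom σ (proj i ((1 + X j + X j * X (j + 1)) * Q) * (pairProd rm X * vm X)) =
        - (proj i ((1 + X j + X j * X (j + 1)) * Q) * (pairProd rm X * vm X)) := by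
      rw [map_mul, map_mul, map_mul, map_mul, hQ]
      have r1 : renHom σ (pairProd rm X : MvPolynomial (Fin i) K) = rm (X b) (X a) * E := by
        rw [map_pairProd (renHom σ) rm rm (by simp [rm]), rename_X_comp, hE2]
      have r2 : renHom σ (vm X : MvPolynomial (Fin i) K) = - vm X := by
        unfold vm
        rw [map_mul, map_vand, rename_X_comp, vand_perm, hσ, Equiv.Perm.sign_swap hne]
        simp
      rw [r1, r2, hE1]
      have r3 : proj i (1 + X j + X j * X (j + 1) : MvPolynomial ℕ K) = 1 + X a + X a * X b := by
        simp only [map_add, map_mul, map_one]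
        rw [proj_X _ _ (by omega), proj_X _ _ h1]
      rw [r3]
      simp only [map_add, map_mul, map_one, renHom, AlgHom.toRingHom_eq_coe, RingHom.coe_coe, rename_X, rm]
      rw [hσ, Equiv.swap_apply_left, Equiv.swap_apply_right]
      ring
    have h3 : Lam i ((1 + X j + X j * X (j + 1)) * Q) = - Lam i ((1 + X j + X j * X (j + 1)) * Q) := by
      unfold Lam
      conv_lhs => rw [← cf_rename_const i σ]
      change cf _ (renHom σ _) = _
      rw [hren]
      simp [cf]
    have h4 : (2 : K) * Lam i ((1 + X j + X j * X (j + 1)) * Q) = 0 := by linear_combination h3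
    exact (mul_eq_zero.1 h4).resolve_left two_ne_zero

/-- set a variable to zero -/
noncomputable def phiZ {i : ℕ} (s : Fin (i + 1)) : MvPolynomial (Fin (i + 1)) K →ₐ[K] MvPolynomial (Fin i) K :=
  aeval (s.insertNth (α := fun _ => MvPolynomial (Fin i) K) 0 X)

theorem cf_insertNth {i : ℕ} (s : Fin (i + 1)) (J : Fin i → ℕ) (P : MvPolynomial (Fin (i + 1)) K) :
    cf (s.insertNth (α := fun _ => ℕ) 0 J) P = cf J (phiZ s P) := by
  induction P using MvPolynomial.induction_on' with
  | add p q h1 h2 => rw [cf_add, map_add, cf_add, h1, h2]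
  | monomial u a =>
    unfold phiZ
    rw [aeval_monomial, Finsupp.prod_fintype _ _ (by simp), Fin.prod_univ_succAbove _ s]
    simp only [Fin.insertNth_apply_same, Fin.insertNth_apply_succAbove]
    unfold cf
    rw [coeff_monomial]
    have e : (∏ p, MvPolynomial.X p ^ u (s.succAbove p) : MvPolynomial (Fin i) K) =
      MvPolynomial.monomial (Finsupp.equivFunOnFinite.symm (fun p => u (s.succAbove p))) 1 := by
      rw [MvPolynomial.monomial_eq, Finsupp.prod_fintype _ _ (by simp)]
      simp
    rw [e, algebraMap_eq, coeff_C_mul]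
    by_cases h0 : u s = 0
    · rw [h0, pow_zero, one_mul, coeff_monomial, mul_ite, mul_one, mul_zero]
      congr 1
      rw [eq_iff_iff]
      constructor
      · intro h
        rw [h]
        ext p
        simp
      · intro h
        ext p
        rcases Fin.eq_self_or_eq_succAbove s p with rfl | ⟨q, rfl⟩
        · simp [h0]
        · have := DFunLike.congr_fun h q
          simpa using this
    · rw [zero_pow h0, zero_mul, coeff_zero, mul_zero, if_neg]
      intro h
      apply h0
      rw [h]
      simp

theorem cf_X_pow_mul {i : ℕ} (s : Fin (i + 1)) (P : MvPolynomial (Fin (i + 1)) K) :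
    cf (fun _ => i) (X s ^ i * P) = cf (fun _ => i) (phiZ s P) := by
  rw [← cf_insertNth]
  have := cf_mul_prod_X_pow (fun _ => i) (fun p => if p = s then i else 0) P (by
    intro p; split_ifs <;> omega)
  simp only [pow_ite, pow_zero, prod_ite_eq', mem_univ, if_true] at this
  rw [mul_comm, this]
  congr 1
  funext p
  rcases Fin.eq_self_or_eq_succAbove s p with rfl | ⟨q, rfl⟩
  · simp
  · simp

end PartB3


section PartB4

/-- the `p`-th element -/
noncomputable def kth (S : Finset ℕ) (p : ℕ) : ℕ := Nat.nth (· ∈ S) p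

theorem kth_cnt (S : Finset ℕ) (c : ℕ) (h : c ∈ S) : kth S (cnt S c) = c :=
  Nat.nth_count (p := (· ∈ S)) h

theorem prod_cnt {R : Type*} [CommRing R] (S : Finset ℕ) (g : ℕ → ℕ → R) (n : ℕ) :
    ∏ c ∈ range n, (if c ∈ S then g c (cnt S c) else 1) = ∏ p ∈ range (cnt S n), g (kth S p) p := by
  induction n with
  | zero => simp [cnt_zero]
  | succ n ih =>
    rw [prod_range_succ, ih, cnt_succ]
    by_cases h : n ∈ S
    · rw [if_pos h, if_pos h, prod_range_succ, kth_cnt S n h]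
    · rw [if_neg h, if_neg h, mul_one, add_zero]

variable {K : Type*} [CommRing K]
open MvPolynomial

theorem HPi_formula (S' : Finset ℕ) (w' : ℕ → MvPolynomial ℕ K → MvPolynomial ℕ K) (c : ℕ) :
    HPi S' w' c = (∑ s ∈ range (cnt S' c), (∏ p ∈ range s, (- w' (kth S' p) (X p))) * w' (kth S' s) 0 *
      ∏ p ∈ Ico s (cnt S' c - 1), ((1 + X p) * w' (kth S' (p + 1)) (X p)),
      ∏ p ∈ range (cnt S' c), (- w' (kth S' p) (X p))) := by
  induction c with
  | zero => simp [HPi, cnt_zero]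
  | succ c ih =>
    by_cases h : c ∈ S'
    · rw [HPi, if_pos h, ih, cnt_succ, if_pos h]
      ext1
      · dsimp only
        rw [sum_range_succ, add_tsub_cancel_right, Ico_self, prod_empty, mul_one, kth_cnt S' c h, sum_mul]
        congr 1
        · refine sum_congr rfl fun s hs => ?_
          rw [mem_range] at hs
          obtain ⟨b, hb⟩ : ∃ b, cnt S' c = b + 1 := ⟨cnt S' c - 1, by omega⟩
          rw [hb, add_tsub_cancel_right, prod_Ico_succ_top (by omega), ← hb, kth_cnt S' c h]
          ring
        · ring
      · dsimp only
        rw [prod_range_succ, kth_cnt S' c h]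
    · rw [HPi, if_neg h, ih, cnt_succ, if_neg h, add_zero]

theorem pairProd_insertNth {R : Type*} [CommRing R] {i : ℕ} (s : Fin (i + 1)) (x : Fin i → R) :
    pairProd rm (s.insertNth (α := fun _ => R) 0 x) =
      (∏ q : Fin i, if (q : ℕ) < s then 1 else (1 + x q)) * pairProd rm x := by
  rw [pairProd_succAbove' rm i _ s]
  congr 1
  · refine prod_congr rfl fun q _ => ?_
    simp [rm]
  · congr 1
    funext q
    simp

/-- the transition identity -/
theorem Lam_step (n i : ℕ) (t : K) (S' : Finset ℕ) (N : ℕ) (hS : cnt S' N = i + 1) :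
    Lam (i + 1) (∏ c ∈ range N, (if c ∈ S' then X (cnt S' c) * wl n (i + 1) c (C t) (X (cnt S' c)) else 1)) =
    Lam i (HPi S' (fun c x => wl n (i + 1) c (C t) x) N).1 := by
  rw [prod_cnt S' (fun c p => X p * wl n (i + 1) c (C t) (X p)), HPi_formula, hS]
  dsimp only
  rw [Lam_sum]
  have hpC : ∀ j, proj j (C t : MvPolynomial ℕ K) = C t := by intro j; simp [proj]
  have hwl : ∀ j c x, proj j (wl n (i + 1) c (C t) x : MvPolynomial ℕ K) = wl n (i + 1) c (C t) (proj j x) := by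
    intro j c x
    have := map_wl (proj j : MvPolynomial ℕ K →ₐ[K] _).toRingHom n (i + 1) c (C t) x
    simp only [AlgHom.toRingHom_eq_coe, RingHom.coe_coe, hpC] at this
    exact this
  have hphi : ∀ (s : Fin (i + 1)) c x, phiZ s (wl n (i + 1) c (C t) x : MvPolynomial (Fin (i + 1)) K) =
      wl n (i + 1) c (C t) (phiZ s x) := by
    intro s c x
    have := map_wl (phiZ s : MvPolynomial (Fin (i + 1)) K →ₐ[K] _).toRingHom n (i + 1) c (C t) x
    have e : phiZ s (C t : MvPolynomial (Fin (i + 1)) K) = C t := by simp [phiZ]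
    simp only [AlgHom.toRingHom_eq_coe, RingHom.coe_coe, e] at this
    exact this
  -- left side
  have e1 : proj (i + 1) (∏ p ∈ range (i + 1), (X p * wl n (i + 1) (kth S' p) (C t) (X p)) : MvPolynomial ℕ K) =
      (∏ p : Fin (i + 1), wl n (i + 1) (kth S' p) (C t) (X p)) * ∏ p : Fin (i + 1), X p ^ 1 := by
    rw [map_prod, ← Fin.prod_univ_eq_prod_range (fun p => proj (i + 1) (X p * wl n (i + 1) (kth S' p) (C t) (X p) : MvPolynomial ℕ K)),
      ← prod_mul_distrib]
    refine prod_congr rfl fun p _ => ?_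
    rw [map_mul, hwl, proj_X _ _ p.2, pow_one, mul_comm]
  unfold Lam
  rw [e1, mul_right_comm, cf_mul_prod_X_pow _ _ _ (by intro p; omega)]
  simp only [add_tsub_cancel_right]
  rw [vm_expand, mul_sum, mul_sum, cf_sum, ← Fin.sum_univ_eq_sum_range (fun s => cf (fun _ => i) (proj i
    ((∏ p ∈ range s, (- wl n (i + 1) (kth S' p) (C t) (X p))) * wl n (i + 1) (kth S' s) (C t) 0 *
      ∏ p ∈ Ico s i, ((1 + X p) * wl n (i + 1) (kth S' (p + 1)) (C t) (X p))) * (pairProd rm X * vm X)))]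
  refine sum_congr rfl fun s _ => ?_
  have e2 : (∏ p : Fin (i + 1), wl n (i + 1) (kth S' p) (C t) (X p : MvPolynomial (Fin (i + 1)) K)) *
      (pairProd rm X * ((-1) ^ (s : ℕ) * X s ^ i * vm (X ∘ s.succAbove))) =
      X s ^ i * ((∏ p : Fin (i + 1), wl n (i + 1) (kth S' p) (C t) (X p)) * pairProd rm X * ((-1) ^ (s : ℕ) * vm (X ∘ s.succAbove))) := by
    ring
  rw [e2, cf_X_pow_mul]
  congr 1
  have hphX : ∀ p, phiZ s (X p : MvPolynomial (Fin (i + 1)) K) = s.insertNth (α := fun _ => MvPolynomial (Fin i) K) 0 X p := by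
    intro p; simp [phiZ]
  have e3 : phiZ s (pairProd rm X : MvPolynomial (Fin (i + 1)) K) =
      (∏ q : Fin i, if (q : ℕ) < s then 1 else (1 + X q)) * pairProd rm X := by
    rw [← pairProd_insertNth]
    have := map_pairProd (phiZ s : MvPolynomial (Fin (i + 1)) K →ₐ[K] _).toRingHom rm rm (by simp [rm]) X
    simp only [AlgHom.toRingHom_eq_coe, RingHom.coe_coe] at this
    rw [this]
    congr 1
    funext p
    exact hphX p
  have e4 : phiZ s (vm (X ∘ s.succAbove) : MvPolynomial (Fin (i + 1)) K) = vm X := by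
    unfold vm
    have := map_vand (phiZ s : MvPolynomial (Fin (i + 1)) K →ₐ[K] _).toRingHom (X ∘ s.succAbove)
    simp only [AlgHom.toRingHom_eq_coe, RingHom.coe_coe] at this
    rw [map_mul, this]
    congr 1
    · simp
    · congr 1
      funext p
      simp [hphX]
  have e5 : phiZ s (∏ p : Fin (i + 1), wl n (i + 1) (kth S' p) (C t) (X p : MvPolynomial (Fin (i + 1)) K)) =
      wl n (i + 1) (kth S' s) (C t) 0 * ∏ q : Fin i, (if (q : ℕ) < s then wl n (i + 1) (kth S' q) (C t) (X q) else
        wl n (i + 1) (kth S' (q + 1)) (C t) (X q)) := by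
    rw [map_prod, Fin.prod_univ_succAbove _ s]
    simp only [hphi, hphX, Fin.insertNth_apply_same, Fin.insertNth_apply_succAbove]
    congr 1
    refine prod_congr rfl fun q _ => ?_
    by_cases h : (q : ℕ) < s
    · rw [if_pos h, Fin.succAbove_of_castSucc_lt _ _ (by rw [Fin.lt_def]; exact h)]
      rfl
    · rw [if_neg h, Fin.succAbove_of_le_castSucc _ _ (by rw [Fin.le_def]; exact not_lt.1 h)]
      rfl
  have hs : (s : ℕ) ≤ i := by omega
  have e6 : proj i ((∏ p ∈ range s, (- wl n (i + 1) (kth S' p) (C t) (X p : MvPolynomial ℕ K))) * wl n (i + 1) (kth S' s) (C t) 0 *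
      ∏ p ∈ Ico (s : ℕ) i, ((1 + X p) * wl n (i + 1) (kth S' (p + 1)) (C t) (X p))) =
      (-1) ^ (s : ℕ) * wl n (i + 1) (kth S' s) (C t) 0 * ∏ q : Fin i, (if (q : ℕ) < s then wl n (i + 1) (kth S' q) (C t) (X q) else
        (1 + X q) * wl n (i + 1) (kth S' (q + 1)) (C t) (X q)) := by
    have f1 : ∏ q : Fin i, (if (q : ℕ) < s then wl n (i + 1) (kth S' q) (C t) (X q) else
        (1 + X q) * wl n (i + 1) (kth S' (q + 1)) (C t) (X q : MvPolynomial (Fin i) K)) =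
        ∏ q ∈ range i, proj i (if (q : ℕ) < s then wl n (i + 1) (kth S' q) (C t) (X q) else
        (1 + X q) * wl n (i + 1) (kth S' (q + 1)) (C t) (X q)) := by
      rw [← Fin.prod_univ_eq_prod_range (fun q => proj i (if (q : ℕ) < s then wl n (i + 1) (kth S' q) (C t) (X q) else
        (1 + X q) * wl n (i + 1) (kth S' (q + 1)) (C t) (X q : MvPolynomial ℕ K)))]
      refine prod_congr rfl fun q _ => ?_
      split_ifs
      · rw [hwl, proj_X _ _ q.2]
      · rw [map_mul, hwl, map_add, map_one, proj_X _ _ q.2]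
    rw [f1, ← prod_range_mul_prod_Ico _ hs, prod_neg, card_range]
    simp only [map_mul, map_prod, map_pow, map_neg, map_one, hwl, map_zero, map_add]
    rw [mul_comm ((-1) ^ (s : ℕ)), mul_comm ((-1) ^ (s : ℕ))]
    have f2 : ∏ x ∈ range (s : ℕ), proj i (if x < s then wl n (i + 1) (kth S' x) (C t) (X x) else
        (1 + X x) * wl n (i + 1) (kth S' (x + 1)) (C t) (X x : MvPolynomial ℕ K)) =
        ∏ x ∈ range (s : ℕ), wl n (i + 1) (kth S' x) (C t) (proj i (X x)) := by
      refine prod_congr rfl fun x hx => ?_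
      rw [if_pos (mem_range.1 hx), hwl]
    have f3 : ∏ x ∈ Ico (s : ℕ) i, proj i (if x < s then wl n (i + 1) (kth S' x) (C t) (X x) else
        (1 + X x) * wl n (i + 1) (kth S' (x + 1)) (C t) (X x : MvPolynomial ℕ K)) =
        ∏ x ∈ Ico (s : ℕ) i, (1 + proj i (X x)) * wl n (i + 1) (kth S' (x + 1)) (C t) (proj i (X x)) := by
      refine prod_congr rfl fun x hx => ?_
      rw [if_neg (not_lt.2 (mem_Ico.1 hx).1), map_mul, hwl, map_add, map_one]
    rw [f2, f3]
    ring
  rw [e6, map_mul, map_mul, map_mul, e3, e4, e5]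
  have e7 : (∏ q : Fin i, if (q : ℕ) < s then wl n (i + 1) (kth S' q) (C t) (X q) else
        (1 + X q) * wl n (i + 1) (kth S' (q + 1)) (C t) (X q : MvPolynomial (Fin i) K)) =
      (∏ q : Fin i, (if (q : ℕ) < s then wl n (i + 1) (kth S' q) (C t) (X q) else
        wl n (i + 1) (kth S' (q + 1)) (C t) (X q))) * ∏ q : Fin i, if (q : ℕ) < s then 1 else (1 + X q) := by
    rw [← prod_mul_distrib]
    refine prod_congr rfl fun q _ => ?_
    split_ifs <;> ring
  rw [e7]
  simp only [map_pow, map_neg, map_one]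
  ring

/-- state weights -/
noncomputable def Zst (n : ℕ) (t : K) (i : ℕ) (S : Finset ℕ) : K :=
  if S.card = i then
    Lam i (∏ c ∈ range (2 * n), (if c ∈ S then X (cnt S c) * wl n i c (C t) (X (cnt S c)) else 1)) else 0

/-- admissible transitions -/
def Tst (n i : ℕ) (S S' : Finset ℕ) : Prop :=
  okRow (frz n i) S' (2 * n) S ∧ cnt S' (2 * n) = cnt S (2 * n) + 1

/-- exponent -/
def est (n i : ℕ) (S S' : Finset ℕ) : ℕ :=
  (if i + 1 ∈ S' ∧ i + 1 ∉ S then 1 else 0) + (if 2 * n - i - 1 ∈ S ∧ 2 * n - i - 1 ∈ S' then 1 else 0)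

theorem prod_vwt {R : Type*} [CommRing R] (n i : ℕ) (hi : i + 2 ≤ n) (t : R) (S S' : Finset ℕ) :
    ∏ c ∈ range (2 * n), vwt n i t c (c ∈ S) (c ∈ S') = t ^ est n i S S' := by
  have h1 : ∀ c ∈ range (2 * n), vwt n i t c (c ∈ S) (c ∈ S') =
    (if c = i + 1 then (if i + 1 ∈ S' ∧ i + 1 ∉ S then t else 1) else 1) *
    (if c = 2 * n - i - 1 then (if 2 * n - i - 1 ∈ S ∧ 2 * n - i - 1 ∈ S' then t else 1) else 1) := by
    intro c _
    unfold vwt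
    by_cases hc1 : c = i + 1
    · have hc2 : c ≠ 2 * n - i - 1 := by omega
      subst hc1
      simp [hc2]
    · by_cases hc2 : c = 2 * n - i - 1
      · subst hc2
        simp [hc1]
      · simp [hc1, hc2]
  rw [prod_congr rfl h1, prod_mul_distrib, prod_ite_eq', prod_ite_eq', if_pos (by rw [mem_range]; omega : i + 1 ∈ range (2 * n)),
    if_pos (by rw [mem_range]; omega : 2 * n - i - 1 ∈ range (2 * n))]
  unfold est
  split_ifs <;> ring

open Classical in
theorem Zst_step [IsDomain K] [CharZero K] (n : ℕ) (t : K) (i : ℕ) (hi : i + 2 ≤ n) (S' : Finset ℕ)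
    (hS' : S' ∈ (range (2 * n)).powerset) :
    Zst n t (i + 1) S' = ∑ S ∈ (range (2 * n)).powerset, if Tst n i S S' then t ^ est n i S S' * Zst n t i S else 0 := by
  rw [mem_powerset] at hS'
  have hc' := cnt_eq_card S' _ hS'
  by_cases hcard : S'.card = i + 1
  · unfold Zst
    rw [if_pos hcard, Lam_step n i t S' (2 * n) (by omega)]
    have inv := (scan_inv n i t S' hi (fun c j => X j * wl n i c (C t) (X j)) (fun _ _ => rfl) (vwt n i (C t)) rfl
      (fun c x => wl n (i + 1) c (C t) x) (fun _ _ => rfl) (2 * n)).2.1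
    rw [hc', hcard, add_tsub_cancel_right] at inv
    have h0 := Lam_null _ _ inv
    rw [Lam_sub, sub_eq_zero] at h0
    rw [← h0]
    unfold scan
    rw [Lam_sum]
    refine sum_congr rfl fun S hS => ?_
    rw [mem_powerset] at hS
    by_cases hT : Tst n i S S'
    · have hT2 := hT
      unfold Tst at hT2
      rw [if_pos hT, if_pos hT2, prod_mul_distrib, prod_vwt n i hi, ← C_pow, Lam_C_mul, if_pos]
      have h1 := hT.2
      rw [cnt_eq_card S _ hS] at h1
      omega
    · have hT2 := hT
      unfold Tst at hT2
      rw [if_neg hT2, Lam_zero, if_neg hT]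
  · unfold Zst
    rw [if_neg hcard, eq_comm]
    refine sum_eq_zero fun S hS => ?_
    rw [mem_powerset] at hS
    by_cases hT : Tst n i S S'
    · rw [if_pos hT, if_neg, mul_zero]
      have h1 := hT.2
      rw [cnt_eq_card S _ hS] at h1
      omega
    · rw [if_neg hT]

theorem Zst_zero (n : ℕ) (t : K) (S : Finset ℕ) : Zst n t 0 S = if S = ∅ then 1 else 0 := by
  unfold Zst
  by_cases h : S = ∅
  · rw [if_pos h, if_pos (by rw [h, card_empty]), h]
    simp [Lam, proj, cf, vm, vand, pairProd]
    rw [show (Finsupp.equivFunOnFinite.symm fun _ => 0 : Fin 0 →₀ ℕ) = 0 from Subsingleton.elim _ _, coeff_zero_one]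
  · rw [if_neg h, if_neg (by rwa [card_eq_zero])]

end PartB4


section PartB5

/-- ordered pairs -/
def pairs (m : ℕ) : Finset (Fin m × Fin m) := univ.filter (fun pq => pq.1 < pq.2)

theorem pairs_filter {m : ℕ} (s : Fin m) :
    (pairs m).filter (fun pq => pq.1 = s ∨ pq.2 = s) =
      (univ.erase s).image (fun q => if q < s then (q, s) else (s, q)) := by
  ext ⟨a, b⟩
  simp only [pairs, mem_filter, mem_univ, true_and, mem_image, mem_erase, and_true]
  constructor
  · rintro ⟨h1, rfl | rfl⟩
    · exact ⟨b, h1.ne', by rw [if_neg (not_lt.2 h1.le)]⟩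
    · exact ⟨a, h1.ne, by rw [if_pos h1]⟩
  · rintro ⟨q, h1, h2⟩
    split_ifs at h2 with h
    · obtain ⟨rfl, rfl⟩ := Prod.mk.inj h2
      exact ⟨h, Or.inr rfl⟩
    · obtain ⟨rfl, rfl⟩ := Prod.mk.inj h2
      exact ⟨lt_of_le_of_ne (not_lt.1 h) (Ne.symm h1), Or.inl rfl⟩

theorem pairs_inj {m : ℕ} (s : Fin m) : Set.InjOn (fun q : Fin m => if q < s then (q, s) else (s, q))
    ((univ.erase s : Finset (Fin m)) : Set (Fin m)) := by
  intro a ha b hb h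
  simp only [coe_erase, coe_univ, Set.mem_sdiff, Set.mem_univ, Set.mem_singleton_iff, true_and] at ha hb
  dsimp only at h
  split_ifs at h <;> simp_all

variable {R : Type*} [CommRing R]

theorem vand_mul_lin {m : ℕ} (y : Fin m → R) (hy : ∀ p, y p ^ m = 0) (a b : R) :
    (∏ q, (a + b * y q)) * vand y = a ^ m * vand y := by
  rw [← det_vand, ← Matrix.det_diagonal]
  set B : Matrix (Fin m) (Fin m) R := Matrix.of fun k j => if k = j then a else if (k : ℕ) = j + 1 then b else 0 with hB
  have h1 : Matrix.diagonal (fun q => a + b * y q) * Matrix.vandermonde y = Matrix.vandermonde y * B := by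
    ext p j
    rw [Matrix.diagonal_mul, Matrix.mul_apply]
    simp only [Matrix.vandermonde_apply, hB, Matrix.of_apply]
    have h2 : ∀ k : Fin m, y p ^ (k : ℕ) * (if k = j then a else if (k : ℕ) = j + 1 then b else 0) =
        (if k = j then y p ^ (k : ℕ) * a else 0) + (if (k : ℕ) = j + 1 then y p ^ (k : ℕ) * b else 0) := by
      intro k
      by_cases h : k = j
      · subst h; simp
      · simp [h]
    rw [sum_congr rfl (fun k _ => h2 k), sum_add_distrib, sum_ite_eq' univ j, if_pos (mem_univ _)]
    by_cases hj : (j : ℕ) + 1 < m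
    · rw [sum_eq_single (⟨j + 1, hj⟩ : Fin m)]
      · simp only [if_true]; ring
      · intro k _ hk
        rw [if_neg]
        intro h
        exact hk (Fin.ext h)
      · simp
    · rw [sum_eq_zero]
      · have : y p * y p ^ (j : ℕ) = 0 := by
          rw [← pow_succ', show (j : ℕ) + 1 = m by omega, hy]
        linear_combination b * this
      · intro k _
        rw [if_neg (by omega)]
  have hBl : B.det = a ^ m := by
    rw [Matrix.det_of_lowerTriangular B]
    · simp [hB]
    · intro i j hij
      have hij : i < j := hij
      simp only [hB, Matrix.of_apply]
      rw [if_neg hij.ne, if_neg]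
      rw [Fin.lt_def] at hij
      omega
  rw [← Matrix.det_mul, h1, Matrix.det_mul, hBl, mul_comm]

/-- rotated pair factor -/
def rotf {m : ℕ} (l : ℕ) (y : Fin m → R) (pq : Fin m × Fin m) : R :=
  if (pq.1 : ℕ) < l ∧ l ≤ (pq.2 : ℕ) then 1 + y pq.1 + y pq.1 * y pq.2 else 1 + y pq.2 + y pq.1 * y pq.2

/-- rotated product -/
def Rrot {m : ℕ} (l : ℕ) (y : Fin m → R) : R := ∏ pq ∈ pairs m, rotf l y pq

theorem Rrot_zero {m : ℕ} (y : Fin m → R) : Rrot 0 y = pairProd rm y := by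
  rw [pairProd_eq]
  refine prod_congr rfl fun pq _ => ?_
  simp [rotf, rm]

theorem Rrot_step {m : ℕ} (y : Fin m → R) (hy : ∀ p, y p ^ m = 0) (s : Fin m) :
    (1 + y s) ^ m * (Rrot s y * vand y) = Rrot (s + 1) y * vand y := by
  have split : ∀ l, Rrot l y = (∏ pq ∈ (pairs m).filter (fun pq => pq.1 = s ∨ pq.2 = s), rotf l y pq) *
      ∏ pq ∈ (pairs m).filter (fun pq => ¬ (pq.1 = s ∨ pq.2 = s)), rotf l y pq :=
    fun l => (prod_filter_mul_prod_filter_not _ _ _).symm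
  have rest : ∏ pq ∈ (pairs m).filter (fun pq => ¬ (pq.1 = s ∨ pq.2 = s)), rotf (s : ℕ) y pq =
      ∏ pq ∈ (pairs m).filter (fun pq => ¬ (pq.1 = s ∨ pq.2 = s)), rotf (s + 1 : ℕ) y pq := by
    refine prod_congr rfl fun pq hpq => ?_
    simp only [mem_filter, Fin.ext_iff] at hpq
    unfold rotf
    have : ((pq.1 : ℕ) < s ∧ (s : ℕ) ≤ pq.2) ↔ ((pq.1 : ℕ) < s + 1 ∧ (s : ℕ) + 1 ≤ pq.2) := by omega
    simp only [this]
  have main1 : ∏ pq ∈ (pairs m).filter (fun pq => pq.1 = s ∨ pq.2 = s), rotf (s : ℕ) y pq =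
      ∏ q ∈ univ.erase s, (1 + (1 + y s) * y q) := by
    rw [pairs_filter, prod_image (pairs_inj s)]
    refine prod_congr rfl fun q hq => ?_
    have hq := (mem_erase.1 hq).1
    split_ifs with h
    · rw [Fin.lt_def] at h
      simp only [rotf, h, le_refl, and_self, if_true]; ring
    · simp only [rotf]
      rw [if_neg (by omega)]; ring
  have main2 : ∏ pq ∈ (pairs m).filter (fun pq => pq.1 = s ∨ pq.2 = s), rotf (s + 1 : ℕ) y pq =
      ∏ q ∈ univ.erase s, ((1 + y s) + y s * y q) := by
    rw [pairs_filter, prod_image (pairs_inj s)]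
    refine prod_congr rfl fun q hq => ?_
    have hq : q ≠ s := (mem_erase.1 hq).1
    split_ifs with h
    · rw [Fin.lt_def] at h
      simp only [rotf]
      rw [if_neg (by omega)]; ring
    · have : (s : ℕ) < q := by
        rw [← Fin.lt_def]; exact lt_of_le_of_ne (not_lt.1 h) (Ne.symm hq)
      simp only [rotf]
      rw [if_pos (by omega)]
  rw [split, split, rest, main1, main2]
  have l1 := vand_mul_lin y hy 1 (1 + y s)
  have l2 := vand_mul_lin y hy (1 + y s) (y s)
  rw [← mul_prod_erase univ _ (mem_univ s)] at l1 l2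
  have hu : IsUnit (1 + (y s + y s ^ 2)) := by
    refine IsNilpotent.isUnit_one_add ⟨m, ?_⟩
    rw [show y s + y s ^ 2 = y s * (1 + y s) by ring, mul_pow, hy, zero_mul]
  refine hu.mul_left_cancel ?_
  rw [one_pow, one_mul] at l1
  set Q := ∏ pq ∈ (pairs m).filter (fun pq => ¬ (pq.1 = s ∨ pq.2 = s)), rotf (s + 1 : ℕ) y pq
  linear_combination (1 + y s) ^ m * Q * l1 - Q * l2

theorem Rrot_all {m : ℕ} (y : Fin m → R) (hy : ∀ p, y p ^ m = 0) (l : ℕ) (hl : l ≤ m) :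
    (∏ p : Fin m, if (p : ℕ) < l then (1 + y p) ^ m else 1) * (Rrot 0 y * vand y) = Rrot l y * vand y := by
  induction l with
  | zero => simp
  | succ l ih =>
    have h : (∏ p : Fin m, if (p : ℕ) < l + 1 then (1 + y p) ^ m else 1) =
        (∏ p : Fin m, if (p : ℕ) < l then (1 + y p) ^ m else 1) * (1 + y ⟨l, hl⟩) ^ m := by
      have h1 : (1 + y ⟨l, hl⟩) ^ m = ∏ p : Fin m, if p = ⟨l, hl⟩ then (1 + y p) ^ m else 1 := by
        rw [prod_ite_eq' univ (⟨l, hl⟩ : Fin m), if_pos (mem_univ _)]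
      rw [h1, ← prod_mul_distrib]
      refine prod_congr rfl fun p _ => ?_
      by_cases h2 : p = ⟨l, hl⟩
      · subst h2; simp
      · have : (p : ℕ) ≠ l := fun h => h2 (Fin.ext h)
        have h3 : (p : ℕ) < l + 1 ↔ (p : ℕ) < l := by omega
        simp only [h2, h3, if_false, mul_one]
    rw [h, mul_right_comm, ih (by omega), mul_comm]
    exact Rrot_step y hy ⟨l, hl⟩

/-- truncated negative binomial series -/
def bser (M E : ℕ) (y : R) : R := ∑ j ∈ range M, (-1) ^ j * ((E + j).choose j : R) * y ^ j

theorem bser_succ (M E : ℕ) (y : R) : (1 + y) * bser M (E + 1) y = bser M E y -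
    (-1) ^ M * (((E + 1 + M).choose M : R) - ((E + M).choose M : R)) * y ^ M := by
  unfold bser
  induction M with
  | zero => simp
  | succ M ih =>
    rw [sum_range_succ, mul_add, ih, sum_range_succ]
    have h : ((E + 1 + (M + 1)).choose (M + 1) : R) = ((E + 1 + M).choose M : R) + ((E + (M + 1)).choose (M + 1) : R) := by
      rw [show E + 1 + (M + 1) = (E + 1 + M) + 1 by ring, Nat.choose_succ_succ', show E + 1 + M = E + (M + 1) by ring]
      push_cast
      rfl
    rw [h]
    ring

theorem bser_mul (M E : ℕ) (y : R) (hy : y ^ M = 0) : (1 + y) ^ (E + 1) * bser M E y = 1 := by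
  induction E with
  | zero =>
    have : bser M 0 y = ∑ j ∈ range M, (-y) ^ j := by
      unfold bser
      refine sum_congr rfl fun j _ => ?_
      rw [zero_add, Nat.choose_self, neg_pow y]
      simp
    rw [this]
    have h := mul_neg_geom_sum (-y) M
    rw [neg_pow, hy] at h
    linear_combination h
  | succ E ih =>
    rw [pow_succ, mul_assoc, bser_succ, hy, mul_zero, sub_zero, ih]

/-- reduced letters -/
def gl (n m c : ℕ) (t y : R) : R :=
  if c < n then bser m (n + m - c - 1) y * ((-y) ^ (m - c) * (t * (1 + y) - y))
  else y ^ (c - n - 1) * (1 + t * y)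

theorem wl_eq_gl (n m c : ℕ) (hn : n = m + 1) (hc : c ≠ n) (t y : R) (hy : y ^ m = 0) :
    wl n m c t y = gl n m c t y * ((1 + y) ^ n * if c < n then (1 + y) ^ m else 1) := by
  subst hn
  unfold wl gl
  by_cases h : c < m + 1
  · rw [if_pos (by omega), if_pos h, if_pos h]
    have h1 := bser_mul m (m + 1 + m - c - 1) y hy
    rw [show m + 1 + m - c - 1 + 1 = m + 1 + m - c by omega] at h1
    have h2 : (1 + y) ^ (m + 1) * (1 + y) ^ m = (1 + y) ^ c * (1 + y) ^ (m + 1 + m - c) := by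
      rw [← pow_add, ← pow_add]; congr 1; omega
    linear_combination (-(-y) ^ (m - c) * (t * (1 + y) - y) * (1 + y) ^ c) * h1 -
      bser m (m + 1 + m - c - 1) y * ((-y) ^ (m - c) * (t * (1 + y) - y)) * h2
  · rw [if_neg (by omega), if_neg (by omega), if_neg h, if_neg h, show 2 * (m + 1) - 1 - m = m + 1 by omega,
      show c + m - 2 * (m + 1) = c - (m + 1) - 1 by omega]
    ring

theorem rot_final (n m l : ℕ) (hn : n = m + 1) (hl : l ≤ m) (k : Fin m → ℕ) (hk : ∀ p, k p ≠ n)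
    (hkl : ∀ p : Fin m, (p : ℕ) < l ↔ k p < n) (t : R) (y : Fin m → R) (hy : ∀ p, y p ^ m = 0) :
    (∏ p, wl n m (k p) t (y p)) * (pairProd rm y * vm y) =
      (∏ p, gl n m (k p) t (y p)) * (Rrot l y * vm y) := by
  rw [prod_congr rfl (fun p _ => wl_eq_gl n m (k p) hn (hk p) t (y p) (hy p)), prod_mul_distrib, prod_mul_distrib,
    prod_pow]
  have h1 := vand_mul_lin y hy 1 1
  simp only [one_mul, one_pow] at h1
  have h2 : ∀ N : ℕ, (∏ q, (1 + y q)) ^ N * vand y = vand y := by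
    intro N
    induction N with
    | zero => simp
    | succ N ih => rw [pow_succ, mul_assoc, h1, ih]
  have h3 := Rrot_all y hy l hl
  simp only [hkl, Rrot_zero] at h3
  unfold vm
  have h4 := h2 n
  linear_combination ((-1) ^ m.choose 2 * ∏ p, gl n m (k p) t (y p)) * h3 +
    (-1) ^ m.choose 2 * (∏ p, gl n m (k p) t (y p)) * (∏ p, if k p < n then (1 + y p) ^ m else 1) * pairProd rm y * h4

end PartB5


section PartB6

section gen
variable {R : Type*} [CommRing R]

theorem map_bser {S : Type*} [CommRing S] (φ : R →+* S) (M E : ℕ) (y : R) :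
    φ (bser M E y) = bser M E (φ y) := by
  unfold bser
  simp [map_sum]

theorem map_gl {S : Type*} [CommRing S] (φ : R →+* S) (n m c : ℕ) (t y : R) :
    φ (gl n m c t y) = gl n m c (φ t) (φ y) := by
  unfold gl
  split_ifs <;> simp [map_bser]

theorem pairProd_mul (m : ℕ) (x : Fin m → R) :
    pairProd (fun a b => a * b) x = (∏ p, x p) ^ (m - 1) := by
  induction m with
  | zero => simp [pairProd]
  | succ m ih =>
    rw [pairProd_succ, ih, prod_mul_distrib, Fin.prod_univ_succ, add_tsub_cancel_right, mul_pow]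
    simp only [prod_const, card_univ, Fintype.card_fin]
    rcases m with _ | m
    · simp
    · rw [add_tsub_cancel_right]; ring

theorem vm_eq {m : ℕ} (u : Fin m → R) : vm u = ∏ pq ∈ pairs m, (u pq.1 - u pq.2) := by
  have h : vm u = pairProd (fun a b => a - b) u := by
    unfold vm vand
    induction m with
    | zero => simp [pairProd]
    | succ m ih =>
      rw [pairProd_succ, pairProd_succ, ← ih, Nat.choose_succ_succ' m 1, Nat.choose_one_right, pow_add]
      have : ∏ q : Fin m, (u 0 - u q.succ) = (-1) ^ m * ∏ q : Fin m, (u q.succ - u 0) := by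
        have h := prod_neg (s := (univ : Finset (Fin m))) (f := fun q : Fin m => u q.succ - u 0)
        rw [card_univ, Fintype.card_fin] at h
        rw [← h]
        simp
      rw [this]
      ring
  rw [h, pairProd_eq]
  rfl

end gen

variable {K : Type*} [CommRing K]
open Polynomial

theorem coeff_bser (M E j : ℕ) : (bser M E (X : K[X])).coeff j =
    if j < M then (-1) ^ j * ((E + j).choose j : K) else 0 := by
  unfold bser
  rw [finsetSum_coeff]
  have : ∀ i, ((-1 : K[X]) ^ i * ((E + i).choose i : K[X]) * X ^ i).coeff j =
      if j = i then (-1) ^ i * ((E + i).choose i : K) else 0 := by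
    intro i
    rw [show ((-1 : K[X]) ^ i * ((E + i).choose i : K[X]) * X ^ i) = C ((-1) ^ i * ((E + i).choose i : K)) * X ^ i by simp,
      coeff_C_mul_X_pow]
  simp only [this]
  rw [sum_ite_eq]
  simp

/-- numerators -/
noncomputable def numr {R : Type*} [CommRing R] (b : Prop) [Decidable b] (x : R) : R := if b then -x else 1
/-- denominators -/
noncomputable def denr {R : Type*} [CommRing R] (b : Prop) [Decidable b] (x : R) : R := if b then 1 + x else x

theorem single_conv (n m c e : ℕ) (hn : n = m + 1) (hm : 1 ≤ m) (hc1 : 1 ≤ c) (hc : c ≠ n) (he : e ≤ 2 * (m - 1)) (t : K) :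
    (gl n m c (C t) X * X ^ e : K[X]).coeff (m - 1) = (if c < n then (-1) ^ (m - 1) else 1) *
      ((C t + X) * (numr (c < n) X ^ e * denr (c < n) X ^ (2 * (m - 1) - e)) : K[X]).coeff (AST.label n c) := by
  unfold AST.label
  by_cases h : c < n
  · rw [if_pos h, if_pos h]
    unfold gl numr denr
    simp only [if_pos h]
    have e1 : (bser m (n + m - c - 1) X * ((-X) ^ (m - c) * (C t * (1 + X) - X)) * X ^ e : K[X]) =
        C ((-1) ^ (m - c)) * ((C t * bser m (n + m - c - 1) X + C (t - 1) * bser m (n + m - c - 1) X * X) * X ^ (m - c + e)) := by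
      rw [neg_pow, pow_add]
      simp only [C_sub, C_1, C_pow, C_neg]
      ring
    have e2 : ((C t + X) * ((-X) ^ e * (1 + X) ^ (2 * (m - 1) - e)) : K[X]) =
        C ((-1) ^ e) * ((C t * (1 + X) ^ (2 * (m - 1) - e) + (1 + X) ^ (2 * (m - 1) - e) * X) * X ^ e) := by
      rw [neg_pow]
      simp only [C_1, C_pow, C_neg]
      ring
    rw [e1, e2, coeff_C_mul, coeff_C_mul, coeff_mul_X_pow', coeff_mul_X_pow']
    by_cases h1 : e ≤ c - 1
    · rw [if_pos (by omega), if_pos h1, show m - 1 - (m - c + e) = c - 1 - e by omega]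
      obtain ⟨j, hj⟩ : ∃ j, c = j + 1 + e := ⟨c - 1 - e, by omega⟩
      subst hj
      obtain ⟨d, rfl⟩ : ∃ d, m = j + 1 + e + d := ⟨m - (j + 1 + e), by omega⟩
      subst hn
      rw [show j + 1 + e - 1 - e = j by omega]
      rcases j with _ | j
      · simp only [coeff_add, coeff_bser, mul_coeff_zero, coeff_X_zero]
        rw [if_pos (by omega)]
        simp [coeff_zero_eq_eval_zero]
        rw [show 1 + e + d - 1 = e + d by omega, pow_add]
        have e3 : ((-1 : K) ^ e) * (-1) ^ e = 1 := by rw [← pow_add, Even.neg_one_pow ⟨_, rfl⟩]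
        linear_combination (-(-1) ^ d * t) * e3
      · simp only [coeff_add, coeff_C_mul, coeff_bser, coeff_mul_X]
        rw [if_pos (by omega), if_pos (by omega), coeff_one_add_X_pow, coeff_one_add_X_pow]
        set M := 2 * (j + 1 + 1 + e + d - 1) - e with hM
        rw [show j + 1 + 1 + e + d + 1 + (j + 1 + 1 + e + d) - (j + 1 + 1 + e) - 1 + (j + 1) = M + 1 by omega,
          show j + 1 + 1 + e + d + 1 + (j + 1 + 1 + e + d) - (j + 1 + 1 + e) - 1 + j = M by omega,
          Nat.choose_succ_succ', show j + 1 + 1 + e + d - (j + 1 + 1 + e) = d by omega,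
          show j + 1 + 1 + e + d - 1 = j + 1 + (e + d) by omega]
        push_cast
        rw [pow_add, pow_add, pow_succ]
        have e3 : ((-1 : K) ^ e) * (-1) ^ e = 1 := by rw [← pow_add, Even.neg_one_pow ⟨_, rfl⟩]
        linear_combination ((-1) ^ j * (-1) ^ d * (t * (M.choose (j + 1) : K) + (M.choose j : K))) * e3
    · rw [if_neg (by omega), if_neg h1]; simp
  · rw [if_neg h, if_neg h]
    unfold gl numr denr
    simp only [if_neg h]
    have e1 : (X ^ (c - n - 1) * (1 + C t * X) * X ^ e : K[X]) = X ^ (c - n - 1 + e) + C t * X ^ (c - n - 1 + e + 1) := by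
      ring
    have e2 : ((C t + X) * (1 ^ e * X ^ (2 * (m - 1) - e)) : K[X]) = X ^ (2 * (m - 1) - e + 1) + C t * X ^ (2 * (m - 1) - e) := by
      ring
    rw [e1, e2, coeff_add, coeff_add, coeff_C_mul, coeff_C_mul, coeff_X_pow, coeff_X_pow, coeff_X_pow, coeff_X_pow, one_mul]
    congr 1
    · congr 1; rw [eq_iff_iff]; omega
    · congr 2; rw [eq_iff_iff]; omega

end PartB6


section PartB7

variable {K : Type*} [CommRing K]
open MvPolynomial

theorem conv_lin {m : ℕ} (F : MvPolynomial (Fin m) K) (D : ℕ) (hF : ∀ p, F.degreeOf p ≤ D)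
    (g w N Dn : Fin m → Polynomial K) (σ : Fin m → K) (i j : Fin m → ℕ)
    (hs : ∀ p, ∀ e ≤ D, (g p * Polynomial.X ^ e).coeff (i p) = σ p * (w p * (N p ^ e * Dn p ^ (D - e))).coeff (j p)) :
    cf i ((∏ p, Polynomial.aeval (X p) (g p)) * F) = (∏ p, σ p) * cf j ((∏ p, Polynomial.aeval (X p) (w p)) *
      ∑ e ∈ F.support, C (coeff e F) * ∏ p, (Polynomial.aeval (X p : MvPolynomial (Fin m) K) (N p) ^ e p *
        Polynomial.aeval (X p : MvPolynomial (Fin m) K) (Dn p) ^ (D - e p))) := by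
  have hFs : F = ∑ e ∈ F.support, C (coeff e F) * ∏ p, X p ^ e p := by
    conv_lhs => rw [F.as_sum]
    refine sum_congr rfl fun e _ => ?_
    rw [monomial_eq, Finsupp.prod_fintype _ _ (fun _ => pow_zero _)]
  conv_lhs => rw [hFs]
  rw [mul_sum, mul_sum, cf_sum, cf_sum, mul_sum]
  refine sum_congr rfl fun e he => ?_
  have hC : ∀ (J : Fin m → ℕ) (a : K) P, cf J (C a * P) = a * cf J P := fun J a P => by
    unfold cf; rw [coeff_C_mul]
  rw [mul_left_comm, mul_left_comm _ (C _), hC, hC, mul_left_comm, ← prod_mul_distrib, ← prod_mul_distrib]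
  congr 1
  have e1 : ∀ p : Fin m, Polynomial.aeval (X p : MvPolynomial (Fin m) K) (g p) * X p ^ e p =
      Polynomial.aeval (X p) (g p * Polynomial.X ^ e p) := by
    intro p; simp
  have e2 : ∀ p : Fin m, Polynomial.aeval (X p : MvPolynomial (Fin m) K) (w p) * (Polynomial.aeval (X p) (N p) ^ e p *
      Polynomial.aeval (X p) (Dn p) ^ (D - e p)) = Polynomial.aeval (X p) (w p * (N p ^ e p * Dn p ^ (D - e p))) := by
    intro p; simp
  simp only [e1, e2]
  rw [cf_prod_aeval, cf_prod_aeval, ← prod_mul_distrib]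
  refine prod_congr rfl fun p _ => hs p _ ?_
  refine le_trans ?_ (hF p)
  rw [degreeOf_eq_sup]
  exact le_sup (f := fun e => e p) he

theorem hom_eval [IsDomain K] {m : ℕ} (F : MvPolynomial (Fin m) K) (D : ℕ) (hF : ∀ p, F.degreeOf p ≤ D)
    {L : Type*} [Field L] (ι : MvPolynomial (Fin m) K →+* L) (N Dn : Fin m → MvPolynomial (Fin m) K)
    (hD : ∀ p, ι (Dn p) ≠ 0) :
    ι (∑ e ∈ F.support, C (coeff e F) * ∏ p, (N p ^ e p * Dn p ^ (D - e p))) =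
      (∏ p, ι (Dn p)) ^ D * eval₂Hom (ι.comp C) (fun p => ι (N p) / ι (Dn p)) F := by
  rw [coe_eval₂Hom, eval₂_eq', map_sum, mul_sum]
  refine sum_congr rfl fun e he => ?_
  rw [map_mul, mul_left_comm, RingHom.comp_apply, ← prod_pow, ← prod_mul_distrib, map_prod]
  congr 1
  refine prod_congr rfl fun p _ => ?_
  have h : e p ≤ D := by
    refine le_trans ?_ (hF p)
    rw [degreeOf_eq_sup]
    exact le_sup (f := fun e => e p) he
  obtain ⟨d, hd⟩ := Nat.exists_eq_add_of_le h
  rw [hd, add_tsub_cancel_left, map_mul, map_pow, map_pow, div_pow, pow_add]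
  have := pow_ne_zero (e p) (hD p)
  field_simp

theorem deg_F [Nontrivial K] {m : ℕ} (l : ℕ) (s : Fin m) :
    (Rrot l X * vm X : MvPolynomial (Fin m) K).degreeOf s ≤ 2 * (m - 1) := by
  unfold Rrot
  rw [vm_eq, ← prod_mul_distrib]
  refine (degreeOf_prod_le _ _ _).trans ?_
  have h1 : ∀ a b : Fin m, (X a - X b : MvPolynomial (Fin m) K).degreeOf s ≤ if a = s ∨ b = s then 1 else 0 := by
    intro a b
    refine (degreeOf_sub_le _ _ _).trans ?_
    rw [degreeOf_X, degreeOf_X]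
    split_ifs <;> simp_all
  have h2 : ∀ a b c : Fin m, a ≠ b → (c = a ∨ c = b) → (1 + X c + X a * X b : MvPolynomial (Fin m) K).degreeOf s ≤ if a = s ∨ b = s then 1 else 0 := by
    intro a b c hab hc
    refine (degreeOf_add_le _ _ _).trans (max_le ((degreeOf_add_le _ _ _).trans (max_le ?_ ?_)) ((degreeOf_mul_le _ _ _).trans ?_))
    · rw [degreeOf_one]; exact Nat.zero_le _
    · rw [degreeOf_X]
      rcases hc with rfl | rfl <;> split_ifs <;> simp_all
    · rw [degreeOf_X, degreeOf_X]
      split_ifs <;> simp_all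
  have h3 : ∀ pq ∈ pairs m, (rotf l X pq * (X pq.1 - X pq.2) : MvPolynomial (Fin m) K).degreeOf s ≤
      if pq.1 = s ∨ pq.2 = s then 2 else 0 := by
    rintro ⟨a, b⟩ hab
    have hne : a ≠ b := ((mem_filter.1 hab).2 : a < b).ne
    refine (degreeOf_mul_le _ _ _).trans ?_
    have := h1 a b
    have h4 : (rotf l X (a, b) : MvPolynomial (Fin m) K).degreeOf s ≤ if a = s ∨ b = s then 1 else 0 := by
      unfold rotf
      split_ifs with h5 h6 h6
      · simpa [h6] using h2 a b a hne (Or.inl rfl)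
      · simpa [h6] using h2 a b a hne (Or.inl rfl)
      · simpa [h6] using h2 a b b hne (Or.inr rfl)
      · simpa [h6] using h2 a b b hne (Or.inr rfl)
    dsimp only
    split_ifs at * <;> omega
  refine (sum_le_sum h3).trans ?_
  rw [← sum_filter, sum_const, pairs_filter, card_image_of_injOn (pairs_inj s), card_erase_of_mem (mem_univ _), card_univ,
    Fintype.card_fin, smul_eq_mul, mul_comm]

theorem hom_F [IsDomain K] {m : ℕ} (l : ℕ) (F : MvPolynomial (Fin m) K) (hF : F = Rrot l X * vm X) :
    (∏ p : Fin m, if (p : ℕ) < l then (-1) ^ (m - 1) else 1) *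
    (∑ e ∈ F.support, C (coeff e F) * ∏ p : Fin m, (numr ((p : ℕ) < l) (X p : MvPolynomial (Fin m) K) ^ e p *
        denr ((p : ℕ) < l) (X p) ^ (2 * (m - 1) - e p))) =
      vand X * pairProd (fun x y => 1 + x + x * y) X := by
  apply IsFractionRing.injective (MvPolynomial (Fin m) K) (FractionRing (MvPolynomial (Fin m) K))
  set ι := algebraMap (MvPolynomial (Fin m) K) (FractionRing (MvPolynomial (Fin m) K)) with hι
  have hinj : Function.Injective ι := IsFractionRing.injective _ _
  have hD0 : ∀ p : Fin m, (denr ((p : ℕ) < l) (X p : MvPolynomial (Fin m) K)) ≠ 0 := by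
    intro p
    unfold denr
    split_ifs
    · intro h
      have := congrArg (eval (fun _ => (0 : K))) h
      simp at this
    · exact X_ne_zero p
  have hD : ∀ p : Fin m, ι (denr ((p : ℕ) < l) (X p : MvPolynomial (Fin m) K)) ≠ 0 := by
    intro p h
    exact hD0 p (hinj (by rw [h, map_zero]))
  rw [map_mul, hom_eval F (2 * (m - 1)) (fun p => by rw [hF]; exact deg_F l p) ι _ _ hD, hF]
  set y : Fin m → FractionRing (MvPolynomial (Fin m) K) :=
    fun p => ι (numr ((p : ℕ) < l) (X p)) / ι (denr ((p : ℕ) < l) (X p)) with hy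
  unfold Rrot vand
  rw [vm_eq, ← prod_mul_distrib, map_prod (eval₂Hom (ι.comp C) y), mul_comm 2 (m - 1), pow_mul, ← pairProd_mul]
  have e2 : ι (∏ p : Fin m, if (p : ℕ) < l then (-1) ^ (m - 1) else 1) =
      pairProd (fun a b => a * b) (fun p : Fin m => if (p : ℕ) < l then (-1 : FractionRing (MvPolynomial (Fin m) K)) else 1) := by
    rw [pairProd_mul, map_prod, ← prod_pow]
    refine prod_congr rfl fun p _ => ?_
    split_ifs <;> simp
  rw [e2, pairProd_eq, pairProd_eq, pairProd_eq, pairProd_eq, ← prod_mul_distrib, map_prod ι, ← prod_pow]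
  change (∏ pq ∈ pairs m, _) * ((∏ pq ∈ pairs m, _) * _) = ∏ pq ∈ pairs m, _
  rw [← prod_mul_distrib, ← prod_mul_distrib]
  refine prod_congr rfl ?_
  rintro ⟨a, b⟩ hab
  have hlt : (a : ℕ) < b := (mem_filter.1 hab).2
  have ha := hD a
  have hb := hD b
  have hrot : eval₂Hom (ι.comp C) y (rotf l X (a, b) * (X a - X b)) =
      (if (a : ℕ) < l ∧ l ≤ (b : ℕ) then 1 + y a + y a * y b else 1 + y b + y a * y b) * (y a - y b) := by
    unfold rotf
    rw [map_mul]
    split_ifs <;> simp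
  dsimp only
  rw [hrot]
  have e3 : ι ((X b - X a) * (1 + X a + X a * X b)) = (ι (X b) - ι (X a)) * (1 + ι (X a) + ι (X a) * ι (X b)) := by simp
  rw [e3]
  simp only [hy]
  unfold numr denr at *
  clear hrot e3 e2 hD hD0
  by_cases h1 : (a : ℕ) < l
  · by_cases h2 : (b : ℕ) < l
    · have h3 : ¬ ((a : ℕ) < l ∧ l ≤ (b : ℕ)) := by omega
      simp only [if_pos h1, if_pos h2, if_neg h3, map_neg, map_add, map_one] at *
      field_simp
      ring
    · have h3 : ((a : ℕ) < l ∧ l ≤ (b : ℕ)) := by omega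
      simp only [if_pos h1, if_neg h2, if_pos h3, map_neg, map_add, map_one] at *
      field_simp
      ring
  · have h2 : ¬ (b : ℕ) < l := by omega
    have h3 : ¬ ((a : ℕ) < l ∧ l ≤ (b : ℕ)) := by omega
    simp only [if_neg h1, if_neg h2, if_neg h3, map_one] at *
    field_simp
    ring

end PartB7


section PartB8

theorem kth_mem (S : Finset ℕ) (p : ℕ) (h : p < S.card) : kth S p ∈ S := by
  have := Nat.nth_mem (p := (· ∈ S)) p (fun hf => by
    have : hf.toFinset = S := by ext; simp
    rwa [this])
  exact this

theorem kth_lt (S : Finset ℕ) (p q : ℕ) (h : p < q) (hq : q < S.card) : kth S p < kth S q := by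
  have hf : (Set.ofPred (· ∈ S)).Finite := S.finite_toSet
  refine Nat.nth_lt_nth_of_lt_card hf h ?_
  have : hf.toFinset = S := by ext; simp
  rwa [this]

theorem kth_lt_iff (S : Finset ℕ) (p c : ℕ) (h : p < S.card) : p < cnt S c ↔ kth S p < c := by
  constructor
  · intro h1
    exact Nat.nth_lt_of_lt_count h1
  · intro h1
    by_contra h2
    have h4 := Nat.count_nth (p := (· ∈ S)) (n := p) (fun hf => by
      have : hf.toFinset = S := by ext; simp
      rwa [this])
    have h5 := Nat.count_strict_mono (p := (· ∈ S)) (kth_mem S p h) h1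
    change Nat.count (· ∈ S) (kth S p) = p at h4
    unfold cnt at h2
    omega

variable {K : Type*} [CommRing K]
open MvPolynomial

theorem Zst_red (n m : ℕ) (hm : 1 ≤ m) (t : K) (S : Finset ℕ) (hS : S ⊆ range (2 * n)) (hcard : S.card = m) :
    Zst n t m S = cf (fun _ => m - 1) ((∏ p : Fin m, wl n m (kth S p) (C t) (X p)) * (pairProd rm X * vm X)) := by
  unfold Zst
  rw [if_pos hcard, prod_cnt S (fun c p => X p * wl n m c (C t) (X p)), cnt_eq_card S _ hS, hcard]
  have hpC : ∀ j, proj j (C t : MvPolynomial ℕ K) = C t := by intro j; simp [proj]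
  have hwl : ∀ j c x, proj j (wl n m c (C t) x : MvPolynomial ℕ K) = wl n m c (C t) (proj j x) := by
    intro j c x
    have := map_wl (proj j : MvPolynomial ℕ K →ₐ[K] _).toRingHom n m c (C t) x
    simp only [AlgHom.toRingHom_eq_coe, RingHom.coe_coe, hpC] at this
    exact this
  have e1 : proj m (∏ p ∈ range m, (X p * wl n m (kth S p) (C t) (X p)) : MvPolynomial ℕ K) =
      (∏ p : Fin m, wl n m (kth S p) (C t) (X p)) * ∏ p : Fin m, X p ^ 1 := by
    rw [map_prod, ← Fin.prod_univ_eq_prod_range (fun p => proj m (X p * wl n m (kth S p) (C t) (X p) : MvPolynomial ℕ K)),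
      ← prod_mul_distrib]
    refine prod_congr rfl fun p _ => ?_
    rw [map_mul, hwl, proj_X _ _ p.2, pow_one, mul_comm]
  unfold Lam
  rw [e1, mul_right_comm, cf_mul_prod_X_pow _ _ _ (by intro p; omega)]

theorem map_Rrot {R T : Type*} [CommRing R] [CommRing T] (φ : R →+* T) {m : ℕ} (l : ℕ) (y : Fin m → R) :
    φ (Rrot l y) = Rrot l (φ ∘ y) := by
  unfold Rrot rotf
  rw [map_prod]
  refine prod_congr rfl fun p _ => ?_
  split_ifs <;> simp

theorem map_vm {R T : Type*} [CommRing R] [CommRing T] (φ : R →+* T) {m : ℕ} (y : Fin m → R) :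
    φ (vm y) = vm (φ ∘ y) := by
  unfold vm
  rw [map_mul, map_vand]
  simp

theorem Zst_final [IsDomain K] (n m : ℕ) (hn : n = m + 1) (hm : 1 ≤ m) (t : K) (S : Finset ℕ) (hS : S ⊆ range (2 * n))
    (hcard : S.card = m) (h1 : ∀ c ∈ S, 1 ≤ c ∧ c ≠ n) :
    Zst n t m S = cf (fun p : Fin m => AST.label n (kth S p))
      ((∏ p, (C t + X p)) * vand X * pairProd (fun x y => 1 + x + x * y) X) := by
  rw [Zst_red n m hm t S hS hcard]
  set l := cnt S n with hl
  have hlm : l ≤ m := by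
    have := cnt_eq_card S _ hS
    rw [← hcard, ← this]
    exact Nat.count_monotone _ (by omega)
  have hmem : ∀ p : Fin m, kth S p ∈ S := fun p => kth_mem S p (by omega)
  have hkl : ∀ p : Fin m, (p : ℕ) < l ↔ kth S p < n := fun p => kth_lt_iff S p n (by omega)
  have e1 : cf (fun _ => m - 1) ((∏ p : Fin m, wl n m (kth S p) (C t) (X p : MvPolynomial (Fin m) K)) * (pairProd rm X * vm X)) =
      cf (fun _ => m - 1) ((∏ p : Fin m, gl n m (kth S p) (C t) (X p)) * (Rrot l X * vm X)) := by
    apply cf_congr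
    set φ := Ideal.Quotient.mk (truncIdeal (K := K) (fun _ : Fin m => m - 1)) with hφ
    have := rot_final n m l hn hlm (fun p => kth S p) (fun p => (h1 _ (hmem p)).2) hkl (φ (C t)) (φ ∘ X) (by
      intro p
      rw [Function.comp_apply, ← map_pow]
      exact Ideal.Quotient.eq_zero_iff_mem.2 (X_pow_mem_truncIdeal _ p m (by omega)))
    rw [map_mul, map_mul, map_mul, map_mul, map_prod, map_prod, map_pairProd φ rm rm (by simp [rm]), map_Rrot, map_vm]
    simp only [map_wl, map_gl]
    exact this
  rw [e1]
  have e2 := conv_lin (Rrot l X * vm X : MvPolynomial (Fin m) K) (2 * (m - 1)) (fun p => deg_F l p)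
    (fun p => gl n m (kth S p) (Polynomial.C t) Polynomial.X) (fun p => Polynomial.C t + Polynomial.X)
    (fun p => numr ((p : ℕ) < l) Polynomial.X) (fun p => denr ((p : ℕ) < l) Polynomial.X)
    (fun p => if (p : ℕ) < l then (-1) ^ (m - 1) else 1) (fun _ => m - 1) (fun p => AST.label n (kth S p)) (by
      intro p e he
      have := single_conv n m (kth S p) e hn hm (h1 _ (hmem p)).1 (h1 _ (hmem p)).2 he t
      simp only [← hkl p] at this
      exact this)
  have a1 : ∀ p : Fin m, Polynomial.aeval (X p : MvPolynomial (Fin m) K) (gl n m (kth S p) (Polynomial.C t) Polynomial.X) =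
      gl n m (kth S p) (C t) (X p) := by
    intro p
    have := map_gl (Polynomial.aeval (X p : MvPolynomial (Fin m) K)).toRingHom n m (kth S p) (Polynomial.C t) Polynomial.X
    simpa using this
  have a2 : ∀ p : Fin m, Polynomial.aeval (X p : MvPolynomial (Fin m) K) (numr ((p : ℕ) < l) (Polynomial.X : Polynomial K)) = numr ((p : ℕ) < l) (X p) := by
    intro p
    unfold numr
    split_ifs <;> simp
  have a3 : ∀ p : Fin m, Polynomial.aeval (X p : MvPolynomial (Fin m) K) (denr ((p : ℕ) < l) (Polynomial.X : Polynomial K)) = denr ((p : ℕ) < l) (X p) := by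
    intro p
    unfold denr
    split_ifs <;> simp
  simp only [a1, a2, a3] at e2
  rw [e2]
  have hC : ∀ (J : Fin m → ℕ) (a : K) P, a * cf J P = cf J (C a * P) := fun J a P => by
    unfold cf; rw [coeff_C_mul]
  rw [hC, mul_assoc, ← hom_F l _ rfl, mul_left_comm]
  congr 1
  simp [map_prod, apply_ite C]

end PartB8


section PartB9

theorem kth_strict (S : Finset ℕ) (m : ℕ) (h : S.card = m) : StrictMono (fun p : Fin m => kth S p) :=
  fun a b hab => kth_lt S a b hab (by omega)

theorem kth_image (S : Finset ℕ) (m : ℕ) (h : S.card = m) : univ.image (fun p : Fin m => kth S p) = S := by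
  refine eq_of_subset_of_card_le ?_ ?_
  · intro c hc
    obtain ⟨p, _, rfl⟩ := mem_image.1 hc
    exact kth_mem S p (by omega)
  · rw [card_image_of_injective _ (kth_strict S m h).injective, card_univ, Fintype.card_fin, h]

theorem kth_unique (S : Finset ℕ) (m : ℕ) (h : S.card = m) (f : Fin m → ℕ) (hf : StrictMono f) (hS : univ.image f = S) :
    (fun p : Fin m => kth S p) = f := by
  rw [← StrictMono.range_inj (kth_strict S m h) hf]
  have := kth_image S m h
  rw [← hS] at this
  have h2 := congrArg (fun A : Finset ℕ => (A : Set ℕ)) this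
  simp only [coe_image, coe_univ, Set.image_univ] at h2
  rw [hS] at h2
  exact h2

/-- final state condition -/
def okFin (n l r : ℕ) (S : Finset ℕ) : Prop :=
  ∀ c ∈ S, 1 ≤ c ∧ c ≠ n ∧ l ≤ AST.label n c ∧ AST.label n c ≤ r

/-- inverse of the label -/
def unlabel (n j : ℕ) : ℕ := if j + 1 < n then j + 1 else j + 2

theorem label_unlabel (n j : ℕ) : AST.label n (unlabel n j) = j := by
  unfold AST.label unlabel; split_ifs <;> omega

theorem unlabel_label (n c : ℕ) (h1 : 1 ≤ c) (hc : c ≠ n) (hn : 2 ≤ n) : unlabel n (AST.label n c) = c := by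
  unfold AST.label unlabel; split_ifs <;> omega

variable {K : Type*} [CommRing K]
open MvPolynomial

open Classical in
theorem Zst_sum [IsDomain K] (n m l r : ℕ) (hn : n = m + 1) (hm : 1 ≤ m) (hr : r + 3 ≤ 2 * n) (t : K) :
    ∑ S ∈ (range (2 * n)).powerset with okFin n l r S, Zst n t m S =
      ∑ J ∈ (Fintype.piFinset (fun _ : Fin m => Icc l r)).filter StrictMono,
        cf J ((∏ p, (C t + X p)) * vand X * pairProd (fun x y => 1 + x + x * y) X) := by
  have e0 : ∑ S ∈ (range (2 * n)).powerset with okFin n l r S, Zst n t m S =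
      ∑ S ∈ ((range (2 * n)).powerset.filter (okFin n l r)).filter (fun S => S.card = m), Zst n t m S := by
    conv_rhs => rw [sum_filter]
    refine sum_congr rfl fun S _ => ?_
    by_cases h : S.card = m
    · rw [if_pos h]
    · rw [if_neg h]; unfold Zst; rw [if_neg h]
  rw [e0]
  refine sum_bij (fun S _ => fun p : Fin m => AST.label n (kth S p)) ?_ ?_ ?_ ?_
  · intro S hS
    simp only [mem_filter, mem_powerset] at hS
    obtain ⟨⟨h1, h2⟩, h3⟩ := hS
    have hmem : ∀ p : Fin m, kth S p ∈ S := fun p => kth_mem S p (by omega)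
    rw [mem_filter, Fintype.mem_piFinset]
    refine ⟨fun p => ?_, fun a b hab => ?_⟩
    · rw [mem_Icc]; exact (h2 _ (hmem p)).2.2
    · have h4 := kth_strict S m h3 hab
      have ha := h2 _ (hmem a)
      have hb := h2 _ (hmem b)
      dsimp only at h4 ⊢
      unfold AST.label
      split_ifs <;> omega
  · intro S hS S' hS' h
    simp only [mem_filter, mem_powerset] at hS hS'
    obtain ⟨⟨h1, h2⟩, h3⟩ := hS
    obtain ⟨⟨h1', h2'⟩, h3'⟩ := hS'
    rw [← kth_image S m h3, ← kth_image S' m h3']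
    congr 1
    funext p
    have ha := h2 _ (kth_mem S p (by omega))
    have hb := h2' _ (kth_mem S' p (by omega))
    have h4 := congrArg (unlabel n) (congrFun h p)
    rwa [unlabel_label _ _ ha.1 ha.2.1 (by omega), unlabel_label _ _ hb.1 hb.2.1 (by omega)] at h4
  · intro J hJ
    rw [mem_filter, Fintype.mem_piFinset] at hJ
    obtain ⟨h1, h2⟩ := hJ
    have hst : StrictMono (fun p => unlabel n (J p)) := by
      intro a b hab
      have := h2 hab
      dsimp only
      unfold unlabel
      split_ifs <;> omega
    have hc : (univ.image (fun p => unlabel n (J p))).card = m := by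
      rw [card_image_of_injective _ hst.injective, card_univ, Fintype.card_fin]
    refine ⟨univ.image (fun p => unlabel n (J p)), ?_, ?_⟩
    · simp only [mem_filter, mem_powerset]
      refine ⟨⟨?_, ?_⟩, hc⟩
      · intro c hc
        obtain ⟨p, _, rfl⟩ := mem_image.1 hc
        have := mem_Icc.1 (h1 p)
        rw [mem_range]
        unfold unlabel
        split_ifs <;> omega
      · intro c hc
        obtain ⟨p, _, rfl⟩ := mem_image.1 hc
        have := mem_Icc.1 (h1 p)
        rw [label_unlabel]
        refine ⟨?_, ?_, this⟩
        · unfold unlabel; split_ifs <;> omega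
        · unfold unlabel; split_ifs <;> omega
    · have := kth_unique _ m hc _ hst rfl
      funext p
      have h3 := congrFun this p
      rw [h3, label_unlabel]
  · intro S hS
    simp only [mem_filter, mem_powerset] at hS
    obtain ⟨⟨h1, h2⟩, h3⟩ := hS
    exact Zst_final n m hn hm t S h1 h3 (fun c hc => ⟨(h2 c hc).1, (h2 c hc).2.1⟩)

end PartB9


section PartE1

/-- alternation -/
def altSeq (a : ℕ → ℤ) : Prop := ∀ x y, x < y → a x ≠ 0 → a y ≠ 0 → (∀ z, x < z → z < y → a z = 0) → a x * a y = -1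

theorem alt_sum (a : ℕ → ℤ) (h0 : ∀ x, a x = -1 ∨ a x = 0 ∨ a x = 1) (h1 : altSeq a)
    (h2 : ∀ x, a x ≠ 0 → (∀ y, y < x → a y = 0) → a x = 1) (N : ℕ) :
    ∑ x ∈ range N, a x = 0 ∨ ∑ x ∈ range N, a x = 1 := by
  have key : ((∀ x < N, a x = 0) ∧ ∑ x ∈ range N, a x = 0) ∨
      ∃ x < N, a x ≠ 0 ∧ (∀ y, x < y → y < N → a y = 0) ∧ 2 * ∑ x ∈ range N, a x = a x + 1 := by
    induction N with
    | zero => left; simp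
    | succ N ih =>
      rw [sum_range_succ]
      by_cases hN : a N = 0
      · rcases ih with ⟨h3, h4⟩ | ⟨x, hx, h3, h4, h5⟩
        · left
          refine ⟨fun x hx => ?_, by rw [h4, hN]; rfl⟩
          rcases Nat.lt_or_ge x N with h | h
          · exact h3 x h
          · rw [show x = N by omega]; exact hN
        · right
          refine ⟨x, by omega, h3, fun y hy hy2 => ?_, by rw [hN, add_zero, h5]⟩
          rcases Nat.lt_or_ge y N with h | h
          · exact h4 y hy h
          · rw [show y = N by omega]; exact hN
      · right
        refine ⟨N, by omega, hN, fun y hy hy2 => by omega, ?_⟩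
        rcases ih with ⟨h3, h4⟩ | ⟨x, hx, h3, h4, h5⟩
        · have := h2 N hN h3
          omega
        · have h6 := h1 x N hx h3 hN h4
          rcases h0 x with h | h | h <;> rcases h0 N with h' | h' | h' <;> rw [h, h'] at h6 <;> omega
  rcases key with ⟨_, h⟩ | ⟨x, _, h3, _, h⟩
  · exact Or.inl h
  · rcases h0 x with h4 | h4 | h4 <;> omega

theorem alt_of_sum (a : ℕ → ℤ) (h : ∀ N, ∑ x ∈ range N, a x = 0 ∨ ∑ x ∈ range N, a x = 1) :
    (∀ x, a x = -1 ∨ a x = 0 ∨ a x = 1) ∧ altSeq a ∧ (∀ x, a x ≠ 0 → (∀ y, y < x → a y = 0) → a x = 1) := by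
  refine ⟨fun x => ?_, fun x y hxy hx hy hz => ?_, fun x hx hy => ?_⟩
  · have h1 := h x
    have h2 := h (x + 1)
    rw [sum_range_succ] at h2
    omega
  · have h1 := h x
    have h2 := h (x + 1)
    have h3 := h y
    have h4 := h (y + 1)
    rw [sum_range_succ] at h2 h4
    have h5 : ∑ z ∈ range y, a z = ∑ z ∈ range x, a z + a x := by
      rw [← sum_range_succ, ← sum_range_add_sum_Ico _ (by omega : x + 1 ≤ y)]
      rw [sum_eq_zero (s := Ico (x + 1) y), add_zero]
      intro z hz2
      rw [mem_Ico] at hz2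
      exact hz z (by omega) (by omega)
    have h6 : (a x = 1 ∧ a y = -1) ∨ (a x = -1 ∧ a y = 1) := by omega
    rcases h6 with ⟨h, h'⟩ | ⟨h, h'⟩ <;> rw [h, h'] <;> rfl
  · have h2 := h (x + 1)
    rw [sum_range_succ, sum_eq_zero (fun y hy' => hy y (mem_range.1 hy'))] at h2
    omega

/-- rows with total one start with a one -/
theorem alt_sum_total (a : ℕ → ℤ) (h0 : ∀ x, a x = -1 ∨ a x = 0 ∨ a x = 1) (h1 : altSeq a) (M : ℕ)
    (hM : ∑ x ∈ range M, a x = 1) (N : ℕ) :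
    ∑ x ∈ range N, a x = 0 ∨ ∑ x ∈ range N, a x = 1 := by
  refine alt_sum a h0 h1 ?_ N
  intro x hx hy
  by_contra hne
  have hx1 : a x = -1 := by rcases h0 x with h | h | h <;> simp_all
  have := alt_sum (fun z => - a z) (fun z => by rcases h0 z with h | h | h <;> simp [h])
    (fun u v huv hu hv hz => by
      have := h1 u v huv (by simpa using hu) (by simpa using hv) (fun z h2 h3 => by simpa using hz z h2 h3)
      simpa using this)
    (fun u hu hv => by
      have h3 : u = x := by
        rcases lt_trichotomy u x with h | h | h
        · exact absurd (hy u h) (by simpa using hu)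
        · exact h
        · have := hv x h
          simp [hx1] at this
      simp [h3, hx1]) M
  simp only [sum_neg_distrib, hM] at this
  omega

/-- indicator difference sums -/
theorem cnt_diff (S S' : Finset ℕ) (d : ℕ) :
    (cnt S' d : ℤ) - cnt S d = ∑ j ∈ range d, ((if j ∈ S' then 1 else 0) - (if j ∈ S then 1 else 0)) := by
  induction d with
  | zero => simp [cnt_zero]
  | succ d ih =>
    rw [sum_range_succ, ← ih, cnt_succ, cnt_succ]
    push_cast
    ring

namespace AST
variable {n : ℕ} (T : AST n)

/-- column partial sums -/
def psum (i j : ℕ) : ℤ := ∑ x ∈ range (i + 1), T.entry x j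

theorem entry_row_zero (j : ℕ) : T.entry 0 j = 0 := by
  by_contra h
  have := T.support 0 j h
  omega

theorem psum_zero (j : ℕ) : T.psum 0 j = 0 := by
  unfold psum; simp [entry_row_zero]

theorem psum_succ (i j : ℕ) : T.psum (i + 1) j = T.psum i j + T.entry (i + 1) j := by
  unfold psum; rw [sum_range_succ]

theorem psum_01 (i j : ℕ) : T.psum i j = 0 ∨ T.psum i j = 1 :=
  alt_sum (fun x => T.entry x j) (fun x => T.entries x j) (fun x y => T.altCol j x y) (fun x => T.topOne x j) _

theorem entry_out (i j : ℕ) (h : ¬ (1 ≤ i ∧ i ≤ n ∧ i ≤ j ∧ j ≤ 2 * n - i)) : T.entry i j = 0 := by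
  by_contra h'
  exact h (T.support i j h')

theorem row_total (i : ℕ) (h1 : 1 ≤ i) (h2 : i ≤ n) : ∑ j ∈ range (2 * n), T.entry i j = 1 := by
  rw [← T.rowSum i h1 h2, eq_comm]
  refine sum_subset ?_ ?_
  · intro j hj
    rw [mem_Icc] at hj
    rw [mem_range]
    omega
  · intro j _ hj
    rw [mem_Icc] at hj
    exact T.entry_out i j (by omega)

theorem row_01 (i : ℕ) (h1 : 1 ≤ i) (h2 : i ≤ n) (d : ℕ) :
    ∑ j ∈ range d, T.entry i j = 0 ∨ ∑ j ∈ range d, T.entry i j = 1 :=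
  alt_sum_total (fun x => T.entry i x) (fun x => T.entries i x) (fun x y => T.altRow i x y) _ (T.row_total i h1 h2) d

/-- states -/
def st (i : ℕ) : Finset ℕ := (range (2 * n)).filter (fun j => T.psum i j = 1)

theorem psum_big (i j : ℕ) (h : 2 * n ≤ j) : T.psum i j = 0 := by
  refine sum_eq_zero fun x _ => T.entry_out x j (by omega)

theorem mem_st (i j : ℕ) : j ∈ T.st i ↔ T.psum i j = 1 := by
  unfold st
  rw [mem_filter, mem_range]
  constructor
  · exact fun h => h.2
  · intro h
    refine ⟨?_, h⟩
    by_contra h2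
    rw [T.psum_big i j (by omega)] at h
    omega

theorem psum_eq (i j : ℕ) : T.psum i j = if j ∈ T.st i then 1 else 0 := by
  rcases T.psum_01 i j with h | h <;> simp [mem_st, h]

theorem st_cnt (i d : ℕ) : (cnt (T.st (i + 1)) d : ℤ) - cnt (T.st i) d = ∑ j ∈ range d, T.entry (i + 1) j := by
  rw [cnt_diff]
  refine sum_congr rfl fun j _ => ?_
  rw [← psum_eq, ← psum_eq, psum_succ]
  ring

theorem st_T (i : ℕ) (hi : i + 1 ≤ n) : Tst n i (T.st i) (T.st (i + 1)) := by
  refine ⟨⟨fun d _ => ?_, fun c hc hf => ?_⟩, ?_⟩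
  · have h1 := T.st_cnt i d
    have h2 := T.row_01 (i + 1) (by omega) hi d
    omega
  · rw [mem_st, mem_st, psum_succ, T.entry_out (i + 1) c, add_zero]
    unfold frz at hf
    omega
  · have h1 := T.st_cnt i (2 * n)
    rw [T.row_total (i + 1) (by omega) hi] at h1
    omega

end AST

/-- the triangle of a chain of states -/
def ofChain (n : ℕ) (σ : ℕ → Finset ℕ) (h0 : σ 0 = ∅) (hT : ∀ i < n, Tst n i (σ i) (σ (i + 1)))
    (hs : ∀ i, σ i ⊆ range (2 * n)) (hc : ∀ i, n ≤ i → σ (i + 1) = σ i) : AST n :=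
  have hcol : ∀ j N, ∑ x ∈ range N, (if x = 0 then (0 : ℤ) else (if j ∈ σ x then 1 else 0) - (if j ∈ σ (x - 1) then 1 else 0)) =
      if j ∈ σ (N - 1) then 1 else 0 := by
    intro j N
    induction N with
    | zero => simp [h0]
    | succ N ih =>
      rw [sum_range_succ, ih]
      rcases N with _ | N
      · simp [h0]
      · simp
  have hrow : ∀ i, 1 ≤ i → i ≤ n → ∀ d, ∑ j ∈ range d, (if i = 0 then (0 : ℤ) else (if j ∈ σ i then 1 else 0) - (if j ∈ σ (i - 1) then 1 else 0)) =
      (cnt (σ i) d : ℤ) - cnt (σ (i - 1)) d := by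
    intro i hi _ d
    rw [cnt_diff]
    refine sum_congr rfl fun j _ => ?_
    rw [if_neg (by omega)]
  have hbig : ∀ i j, 2 * n ≤ j → j ∉ σ i := by
    intro i j hj h
    have := mem_range.1 (hs i h)
    omega
  have hsup : ∀ i j, (if i = 0 then (0 : ℤ) else (if j ∈ σ i then 1 else 0) - (if j ∈ σ (i - 1) then 1 else 0)) ≠ 0 →
      1 ≤ i ∧ i ≤ n ∧ i ≤ j ∧ j ≤ 2 * n - i := by
    intro i j h
    rcases i with _ | i
    · simp at h
    · rw [if_neg (by omega), add_tsub_cancel_right] at h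
      have hin : i < n := by
        by_contra h'
        rw [hc i (by omega)] at h
        simp at h
      refine ⟨by omega, by omega, ?_⟩
      have hj : j < 2 * n := by
        by_contra h'
        simp [hbig _ j (by omega)] at h
      by_contra h'
      have := (hT i hin).1.2 j hj (by unfold frz; omega)
      simp [this] at h
  have hrowd : ∀ i d, ∑ j ∈ range d, (if i = 0 then (0 : ℤ) else (if j ∈ σ i then 1 else 0) - (if j ∈ σ (i - 1) then 1 else 0)) = 0 ∨
      ∑ j ∈ range d, (if i = 0 then (0 : ℤ) else (if j ∈ σ i then 1 else 0) - (if j ∈ σ (i - 1) then 1 else 0)) = 1 := by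
    intro i d
    by_cases hi : 1 ≤ i ∧ i ≤ n
    · have hle : ∀ d ≤ 2 * n, (cnt (σ i) d : ℤ) - cnt (σ (i - 1)) d = 0 ∨ (cnt (σ i) d : ℤ) - cnt (σ (i - 1)) d = 1 := by
        intro d hd
        have := (hT (i - 1) (by omega)).1.1 d hd
        rw [show i - 1 + 1 = i by omega] at this
        omega
      rcases Nat.lt_or_ge d (2 * n) with h | h
      · rw [hrow i hi.1 hi.2]; exact hle d h.le
      · rw [← sum_range_add_sum_Ico _ h, hrow i hi.1 hi.2, sum_eq_zero (s := Ico (2 * n) d), add_zero]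
        · exact hle _ le_rfl
        · intro j hj
          rw [mem_Ico] at hj
          simp [hbig _ j hj.1]
    · left
      refine sum_eq_zero fun j _ => ?_
      by_contra h
      exact hi ⟨(hsup i j h).1, (hsup i j h).2.1⟩
  have hcold : ∀ j N, ∑ x ∈ range N, (if x = 0 then (0 : ℤ) else (if j ∈ σ x then 1 else 0) - (if j ∈ σ (x - 1) then 1 else 0)) = 0 ∨
    ∑ x ∈ range N, (if x = 0 then (0 : ℤ) else (if j ∈ σ x then 1 else 0) - (if j ∈ σ (x - 1) then 1 else 0)) = 1 := by
    intro j N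
    rw [hcol]
    split_ifs <;> simp
  { entry := fun i j => if i = 0 then 0 else (if j ∈ σ i then 1 else 0) - (if j ∈ σ (i - 1) then 1 else 0)
    support := hsup
    entries := fun i j => (alt_of_sum _ (hcold j)).1 i
    rowSum := fun i h1 h2 => by
      have h3 := hrow i h1 h2 (2 * n)
      have h4 := (hT (i - 1) (by omega)).2
      rw [show i - 1 + 1 = i by omega] at h4
      rw [h4] at h3
      push_cast at h3
      rw [add_sub_cancel_left] at h3
      refine Eq.trans (sum_subset ?_ ?_) h3
      · intro j hj
        rw [mem_Icc] at hj
        rw [mem_range]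
        omega
      · intro j _ hj
        rw [mem_Icc] at hj
        by_contra h
        exact hj (hsup i j h).2.2
    altRow := fun i => (alt_of_sum _ (hrowd i)).2.1
    altCol := fun j => (alt_of_sum _ (hcold j)).2.1
    topOne := fun i j => (alt_of_sum _ (hcold j)).2.2 i }

theorem st_ofChain (n : ℕ) (σ : ℕ → Finset ℕ) (h0 : σ 0 = ∅) (hT : ∀ i < n, Tst n i (σ i) (σ (i + 1)))
    (hs : ∀ i, σ i ⊆ range (2 * n)) (hc : ∀ i, n ≤ i → σ (i + 1) = σ i) (i : ℕ) :
    (ofChain n σ h0 hT hs hc).st i = σ i := by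
  have h : ∀ j, (ofChain n σ h0 hT hs hc).psum i j = if j ∈ σ i then 1 else 0 := by
    intro j
    induction i with
    | zero => rw [AST.psum_zero, h0]; simp
    | succ i ih =>
      rw [AST.psum_succ, ih]
      simp [ofChain]
  ext j
  rw [AST.mem_st, h]
  simp

end PartE1


section PartE2

namespace AST
variable {n : ℕ} (T : AST n)

theorem psum_stable (i k j : ℕ) (h : j ≤ i ∨ 2 * n - j ≤ i) : T.psum (i + k) j = T.psum i j := by
  induction k with
  | zero => rfl
  | succ k ih =>
    rw [← add_assoc, psum_succ, ih, T.entry_out (i + k + 1) j (by omega), add_zero]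

theorem colSum_eq (j : ℕ) : T.colSum j = T.psum n j := by
  unfold colSum psum
  refine sum_subset ?_ ?_
  · intro x hx
    rw [mem_Icc] at hx
    rw [mem_range]
    omega
  · intro x hx hx2
    rw [mem_range] at hx
    rw [mem_Icc] at hx2
    exact T.entry_out x j (by omega)

theorem colSum_eq_of (i j : ℕ) (hi : i ≤ n) (h : j ≤ i ∨ 2 * n - j ≤ i) : T.colSum j = T.psum i j := by
  rw [colSum_eq, ← T.psum_stable i (n - i) j h]
  congr 1
  omega

theorem entry_last : T.entry n n = if n = 0 then 0 else 1 := by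
  split_ifs with h
  · exact T.entry_out _ _ (by omega)
  · have := T.rowSum n (by omega) le_rfl
    rwa [show 2 * n - n = n by omega, Icc_self, sum_singleton] at this

theorem eleven_iff (i : ℕ) (hi : i + 2 ≤ n) :
    T.IsElevenCol (i + 1) ↔ i + 1 ∈ T.st (i + 1) ∧ i + 1 ∉ T.st i := by
  unfold IsElevenCol bottom
  rw [T.colSum_eq_of (i + 1) (i + 1) (by omega) (by omega), mem_st, mem_st,
    show min (i + 1) (2 * n - (i + 1)) = i + 1 by omega]
  have h1 := T.psum_succ i (i + 1)
  have h2 := T.psum_01 i (i + 1)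
  have h3 := T.psum_01 (i + 1) (i + 1)
  omega

theorem ten_iff (i : ℕ) (hi : i + 2 ≤ n) :
    T.IsTenCol (2 * n - i - 1) ↔ 2 * n - i - 1 ∈ T.st i ∧ 2 * n - i - 1 ∈ T.st (i + 1) := by
  unfold IsTenCol bottom
  rw [T.colSum_eq_of (i + 1) (2 * n - i - 1) (by omega) (by omega), mem_st, mem_st,
    show min (2 * n - i - 1) (2 * n - (2 * n - i - 1)) = i + 1 by omega]
  have h1 := T.psum_succ i (2 * n - i - 1)
  have h2 := T.psum_01 i (2 * n - i - 1)
  have h3 := T.psum_01 (i + 1) (2 * n - i - 1)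
  omega

theorem rho_eq (m : ℕ) (hn : n = m + 1) :
    T.rho = 1 + ∑ i ∈ range m, est n i (T.st i) (T.st (i + 1)) := by
  unfold rho est
  rw [sum_add_distrib, add_assoc, card_filter, card_filter]
  congr 2
  · refine sum_nbij' (fun j => j - 1) (fun i => i + 1) ?_ ?_ ?_ ?_ ?_
    · intro j hj; rw [mem_Icc] at hj; rw [mem_range]; omega
    · intro j hj; rw [mem_range] at hj; rw [mem_Icc]; omega
    · intro j hj; rw [mem_Icc] at hj; omega
    · intro j hj; omega
    · intro j hj
      rw [mem_Icc] at hj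
      obtain ⟨i, rfl⟩ : ∃ i, j = i + 1 := ⟨j - 1, by omega⟩
      simp only [add_tsub_cancel_right]
      exact if_congr (T.eleven_iff i (by omega)) rfl rfl
  · refine sum_nbij' (fun j => 2 * n - j - 1) (fun i => 2 * n - i - 1) ?_ ?_ ?_ ?_ ?_
    · intro j hj; rw [mem_Icc] at hj; rw [mem_range]; omega
    · intro j hj; rw [mem_range] at hj; rw [mem_Icc]; omega
    · intro j hj; rw [mem_Icc] at hj; omega
    · intro j hj; rw [mem_range] at hj; omega
    · intro j hj
      rw [mem_Icc] at hj
      obtain ⟨i, hi, rfl⟩ : ∃ i, i + 2 ≤ n ∧ j = 2 * n - i - 1 := ⟨2 * n - j - 1, by omega, by omega⟩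
      rw [show 2 * n - (2 * n - i - 1) - 1 = i by omega]
      exact if_congr (T.ten_iff i (by omega)) rfl rfl

theorem okFin_iff (m l r : ℕ) (hn : n = m + 1) : T.IsASP l r ↔ okFin n l r (T.st m) := by
  have key : ∀ j, j ≠ n → (T.IsOneCol j ↔ j ∈ T.st m) := by
    intro j hj
    unfold IsOneCol
    rw [T.colSum_eq_of m j (by omega) (by omega), mem_st]
  constructor
  · intro h c hc
    have h0 : 1 ≤ c := by
      by_contra h'
      rw [mem_st, show c = 0 by omega] at hc
      have : T.psum m 0 = 0 := sum_eq_zero fun x _ => T.entry_out x 0 (by omega)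
      omega
    have h1 : c ≠ n := by
      rintro rfl
      rw [mem_st] at hc
      have h2 := T.psum_succ m c
      have h3 := T.psum_01 (m + 1) c
      rw [← hn, T.entry_last, if_neg (by omega)] at h2
      rw [← hn] at h3
      omega
    have h2 : c < 2 * n := mem_range.1 (mem_filter.1 hc).1
    exact ⟨h0, h1, h c h0 (by omega) h1 ((key c h1).2 hc)⟩
  · intro h j _ _ h3 h4
    exact (h j ((key j h3).1 h4)).2.2

theorem st_inj (m : ℕ) (hn : n = m + 1) (T T' : AST n) (h : ∀ i ≤ m, T.st i = T'.st i) : T = T' := by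
  have hp : ∀ i ≤ m, ∀ j, T.psum i j = T'.psum i j := by
    intro i hi j
    rw [psum_eq, psum_eq, h i hi]
  have he : T.entry = T'.entry := by
    funext i j
    rcases i with _ | i
    · rw [entry_row_zero, entry_row_zero]
    · rcases lt_trichotomy i m with hi | hi | hi
      · have h1 := T.psum_succ i j
        have h2 := T'.psum_succ i j
        rw [hp i (by omega), hp (i + 1) (by omega)] at h1
        omega
      · by_cases hj : j = n
        · rw [hj, hi, ← hn, entry_last, entry_last]
        · rw [T.entry_out _ _ (by omega), T'.entry_out _ _ (by omega)]
      · rw [T.entry_out _ _ (by omega), T'.entry_out _ _ (by omega)]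
  cases T
  cases T'
  simp only at he
  subst he
  rfl

end AST

open Classical in
/-- chains of states -/
noncomputable def astPaths (n m l r : ℕ) : Finset (Fin (m + 1) → Finset ℕ) :=
  (Fintype.piFinset (fun _ : Fin (m + 1) => (range (2 * n)).powerset)).filter
    (fun π => π 0 = ∅ ∧ (∀ i : Fin m, Tst n i (π i.castSucc) (π i.succ)) ∧ okFin n l r (π (Fin.last m)))

theorem cnt_insert_gt (S : Finset ℕ) (C d : ℕ) (hC : C ∉ S) (h : C < d) : cnt (insert C S) d = cnt S d + 1 := by
  induction d with
  | zero => omega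
  | succ d ih =>
    rw [cnt_succ, cnt_succ]
    rcases Nat.lt_or_ge C d with h' | h'
    · rw [ih h']
      have : d ∈ insert C S ↔ d ∈ S := by
        rw [mem_insert]
        constructor
        · rintro (h | h)
          · omega
          · exact h
        · exact Or.inr
      simp only [this]
      omega
    · obtain rfl : C = d := by omega
      rw [cnt_insert S C C le_rfl]
      simp [hC]

theorem Tst_last (n m : ℕ) (hn : n = m + 1) (S : Finset ℕ) (hS : n ∉ S) : Tst n m S (insert n S) := by
  refine ⟨⟨fun d _ => ?_, fun c hc hf => ?_⟩, ?_⟩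
  · rcases Nat.lt_or_ge n d with h | h
    · rw [cnt_insert_gt S n d hS h]; omega
    · rw [cnt_insert S n d h]; omega
  · rw [mem_insert]
    unfold frz at hf
    constructor
    · exact Or.inr
    · rintro (h | h)
      · omega
      · exact h
  · exact cnt_insert_gt S n _ hS (by omega)

open Classical in
theorem ast_card (n m l r p : ℕ) (hn : n = m + 1) :
    Nat.card {T : AST n // T.IsASP l r ∧ T.rho = p} =
      ((astPaths n m l r).filter fun π => 1 + ∑ i : Fin m, est n i (π i.castSucc) (π i.succ) = p).card := by
  refine natCard_eq_of_bij (fun T : AST n => T.IsASP l r ∧ T.rho = p) _ (fun T i => T.st i) ?_ ?_ ?_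
  · intro T T' h
    refine AST.st_inj m hn T T' fun i hi => ?_
    exact congrFun h ⟨i, by omega⟩
  · rintro T ⟨h1, h2⟩
    unfold astPaths
    rw [mem_filter, mem_filter, Fintype.mem_piFinset]
    refine ⟨⟨fun i => ?_, ?_, fun i => ?_, ?_⟩, ?_⟩
    · rw [mem_powerset]; exact filter_subset _ _
    · ext j
      simp [AST.mem_st, AST.psum_zero]
    · exact T.st_T i (by omega)
    · exact (T.okFin_iff m l r hn).1 h1
    · rw [← h2, T.rho_eq m hn, Finset.sum_range]
      rfl
  · intro π hπ
    unfold astPaths at hπ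
    rw [mem_filter, mem_filter, Fintype.mem_piFinset] at hπ
    obtain ⟨⟨hA, h0, hT, hF⟩, hρ⟩ := hπ
    have hnF : n ∉ π (Fin.last m) := fun h => (hF n h).2.1 rfl
    let σ : ℕ → Finset ℕ := fun i => if h : i ≤ m then π ⟨i, by omega⟩ else insert n (π (Fin.last m))
    have hσ : ∀ i (h : i ≤ m), σ i = π ⟨i, by omega⟩ := fun i h => dif_pos h
    have hσ2 : ∀ i, m < i → σ i = insert n (π (Fin.last m)) := fun i h => dif_neg (by omega)
    have k0 : σ 0 = ∅ := by rw [hσ 0 (by omega)]; exact h0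
    have kT : ∀ i < n, Tst n i (σ i) (σ (i + 1)) := by
      intro i hi
      rcases Nat.lt_or_ge i m with h | h
      · rw [hσ i h.le, hσ (i + 1) h]
        exact hT ⟨i, h⟩
      · obtain rfl : i = m := by omega
        rw [hσ i le_rfl, hσ2 (i + 1) (by omega)]
        exact Tst_last n i hn _ hnF
    have ks : ∀ i, σ i ⊆ range (2 * n) := by
      intro i
      rcases Nat.lt_or_ge m i with h | h
      · rw [hσ2 i h]
        refine insert_subset (mem_range.2 (by omega)) (mem_powerset.1 (hA _))
      · rw [hσ i h]
        exact mem_powerset.1 (hA _)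
    have kc : ∀ i, n ≤ i → σ (i + 1) = σ i := by
      intro i hi
      rw [hσ2 _ (by omega), hσ2 _ (by omega)]
    have hf : ∀ i : Fin (m + 1), (ofChain n σ k0 kT ks kc).st i = π i := by
      intro i
      rw [st_ofChain, hσ i (by omega)]
    refine ⟨ofChain n σ k0 kT ks kc, ⟨?_, ?_⟩, ?_⟩
    · rw [AST.okFin_iff _ m l r hn]
      have := hf (Fin.last m)
      rw [Fin.val_last] at this
      rw [this]
      exact hF
    · rw [← hρ, AST.rho_eq _ m hn, Finset.sum_range]
      congr 1
      refine sum_congr rfl fun i _ => ?_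
      rw [← hf i.castSucc, ← hf i.succ]
      rfl
    · funext i
      exact hf i

end PartE2


section PartF1

theorem card_of_gf {α : Type*} (s : Finset α) (f : α → ℕ) (p : ℕ) :
    (((s.filter fun x => 1 + f x = p).card : ℕ) : ℤ) =
      if p = 0 then 0 else (∑ x ∈ s, (Polynomial.X : Polynomial ℤ) ^ f x).coeff (p - 1) := by
  rw [Polynomial.finsetSum_coeff, card_filter]
  simp only [Polynomial.coeff_X_pow]
  push_cast
  split_ifs with h
  · refine sum_eq_zero fun x _ => if_neg (by omega)
  · refine sum_congr rfl fun x _ => ?_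
    exact if_congr (by omega) rfl rfl

end PartF1

/-- **Main theorem.** For `1 ≤ p ≤ n`, `0 ≤ l ≤ n-2 < r ≤ 2n-3` with
`l + r < 2n - 2` and `r - l > n - 3`, the number of `(n,l,r)`-alternating sign pentagons `P`
with `ρ(P) = p` equals the number of `(0, n, r+2-n, r-l)`-Magog pentagons `M` with `τ(M) = p`. -/
theorem card_ASP_eq_card_magogPentagon (n l r p : ℕ) (hp1 : 1 ≤ p) (hpn : p ≤ n)
    (hl : l + 2 ≤ n) (hr1 : n < r + 2) (hr2 : r + 3 ≤ 2 * n)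
    (hlr : l + r + 2 < 2 * n) (hwide : l + n < r + 3) :
    Nat.card {P : AST n // P.IsASP l r ∧ P.rho = p}
      = Nat.card {M : MagogPentagon 0 n (r + 2 - n) (r - l) // M.tau = (p : ℤ)} := by
  classical
  obtain ⟨a, rfl⟩ : ∃ a, n = a + 2 := ⟨n - 2, by omega⟩
  rw [magog_card a (r + 2 - (a + 2)) (r - l + 3 - (a + 2)) (r - l) p (by omega) (by omega) (by omega),
    ast_card (a + 2) (a + 1) l r p rfl]
  have hmag := mag_gf a (r + 2 - (a + 2)) (r - l + 3 - (a + 2)) (Polynomial.X : Polynomial ℤ)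
    (by omega) (by omega)
  have hA := theoremA_sum (a + 1) l r (by omega) (Polynomial.X : Polynomial ℤ)
  have hast := chain_gf (range (2 * (a + 2))).powerset ∅ (a + 1) (Polynomial.X : Polynomial ℤ)
    (Tst (a + 2)) (est (a + 2)) (okFin (a + 2) l r) (Zst (a + 2) Polynomial.X)
    (fun S _ => by convert Zst_zero (a + 2) (Polynomial.X : Polynomial ℤ) S)
    (fun i hi S hS => by convert Zst_step (a + 2) (Polynomial.X : Polynomial ℤ) i (by omega) S hS)
  rw [Zst_sum (a + 2) (a + 1) l r rfl (by omega) hr2, hA] at hast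
  rw [show r + 2 - (a + 2) + a = r by omega,
    show r - l + 3 - (a + 2) + a = r - l + 1 by omega, ← hast] at hmag
  have h1 := card_of_gf (astPaths (a + 2) (a + 1) l r)
    (fun π => ∑ i : Fin (a + 1), est (a + 2) i (π i.castSucc) (π i.succ)) p
  have h2 := card_of_gf (magPaths a (r + 2 - (a + 2)) (r - l + 3 - (a + 2)))
    (fun π => ((range (a + 1)).filter fun p =>
        π (Fin.last a).castSucc p = π (Fin.last (a + 1)) p).card) p
  have h3 : ∑ π ∈ astPaths (a + 2) (a + 1) l r, (Polynomial.X : Polynomial ℤ) ^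
      (∑ i : Fin (a + 1), est (a + 2) i (π i.castSucc) (π i.succ)) =
      ∑ π ∈ magPaths a (r + 2 - (a + 2)) (r - l + 3 - (a + 2)), (Polynomial.X : Polynomial ℤ) ^
      (((range (a + 1)).filter fun p =>
        π (Fin.last a).castSucc p = π (Fin.last (a + 1)) p).card) := by
    unfold astPaths magPaths
    convert hmag.symm
  rw [h3] at h1
  have h4 := h1.trans h2.symm
  convert (Nat.cast_injective (R := ℤ)) h4
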